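/- arXiv:1807.03423 — 8 statements merged into one kernel-verified Lean document; each statement's English description precedes it below -/
import Mathlib

section
/- Let A ∈ GL(k,ℤ) and let G = ℤ^k ⋊_A ℤ, the semidirect product in which a fixed generator of ℤ acts on ℤ^k by A. Regard ℚ^k as a ℚ[x]-module with x acting as A, so that ℚ^k ≅ ⊕_{j=1}^b ℚ[x]/(a_j) with a_1 | a_2 | ⋯ | a_b monic non-units (the invariant factors of A, so b is the number of blocks in the rational canonical form of A and a_1 is the characteristic polynomial of the smallest block). Let ρ₁ be the number of distinct roots of a_1 in ℂ. Then there is a constant C such that m_n(G) ≤ ρ₁·n^b + C·n^{b−1} for all sufficiently large n, and m_n(G) ≥ ρ₁·n^b for infinitely many n; in particular m_n(G) grows like a polynomial of degree b with leading coefficient ρ₁. -/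
open Polynomial

/-- The number of maximal subgroups of `G` of index `n`. -/
noncomputable def maxSubgroupCount (G : Type*) [Group G] (n : ℕ) : ℕ :=
  Nat.card {H : Subgroup G // IsCoatom H ∧ H.index = n}

/-- The semidirect product `ℤ^k ⋊_A ℤ` in which a fixed generator of `ℤ` acts on `ℤ^k`
via the matrix `A ∈ GL(k, ℤ)`. -/
abbrev zkByZ (k : ℕ) (A : Matrix.GeneralLinearGroup (Fin k) ℤ) : Type :=
  SemidirectProduct (Multiplicative (Fin k → ℤ)) (Multiplicative ℤ)
    (zpowersHom (MulAut (Multiplicative (Fin k → ℤ)))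
      (AddEquiv.toMultiplicative
        ((LinearMap.GeneralLinearGroup.generalLinearEquiv ℤ (Fin k → ℤ)
          (Matrix.GeneralLinearGroup.toLin A)).toAddEquiv)))

/-- The extension of an abelian group by `ℤ` acting through an automorphism. -/
abbrev ZExtension {N : Type*} [AddCommGroup N] (φ : N ≃+ N) : Type _ :=
  SemidirectProduct (Multiplicative N) (Multiplicative ℤ)
    (zpowersHom (MulAut (Multiplicative N)) (AddEquiv.toMultiplicative φ))

namespace ZExtension
open SemidirectProduct Multiplicative

variable {N : Type*} [AddCommGroup N] {φ : N ≃+ N}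

/-- The inclusion of the base. -/
def base (φ : N ≃+ N) : Multiplicative N →* ZExtension φ := inl

/-- The stable letter. -/
def stable (φ : N ≃+ N) : ZExtension φ := inr (ofAdd 1)

theorem base_apply_map (w : N) :
    base φ (ofAdd (φ w)) = stable φ * base φ (ofAdd w) * (stable φ)⁻¹ := by
  have h := inl_aut (φ := zpowersHom (MulAut (Multiplicative N)) (AddEquiv.toMultiplicative φ))
    (ofAdd 1) (ofAdd w)
  rw [zpowersHom_apply, toAdd_ofAdd, zpow_one] at h
  simpa [base, stable] using h

theorem range_base_eq_ker : (base φ).range = (rightHom : ZExtension φ →* _).ker :=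
  range_inl_eq_ker_rightHom

instance : (base φ).range.Normal := by rw [range_base_eq_ker]; infer_instance

/-- The elements of the base lying in `H`. -/
def trace (H : Subgroup (ZExtension φ)) : AddSubgroup N :=
  Subgroup.toAddSubgroup' (H.comap (base φ))

theorem mem_trace {H : Subgroup (ZExtension φ)} {w : N} :
    w ∈ trace H ↔ base φ (ofAdd w) ∈ H := Iff.rfl

theorem le_of_trace_le {H K : Subgroup (ZExtension φ)} (h : trace H ≤ trace K) {v : N}
    (hH : base φ (ofAdd v) * stable φ ∈ H) (hK : base φ (ofAdd v) * stable φ ∈ K) : H ≤ K := by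
  intro g hg
  set s := base φ (ofAdd v) * stable φ
  have hs : rightHom s = (ofAdd 1 : Multiplicative ℤ) := by
    simp [s, base, stable]
  set j : ℤ := toAdd (rightHom g)
  have hk : g * s ^ (-j) ∈ (base φ).range := by
    rw [range_base_eq_ker, MonoidHom.mem_ker, map_mul, map_zpow, hs, ← ofAdd_zsmul]
    simp [j]
  obtain ⟨w, hw⟩ := hk
  have hw' : toAdd w ∈ trace H := by
    rw [mem_trace, ofAdd_toAdd, hw]
    exact H.mul_mem hg (H.zpow_mem hH _)
  have := mem_trace.1 (h hw')
  rw [ofAdd_toAdd, hw] at this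
  have := K.mul_mem this (K.zpow_mem hK j)
  simpa using this

theorem map_mem_trace {H : Subgroup (ZExtension φ)} {v : N}
    (hv : base φ (ofAdd v) * stable φ ∈ H) {w : N} : φ w ∈ trace H ↔ w ∈ trace H := by
  have : base φ (ofAdd (φ w)) = (base φ (ofAdd v) * stable φ) * base φ (ofAdd w) *
      (base φ (ofAdd v) * stable φ)⁻¹ := by
    have h1 : base φ (ofAdd (φ w)) =
        base φ (ofAdd v) * base φ (ofAdd (φ w)) * (base φ (ofAdd v))⁻¹ := by
      rw [← map_mul, mul_comm, map_mul, mul_inv_cancel_right]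
    rw [h1, base_apply_map]
    group
  rw [mem_trace, mem_trace, this, H.mul_mem_cancel_right (H.inv_mem hv),
    H.mul_mem_cancel_left hv]

theorem sup_base_eq_top {H : Subgroup (ZExtension φ)} (hH : IsCoatom H)
    (hb : ¬ (base φ).range ≤ H) : H ⊔ (base φ).range = ⊤ :=
  hH.2 _ (lt_of_le_of_ne le_sup_left fun h ↦ hb (h ▸ le_sup_right))

theorem exists_base_mul_stable_mem {H : Subgroup (ZExtension φ)}
    (hH : H ⊔ (base φ).range = ⊤) : ∃ v, base φ (ofAdd v) * stable φ ∈ H := by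
  have : stable φ ∈ (base φ).range ⊔ H := by rw [sup_comm, hH]; trivial
  rw [← SetLike.mem_coe, Subgroup.normal_mul] at this
  obtain ⟨_, ⟨w, rfl⟩, h, hh, e⟩ := this
  refine ⟨toAdd w⁻¹, ?_⟩
  rw [← e]
  simpa using hh

theorem index_trace {H : Subgroup (ZExtension φ)} (hH : H ⊔ (base φ).range = ⊤) :
    (trace H).index = H.index := by
  have h1 : (trace H).index = (H.comap (base φ)).index := by
    simp [trace]
    rfl
  let _ : MulAction (Multiplicative N) (ZExtension φ ⧸ H) := MulAction.compHom _ (base φ)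
  have hsmul (w : Multiplicative N) (x : ZExtension φ ⧸ H) : w • x = base φ w • x := rfl
  have h2 : H.comap (base φ) = MulAction.stabilizer (Multiplicative N)
      ((1 : ZExtension φ) : ZExtension φ ⧸ H) := by
    ext w
    rw [MulAction.mem_stabilizer_iff, hsmul, MulAction.Quotient.smul_coe, smul_eq_mul, mul_one,
      eq_comm, QuotientGroup.eq, inv_one, one_mul, Subgroup.mem_comap]
  have h3 (x : ZExtension φ ⧸ H) :
      ∃ w : Multiplicative N, w • ((1 : ZExtension φ) : ZExtension φ ⧸ H) = x := by
    obtain ⟨g, rfl⟩ := QuotientGroup.mk_surjective x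
    have : g ∈ (base φ).range ⊔ H := by rw [sup_comm, hH]; trivial
    rw [← SetLike.mem_coe, Subgroup.normal_mul] at this
    obtain ⟨_, ⟨w, rfl⟩, h, hh, e⟩ := this
    refine ⟨w, ?_⟩
    rw [hsmul, MulAction.Quotient.smul_coe, smul_eq_mul, mul_one, QuotientGroup.eq, ← e]
    simpa using hh
  have : MulAction.IsPretransitive (Multiplicative N) (ZExtension φ ⧸ H) := by
    refine ⟨fun x y ↦ ?_⟩
    obtain ⟨v, rfl⟩ := h3 x
    obtain ⟨w, rfl⟩ := h3 y
    exact ⟨w * v⁻¹, by rw [← mul_smul, inv_mul_cancel_right]⟩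
  rw [h1, h2, MulAction.index_stabilizer_of_transitive, Subgroup.index_eq_card]

theorem eq_top_of_base_le_of_stable_mem (K : Subgroup (ZExtension φ)) (hb : (base φ).range ≤ K)
    (hs : stable φ ∈ K) : K = ⊤ := by
  rw [eq_top_iff]
  intro g _
  have : inr g.right = stable φ ^ toAdd g.right := by
    rw [stable, ← map_zpow, ← ofAdd_zsmul]
    simp
  rw [← inl_left_mul_inr_right g, this]
  exact K.mul_mem (hb ⟨_, rfl⟩) (K.zpow_mem hs _)

theorem normal_map_base_of_invariant {M : AddSubgroup N} (hM : ∀ w, φ w ∈ M ↔ w ∈ M) :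
    ((AddSubgroup.toSubgroup M).map (base φ)).Normal := by
  rw [← Subgroup.normalizer_eq_top_iff]
  refine eq_top_of_base_le_of_stable_mem _ ?_ ?_
  · rintro _ ⟨w, rfl⟩
    rw [Subgroup.mem_normalizer_iff]
    intro h
    constructor
    · rintro ⟨m, hm, rfl⟩
      exact ⟨m, hm, by rw [← map_inv, ← map_mul, ← map_mul, mul_comm, inv_mul_cancel_left]⟩
    · rintro ⟨m, hm, e⟩
      refine ⟨m, hm, ?_⟩
      rw [eq_mul_inv_iff_mul_eq, ← map_mul, mul_comm, map_mul, mul_right_inj] at e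
      exact e
  · rw [Subgroup.mem_normalizer_iff]
    intro h
    constructor
    · rintro ⟨m, hm, rfl⟩
      exact ⟨ofAdd (φ (toAdd m)), (hM _).2 hm, base_apply_map _⟩
    · rintro ⟨m, hm, e⟩
      refine ⟨ofAdd (φ.symm (toAdd m)), (hM _).1 ?_, ?_⟩
      · exact (φ.apply_symm_apply (toAdd m)).symm ▸ hm
      · have := base_apply_map (φ := φ) (φ.symm (toAdd m))
        rw [AddEquiv.apply_symm_apply, ofAdd_toAdd, e] at this
        simpa using this.symm

/-- The trace of a maximal subgroup is maximal among the invariant subgroups of the base. -/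
theorem eq_top_of_trace_lt {H : Subgroup (ZExtension φ)} (hH : IsCoatom H)
    (hb : ¬ (base φ).range ≤ H) (h0 : H.index ≠ 0) {M : AddSubgroup N} (hM : ∀ w ∈ M, φ w ∈ M)
    (hlt : trace H < M) : M = ⊤ := by
  have hsup := sup_base_eq_top hH hb
  have hM' : ∀ w, φ w ∈ M ↔ w ∈ M := by
    have hle : M.map (φ : N →+ N) ≤ M := by
      rintro _ ⟨w, hw, rfl⟩; exact hM w hw
    have hfin : (trace H).FiniteIndex := ⟨by rwa [index_trace hsup]⟩
    have hfin2 : M.FiniteIndex := AddSubgroup.finiteIndex_of_le hlt.le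
    have hfin3 : (M.map (φ : N →+ N)).FiniteIndex :=
      ⟨by rw [AddSubgroup.index_map_equiv]; exact hfin2.index_ne_zero⟩
    have heq : M.map (φ : N →+ N) = M := by
      by_contra hne
      have := AddSubgroup.index_strictAnti (lt_of_le_of_ne hle hne)
      rw [AddSubgroup.index_map_equiv] at this
      exact lt_irrefl _ this
    refine fun w ↦ ⟨fun hw ↦ ?_, hM w⟩
    rw [← heq] at hw
    obtain ⟨u, hu, e⟩ := hw
    rwa [← φ.injective e]
  have := normal_map_base_of_invariant hM'
  set L := (AddSubgroup.toSubgroup M).map (base φ)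
  have htop : L ⊔ H = ⊤ := by
    refine hH.2 _ (lt_of_le_of_ne le_sup_right fun h ↦ hlt.not_ge fun m hm ↦ ?_)
    rw [mem_trace, h]
    exact (le_sup_left : L ≤ L ⊔ H) ⟨_, hm, rfl⟩
  rw [eq_top_iff]
  intro w _
  have hw : base φ (ofAdd w) ∈ L ⊔ H := by rw [htop]; trivial
  rw [← SetLike.mem_coe, Subgroup.normal_mul] at hw
  obtain ⟨_, ⟨m, hm, rfl⟩, h, hh, e⟩ := hw
  replace hm : toAdd m ∈ M := hm
  change base φ m * h = _ at e
  have hh' : h = base φ (ofAdd (w - toAdd m)) := by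
    rw [← mul_right_inj (base φ m), e, ← map_mul]
    congr 1
    exact congrArg ofAdd (add_sub_cancel (toAdd m) w).symm
  rw [hh', SetLike.mem_coe, ← mem_trace] at hh
  have := M.add_mem (hlt.le hh) hm
  rwa [sub_add_cancel] at this

theorem eq_of_base_le {H K : Subgroup (ZExtension φ)} (hH : (base φ).range ≤ H)
    (hK : (base φ).range ≤ K) (h : H.index = K.index) : H = K := by
  rw [range_base_eq_ker] at hH hK
  rw [← Subgroup.comap_map_eq_self hH, ← Subgroup.comap_map_eq_self hK] at h ⊢
  rw [Subgroup.index_comap_of_surjective _ rightHom_surjective,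
    Subgroup.index_comap_of_surjective _ rightHom_surjective] at h
  congr 1
  have key (U : Subgroup (Multiplicative ℤ)) :
      Subgroup.toAddSubgroup' U = AddSubgroup.zmultiples (U.index : ℤ) := by
    obtain ⟨a, ha⟩ := Int.subgroup_cyclic (Subgroup.toAddSubgroup' U)
    have h1 : (Subgroup.toAddSubgroup' U).index = U.index := rfl
    rw [← h1, ha, ← AddSubgroup.zmultiples_eq_closure, Int.index_zmultiples,
      Int.zmultiples_natAbs]
  apply Subgroup.toAddSubgroup'.injective
  rw [key, key, h]

/-- A homomorphism out of `ZExtension φ` is given by a homomorphism on the base and the image of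
the stable letter. -/
def liftHom {P : Type*} [Group P] (f : Multiplicative N →* P) (T : P)
    (h : ∀ w, f (ofAdd (φ w)) = T * f (ofAdd w) * T⁻¹) : ZExtension φ →* P :=
  SemidirectProduct.lift f (zpowersHom P T) (by
    intro g
    have key (j : ℤ) : ∀ w : Multiplicative N,
        f (((AddEquiv.toMultiplicative φ : MulAut (Multiplicative N)) ^ j) w) =
          T ^ j * f w * (T ^ j)⁻¹ := by
      have hφ (w : Multiplicative N) :
          f ((AddEquiv.toMultiplicative φ : MulAut (Multiplicative N)) w) = T * f w * T⁻¹ :=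
        h (toAdd w)
      induction j with
      | zero => simp
      | succ j ih =>
        intro w
        rw [zpow_add_one, MulAut.mul_apply, ih, hφ, zpow_add_one]
        group
      | pred j ih =>
        intro w
        have := hφ ((AddEquiv.toMultiplicative φ : MulAut (Multiplicative N))⁻¹ w)
        rw [MulAut.apply_inv_self] at this
        rw [zpow_sub_one, MulAut.mul_apply, ih, zpow_sub_one, this]
        group
    ext w
    exact key (toAdd g) w)

theorem liftHom_base {P : Type*} [Group P] (f : Multiplicative N →* P) (T : P)
    (h : ∀ w, f (ofAdd (φ w)) = T * f (ofAdd w) * T⁻¹) (w : Multiplicative N) :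
    liftHom f T h (base φ w) = f w := lift_inl ..

theorem liftHom_stable {P : Type*} [Group P] (f : Multiplicative N →* P) (T : P)
    (h : ∀ w, f (ofAdd (φ w)) = T * f (ofAdd w) * T⁻¹) :
    liftHom f T h (stable φ) = T := by
  rw [liftHom, stable, lift_inr, zpowersHom_apply, toAdd_ofAdd, zpow_one]

/-- An eigenfunctional on the base and a scalar yield a point stabilizer for an affine action. -/
theorem exists_subgroup_of_eigenfunctional {F : Type*} [Field F] {ξ : F} (hξ : ξ ≠ 0)
    {l : N →+ F} (hl : Function.Surjective l) (hφ : ∀ w, l (φ w) = ξ * l w) (c : F) :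
    ∃ H : Subgroup (ZExtension φ), H.index = Nat.card F ∧ (∀ w, w ∈ trace H ↔ l w = 0) ∧
      ∀ v, base φ (ofAdd v) * stable φ ∈ H ↔ l v = c := by
  let f : Multiplicative N →* Equiv.Perm F :=
    { toFun := fun w ↦ Equiv.addLeft (l (toAdd w))
      map_one' := by ext; simp
      map_mul' := fun v w ↦ by ext; simp }
  have hf (w : N) (x : F) : f (ofAdd w) x = l w + x := rfl
  let T : Equiv.Perm F := (Equiv.mulLeft₀ ξ hξ).trans (Equiv.addRight (-c))
  have hT (x : F) : T x = ξ * x + -c := rfl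
  have hfT (w : N) : f (ofAdd (φ w)) = T * f (ofAdd w) * T⁻¹ := by
    rw [eq_mul_inv_iff_mul_eq]
    ext x
    simp only [Equiv.Perm.mul_apply, hf, hT, hφ]
    ring
  let H : Subgroup (ZExtension φ) :=
    (MulAction.stabilizer (Equiv.Perm F) (0 : F)).comap (liftHom f T hfT)
  have h1 (w : N) : w ∈ trace H ↔ l w = 0 := by
    rw [mem_trace, Subgroup.mem_comap, liftHom_base, MulAction.mem_stabilizer_iff,
      Equiv.Perm.smul_def, hf, add_zero]
  have h2 (v : N) : base φ (ofAdd v) * stable φ ∈ H ↔ l v = c := by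
    rw [Subgroup.mem_comap, map_mul, liftHom_base, liftHom_stable, MulAction.mem_stabilizer_iff,
      Equiv.Perm.smul_def, Equiv.Perm.mul_apply, hf, hT, mul_zero, zero_add, ← sub_eq_add_neg,
      sub_eq_zero]
  refine ⟨H, ?_, h1, h2⟩
  have hsup : H ⊔ (base φ).range = ⊤ := by
    refine eq_top_of_base_le_of_stable_mem _ le_sup_right ?_
    obtain ⟨v, hv⟩ := hl c
    have hv := (le_sup_left : H ≤ H ⊔ (base φ).range) ((h2 v).2 hv)
    exact (Subgroup.mul_mem_cancel_left _ ((le_sup_right : _ ≤ H ⊔ (base φ).range) ⟨_, rfl⟩)).1 hv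
  have h3 : trace H = l.ker := by
    ext w
    rw [h1, AddMonoidHom.mem_ker]
  rw [← index_trace hsup, h3, AddSubgroup.index_ker, AddMonoidHom.range_eq_top.2 hl]
  exact Nat.card_congr AddSubgroup.topEquiv.toEquiv

theorem isCoatom_of_index_prime {G : Type*} [Group G] {H : Subgroup G} (h : H.index.Prime) :
    IsCoatom H := by
  have hfin : H.FiniteIndex := ⟨h.ne_zero⟩
  refine ⟨fun e ↦ h.ne_one (Subgroup.index_eq_one.2 e), fun K hK ↦ ?_⟩
  rcases (Nat.dvd_prime h).1 (Subgroup.index_dvd_of_le hK.le) with h1 | h1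
  · exact Subgroup.index_eq_one.1 h1
  · exact absurd h1 (Subgroup.index_strictAnti hK).ne

end ZExtension

/-- A maximal proper invariant subgroup of an abelian group is the kernel of an
eigenfunctional with values in a field. -/
theorem exists_field_eigenfunctional {N : Type} [AddCommGroup N] (f : N →ₗ[ℤ] N)
    (M : AddSubgroup N) (hM : ∀ w ∈ M, f w ∈ M) (hne : M ≠ ⊤)
    (hmax : ∀ M', M < M' → (∀ w ∈ M', f w ∈ M') → M' = ⊤) :
    ∃ (F : Type) (_ : Field F) (ξ : F) (l : N →+ F), Function.Surjective l ∧
      (∀ w, l (f w) = ξ * l w) ∧ l.ker = M := by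
  let e := Module.AEval'.of f
  have hX (w : N) : (X : ℤ[X]) • e w = e (f w) := Module.AEval'.X_smul_of f w
  let P : Submodule ℤ[X] (Module.AEval' f) :=
    { carrier := {x | e.symm x ∈ M}
      add_mem' := fun {x y} hx hy ↦ by
        simp only [Set.mem_ofPred_eq, map_add] at *
        exact M.add_mem hx hy
      zero_mem' := by simp
      smul_mem' := fun g x hx ↦ by
        obtain ⟨w, rfl⟩ := e.surjective x
        simp only [Set.mem_ofPred_eq, e.symm_apply_apply] at *
        induction g using Polynomial.induction_on generalizing w with
        | C a =>
          rw [Module.AEval.C_smul, map_smul, e.symm_apply_apply]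
          exact M.zsmul_mem hx a
        | add p q hp hq =>
          rw [add_smul, map_add]
          exact M.add_mem (hp _ hx) (hq _ hx)
        | monomial n a ih =>
          rw [pow_succ, ← mul_assoc, mul_smul, hX]
          exact ih _ (hM _ hx) }
  have hP (w : N) : e w ∈ P ↔ w ∈ M := by
    change e.symm (e w) ∈ M ↔ _
    rw [e.symm_apply_apply]
  have hco : IsCoatom P := by
    refine ⟨fun h ↦ hne ?_, fun Q hQ ↦ ?_⟩
    · rw [eq_top_iff]
      intro w _
      rw [← hP, h]
      trivial
    · let M' : AddSubgroup N := Q.toAddSubgroup.comap (e : N →+ Module.AEval' f)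
      have hM' (w : N) : w ∈ M' ↔ e w ∈ Q := Iff.rfl
      have : M' = ⊤ := by
        refine hmax M' ?_ ?_
        · rw [SetLike.lt_iff_le_and_exists] at hQ ⊢
          refine ⟨fun w hw ↦ hQ.1 ((hP w).2 hw), ?_⟩
          obtain ⟨x, hx, hx'⟩ := hQ.2
          obtain ⟨w, rfl⟩ := e.surjective x
          exact ⟨w, hx, fun h ↦ hx' ((hP w).2 h)⟩
        · intro w hw
          rw [hM', ← hX]
          exact Q.smul_mem _ hw
      rw [eq_top_iff]
      intro x _
      obtain ⟨w, rfl⟩ := e.surjective x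
      rw [← hM', this]
      trivial
  have := isSimpleModule_iff_isCoatom.2 hco
  obtain ⟨m, hm, ⟨i⟩⟩ := isSimpleModule_iff_quot_maximal.1 this
  let l : N →+ ℤ[X] ⧸ m :=
    ((i.toLinearMap ∘ₗ P.mkQ).toAddMonoidHom).comp (e : N →+ Module.AEval' f)
  have hl (w : N) : l w = i (P.mkQ (e w)) := rfl
  refine ⟨ℤ[X] ⧸ m, Ideal.Quotient.field m, Ideal.Quotient.mk m X, l, ?_, fun w ↦ ?_, ?_⟩
  · exact i.surjective.comp (P.mkQ_surjective.comp e.surjective)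
  · rw [hl, ← hX, map_smul, map_smul, hl]
    generalize i (P.mkQ (e w)) = y
    obtain ⟨y, rfl⟩ := Ideal.Quotient.mk_surjective y
    rfl
  · ext w
    rw [AddMonoidHom.mem_ker, hl, i.map_eq_zero_iff, Submodule.mkQ_apply,
      Submodule.Quotient.mk_eq_zero, hP]

namespace ZExtension
open SemidirectProduct Multiplicative

variable {N : Type} [AddCommGroup N] {φ : N ≃+ N}

/-- The maximal subgroups of index `n` which do not contain the base. -/
def supplements (φ : N ≃+ N) (n : ℕ) : Set (Subgroup (ZExtension φ)) :=
  {H | IsCoatom H ∧ H.index = n ∧ ¬ (base φ).range ≤ H}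

theorem exists_field_of_mem_supplements {n : ℕ} (hn : n ≠ 0) {H : Subgroup (ZExtension φ)}
    (hH : H ∈ supplements φ n) :
    ∃ (F : Type) (_ : Field F) (ξ : F) (l : N →+ F), Nat.card F = n ∧ Function.Surjective l ∧
      (∀ w, l (φ w) = ξ * l w) ∧ l.ker = trace H := by
  obtain ⟨hH, hi, hb⟩ := hH
  obtain ⟨v, hv⟩ := exists_base_mul_stable_mem (sup_base_eq_top hH hb)
  obtain ⟨F, _, ξ, l, hl, h1, h2⟩ := exists_field_eigenfunctional
    (φ : N →+ N).toIntLinearMap (trace H) (fun w hw ↦ (map_mem_trace hv).2 hw)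
    (fun h ↦ hb (by
      rintro _ ⟨w, rfl⟩
      have : toAdd w ∈ trace H := by rw [h]; trivial
      exact this))
    (fun M' hlt hM' ↦ eq_top_of_trace_lt hH hb (hi ▸ hn) hM' hlt)
  refine ⟨F, _, ξ, l, ?_, hl, h1, h2⟩
  rw [← hi, ← index_trace (sup_base_eq_top hH hb), ← h2, AddSubgroup.index_ker,
    AddMonoidHom.range_eq_top.2 hl]
  exact (Nat.card_congr AddSubgroup.topEquiv.toEquiv).symm

theorem exists_eigenfunctional_of_mem_supplements {F : Type} [Field F] [Finite F]
    {H : Subgroup (ZExtension φ)} (hH : H ∈ supplements φ (Nat.card F)) :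
    ∃ (ξ : F) (l : N →+ F) (v : N), Function.Surjective l ∧
      (∀ w, l (φ w) = ξ * l w) ∧ l.ker = trace H ∧ base φ (ofAdd v) * stable φ ∈ H := by
  obtain ⟨v, hv⟩ := exists_base_mul_stable_mem (sup_base_eq_top hH.1 hH.2.2)
  obtain ⟨K, _, ξ, l, hK, hl, h1, h2⟩ := exists_field_of_mem_supplements Nat.card_pos.ne' hH
  have : Finite K := Nat.finite_of_card_ne_zero (hK ▸ Nat.card_pos.ne')
  have := Fintype.ofFinite F
  have := Fintype.ofFinite K
  let i : K ≃+* F := FiniteField.ringEquivOfCardEq (by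
    rw [← Nat.card_eq_fintype_card, ← Nat.card_eq_fintype_card, hK])
  refine ⟨i ξ, (i : K →+ F).comp l, v, i.surjective.comp hl, fun w ↦ ?_, ?_, hv⟩
  · simp [h1]
  · rw [← h2]
    ext w
    simp [AddMonoidHom.mem_ker]

/-- Triples consisting of an eigenvalue, a nonzero eigenfunctional and a scalar. -/
def eigenTriples (φ : N ≃+ N) (F : Type) [Field F] : Set (F × (N →+ F) × F) :=
  {x | x.2.1 ≠ 0 ∧ ∀ w, x.2.1 (φ w) = x.1 * x.2.1 w}

theorem exists_injOn_supplements (φ : N ≃+ N) (F : Type) [Field F] [Finite F] :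
    ∃ g : Subgroup (ZExtension φ) × Fˣ → F × (N →+ F) × F,
      Set.MapsTo g (supplements φ (Nat.card F) ×ˢ Set.univ) (eigenTriples φ F) ∧
      Set.InjOn g (supplements φ (Nat.card F) ×ˢ Set.univ) := by
  classical
  have hex : ∀ H : Subgroup (ZExtension φ), H ∈ supplements φ (Nat.card F) → _ :=
    fun H hH ↦ exists_eigenfunctional_of_mem_supplements hH
  choose! ξ l v hl h1 h2 h3 using hex
  refine ⟨fun x ↦ (ξ x.1, (AddMonoidHom.mulLeft (x.2 : F)).comp (l x.1), x.2 * l x.1 (v x.1)),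
    ?_, ?_⟩
  · rintro ⟨H, s⟩ ⟨hH, -⟩
    refine ⟨fun h ↦ ?_, fun w ↦ ?_⟩
    · obtain ⟨w, hw⟩ := hl H hH 1
      simpa [hw] using DFunLike.congr_fun h w
    · simp only [AddMonoidHom.comp_apply, AddMonoidHom.coe_mulLeft]
      rw [h1 H hH]
      ring
  · rintro ⟨H, s⟩ ⟨hH, -⟩ ⟨K, t⟩ ⟨hK, -⟩ e
    simp only [Prod.mk.injEq] at e hH hK ⊢
    obtain ⟨-, e2, e3⟩ := e
    have e2 (w : N) : (s : F) * l H w = t * l K w := by simpa using DFunLike.congr_fun e2 w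
    have hmem (w : N) : w ∈ trace H ↔ w ∈ trace K := by
      rw [← h2 H hH, ← h2 K hK, AddMonoidHom.mem_ker, AddMonoidHom.mem_ker,
        ← s.isUnit.mul_right_eq_zero, e2, t.isUnit.mul_right_eq_zero]
    have hv : base φ (ofAdd (v K)) * stable φ ∈ H := by
      have : v K - v H ∈ trace H := by
        rw [← h2 H hH, AddMonoidHom.mem_ker, map_sub, sub_eq_zero,
          ← s.isUnit.mul_right_inj, e2, e3]
      have := H.mul_mem (mem_trace.1 this) (h3 H hH)
      rwa [← mul_assoc, ← map_mul, ← ofAdd_add, sub_add_cancel] at this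
    have hHK : H = K := le_antisymm
      (le_of_trace_le (fun w ↦ (hmem w).1) hv (h3 K hK))
      (le_of_trace_le (fun w ↦ (hmem w).2) (h3 K hK) hv)
    subst hHK
    obtain ⟨w, hw⟩ := hl H hH 1
    refine ⟨rfl, Units.ext ?_⟩
    simpa [hw] using e2 w

theorem ncard_supplements_mul_le {F : Type} [Field F] [Finite F]
    (hfin : (eigenTriples φ F).Finite) :
    (supplements φ (Nat.card F)).ncard * (Nat.card F - 1) ≤ (eigenTriples φ F).ncard := by
  obtain ⟨g, hg, hg'⟩ := exists_injOn_supplements φ F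
  have := Set.ncard_le_ncard_of_injOn g hg hg' hfin
  rwa [Set.ncard_prod, Set.ncard_univ, Nat.card_units] at this

theorem finite_supplements {F : Type} [Field F] [Finite F] (hfin : (eigenTriples φ F).Finite) :
    (supplements φ (Nat.card F)).Finite := by
  obtain ⟨g, hg, hg'⟩ := exists_injOn_supplements φ F
  have := Set.Finite.of_finite_image (hfin.subset hg.image_subset) hg'
  exact Set.Finite.of_prod_left this Set.univ_nonempty

theorem finite_addMonoidHom {k : ℕ} (F : Type) [AddCommGroup F] [Finite F] :
    Finite ((Fin k → ℤ) →+ F) := by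
  refine Finite.of_injective (fun l (i : Fin k) ↦ l (Pi.single i 1)) fun l m h ↦ ?_
  ext i
  exact congrFun h i

theorem maxSubgroupCount_eq {n : ℕ} :
    maxSubgroupCount (ZExtension φ) n =
      {H : Subgroup (ZExtension φ) | IsCoatom H ∧ H.index = n}.ncard := rfl

theorem maxSubgroups_subset {n : ℕ} :
    ∃ K, {H : Subgroup (ZExtension φ) | IsCoatom H ∧ H.index = n} ⊆
      insert K (supplements φ n) := by
  by_cases h : ∃ K : Subgroup (ZExtension φ), K.index = n ∧ (base φ).range ≤ K
  · obtain ⟨K, hK, hb⟩ := h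
    refine ⟨K, fun H hH ↦ ?_⟩
    by_cases hHb : (base φ).range ≤ H
    · exact Or.inl (eq_of_base_le hHb hb (hH.2.trans hK.symm))
    · exact Or.inr ⟨hH.1, hH.2, hHb⟩
  · exact ⟨⊥, fun H hH ↦ Or.inr ⟨hH.1, hH.2, fun hHb ↦ h ⟨H, hH.2, hHb⟩⟩⟩

theorem maxSubgroupCount_le {n : ℕ} (hfin : (supplements φ n).Finite) :
    maxSubgroupCount (ZExtension φ) n ≤ (supplements φ n).ncard + 1 := by
  obtain ⟨K, hK⟩ := maxSubgroups_subset (φ := φ) (n := n)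
  exact (Set.ncard_le_ncard hK (hfin.insert K)).trans (Set.ncard_insert_le _ _)

end ZExtension

section Eigenfunctional

variable {N : Type*} [AddCommGroup N] {R : Type*} [CommRing R]

theorem map_aeval_of_eigenfunctional {f : Module.End ℤ N} {ξ : R} {l : N →+ R}
    (h : ∀ w, l (f w) = ξ * l w) (P : ℤ[X]) (w : N) :
    l (aeval f P w) = aeval ξ P * l w := by
  induction P using Polynomial.induction_on generalizing w with
  | C a => simp
  | add p q hp hq => simp [hp, hq, add_mul]
  | monomial n a ih =>
    rw [pow_succ, ← mul_assoc, map_mul, map_mul _ _ X, Module.End.mul_apply, aeval_X, ih, h,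
      aeval_X, mul_assoc]

end Eigenfunctional

theorem ncard_roots_le {F : Type*} [Field F] {s : ℤ[X]} (hs : (s.leadingCoeff : F) ≠ 0) :
    {ξ : F | aeval ξ s = 0}.Finite ∧ {ξ : F | aeval ξ s = 0}.ncard ≤ s.natDegree := by
  classical
  have h0 : s.map (Int.castRingHom F) ≠ 0 := fun h ↦ hs (by
    simpa using congrArg (fun P ↦ P.coeff s.natDegree) h)
  have : {ξ : F | aeval ξ s = 0} = ((s.map (Int.castRingHom F)).roots.toFinset : Set F) := by
    ext ξ
    simp [h0, aeval_def, eval_map]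
  rw [this]
  refine ⟨Finset.finite_toSet _, ?_⟩
  rw [Set.ncard_coe_finset]
  exact (Multiset.toFinset_card_le _).trans ((card_roots' _).trans natDegree_map_le)

theorem card_le_pow_of_surjective {k : ℕ} {F : Type} [Field F] (p : ℕ) [CharP F p] [NeZero p]
    {l : (Fin k → ℤ) →+ F} (hl : Function.Surjective l) : Nat.card F ≤ p ^ k := by
  let _ : Algebra (ZMod p) F := ZMod.algebra F p
  let g (y : Fin k → ZMod p) : F := ∑ i, algebraMap (ZMod p) F (y i) * l (Pi.single i 1)
  have hg : Function.Surjective g := by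
    intro x
    obtain ⟨w, rfl⟩ := hl x
    refine ⟨fun i ↦ (w i : ZMod p), ?_⟩
    have hw : w = ∑ i, w i • (Pi.single i 1 : Fin k → ℤ) := by
      conv_lhs => rw [← Finset.univ_sum_single w]
      refine Finset.sum_congr rfl fun i _ ↦ ?_
      rw [← Pi.single_smul, smul_eq_mul, mul_one]
    conv_rhs => rw [hw]
    simp only [g, map_sum, map_zsmul, map_intCast]
    simp only [zsmul_eq_mul]
  have := Nat.card_le_card_of_surjective g hg
  simpa using this

namespace ZExtension

/-- The automorphism of the base as an endomorphism. -/
abbrev toEnd {N : Type*} [AddCommGroup N] (φ : N ≃+ N) : Module.End ℤ N :=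
  (φ : N →+ N).toIntLinearMap

theorem ncard_eigenTriples_le {k b : ℕ} {φ : (Fin k → ℤ) ≃+ (Fin k → ℤ)}
    {F : Type} [Field F] [Finite F]
    (e : Fin (b + 1) → (Fin k → ℤ)) {d : Fin k → ℕ} (hd : ∀ i, (d i : F) ≠ 0)
    {h : Fin k → Fin (b + 1) → ℤ[X]}
    (hgen : ∀ i, d i • (Pi.single i 1 : Fin k → ℤ) =
      ∑ j, aeval (toEnd φ) (h i j) (e j))
    {s χ : ℤ[X]} (hs : (s.leadingCoeff : F) ≠ 0) (hχ : χ.Monic) {m : ℕ}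
    (hse : aeval (toEnd φ) (s ^ m) (e 0) = 0)
    (hχφ : aeval (toEnd φ) χ = 0) :
    (eigenTriples φ F).ncard ≤
      (s.natDegree * Nat.card F ^ (b + 1) + χ.natDegree * Nat.card F ^ b) * Nat.card F := by
  classical
  have hev {ξ : F} {l : (Fin k → ℤ) →+ F} {c : F} (hl : (ξ, l, c) ∈ eigenTriples φ F)
      (P : ℤ[X]) (w : Fin k → ℤ) :
      l (aeval (toEnd φ) P w) = aeval ξ P * l w :=
    map_aeval_of_eigenfunctional hl.2 P w
  let g (x : F × ((Fin k → ℤ) →+ F) × F) : F × F × F × (Fin b → F) :=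
    (x.1, x.2.2, x.2.1 (e 0), fun j ↦ x.2.1 (e j.succ))
  let U : Set (F × F × F × (Fin b → F)) :=
    {ξ : F | aeval ξ s = 0} ×ˢ Set.univ ×ˢ Set.univ ×ˢ Set.univ
  let W : Set (F × F × F × (Fin b → F)) :=
    {ξ : F | aeval ξ χ = 0} ×ˢ Set.univ ×ˢ {0} ×ˢ Set.univ
  have hmaps : Set.MapsTo g (eigenTriples φ F) (U ∪ W) := by
    rintro ⟨ξ, l, c⟩ hl
    by_cases h0 : l (e 0) = 0
    · right
      have hχ0 : aeval ξ χ = 0 := by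
        obtain ⟨w, hw⟩ : ∃ w, l w ≠ 0 := by
          by_contra! hw
          exact hl.1 (AddMonoidHom.ext hw)
        have := hev hl χ w
        rw [hχφ, LinearMap.zero_apply, map_zero] at this
        exact (mul_eq_zero.1 this.symm).resolve_right hw
      simp [W, g, h0, hχ0]
    · left
      have := hev hl (s ^ m) (e 0)
      rw [hse, map_zero, map_pow] at this
      have := eq_zero_of_pow_eq_zero ((mul_eq_zero.1 this.symm).resolve_right h0)
      simp [U, g, this]
  have hinj : Set.InjOn g (eigenTriples φ F) := by
    rintro ⟨ξ, l, c⟩ hl ⟨ξ', l', c'⟩ hl' heq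
    simp only [g, Prod.mk.injEq] at heq
    obtain ⟨rfl, rfl, h0, h1⟩ := heq
    have hej : ∀ j, l (e j) = l' (e j) := Fin.cases h0 (congrFun h1)
    have : l = l' := by
      ext i
      simp only [AddMonoidHom.comp_apply, AddMonoidHom.single_apply]
      have := congrArg l (hgen i)
      have h' := congrArg l' (hgen i)
      simp only [map_nsmul, map_sum, hev hl, hev hl', hej] at this h'
      simp only [nsmul_eq_mul] at this h'
      exact mul_left_cancel₀ (hd i) (this.trans h'.symm)
    rw [this]
  refine (Set.ncard_le_ncard_of_injOn g hmaps hinj).trans ((Set.ncard_union_le _ _).trans ?_)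
  have h1 := (ncard_roots_le hs).2
  have h2 := (ncard_roots_le (F := F) (s := χ) (by simp [hχ.leadingCoeff])).2
  have hU : U.ncard =
      {ξ : F | aeval ξ s = 0}.ncard * (Nat.card F * (Nat.card F * Nat.card F ^ b)) := by
    simp only [U, Set.ncard_prod, Set.ncard_univ, Nat.card_fun, Nat.card_fin]
  have hW : W.ncard = {ξ : F | aeval ξ χ = 0}.ncard * (Nat.card F * Nat.card F ^ b) := by
    simp only [W, Set.ncard_prod, Set.ncard_univ, Nat.card_fun, Nat.card_fin, Set.ncard_singleton,
      one_mul]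
  rw [hU, hW]
  calc _ ≤ s.natDegree * (Nat.card F * (Nat.card F * Nat.card F ^ b)) +
        χ.natDegree * (Nat.card F * Nat.card F ^ b) := by gcongr
    _ = _ := by ring

/-- Upper bound for the number of maximal subgroups when `b + 1` elements generate a finite-index
submodule of the base, one of them being annihilated by a power of `s`. -/
theorem maxSubgroupCount_le_of_generators {k b : ℕ} {φ : (Fin k → ℤ) ≃+ (Fin k → ℤ)}
    (e : Fin (b + 1) → (Fin k → ℤ)) {d : Fin k → ℕ} (hd : ∀ i, d i ≠ 0)
    {h : Fin k → Fin (b + 1) → ℤ[X]}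
    (hgen : ∀ i, d i • (Pi.single i 1 : Fin k → ℤ) =
      ∑ j, aeval (toEnd φ) (h i j) (e j))
    {s χ : ℤ[X]} (hs : s ≠ 0) (hχ : χ.Monic) {m : ℕ}
    (hse : aeval (toEnd φ) (s ^ m) (e 0) = 0)
    (hχφ : aeval (toEnd φ) χ = 0) :
    ∃ C : ℝ, ∃ n₀ : ℕ, ∀ n : ℕ, n₀ ≤ n →
      (maxSubgroupCount (ZExtension φ) n : ℝ) ≤
        s.natDegree * (n : ℝ) ^ (b + 1) + C * (n : ℝ) ^ b := by
  set B : ℕ := ∑ i, d i + s.leadingCoeff.natAbs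
  refine ⟨2 * s.natDegree + 3 * χ.natDegree + 1, (B + 1) ^ k + 2, fun n hn ↦ ?_⟩
  have hn2 : (2 : ℝ) ≤ n := by exact_mod_cast (Nat.le_add_left _ _).trans hn
  rcases (supplements φ n).eq_empty_or_nonempty with hemp | ⟨H, hH⟩
  · have := maxSubgroupCount_le (φ := φ) (n := n) (by simp [hemp])
    rw [hemp, Set.ncard_empty, zero_add] at this
    calc (maxSubgroupCount (ZExtension φ) n : ℝ) ≤ 1 := by exact_mod_cast this
      _ ≤ (n : ℝ) ^ b := one_le_pow₀ (by linarith)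
      _ ≤ s.natDegree * (n : ℝ) ^ (b + 1) +
          ((2 * s.natDegree + 3 * χ.natDegree) * (n : ℝ) ^ b + (n : ℝ) ^ b) :=
        (le_add_of_nonneg_left (by positivity)).trans (le_add_of_nonneg_left (by positivity))
      _ = _ := by ring
  have hn0 : n ≠ 0 := by rintro rfl; norm_num at hn2
  obtain ⟨F, _, ξ, l, hF, hl, -, -⟩ := exists_field_of_mem_supplements hn0 hH
  have : Finite F := Nat.finite_of_card_ne_zero (by rwa [hF])
  subst hF
  obtain ⟨p, hp⟩ := CharP.exists F
  have hpp : p.Prime :=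
    (CharP.char_is_prime_or_zero F p).resolve_right (CharP.char_ne_zero_of_finite F p)
  have : NeZero p := ⟨hpp.ne_zero⟩
  have hcard := card_le_pow_of_surjective p hl
  have hBp : B < p := by
    by_contra! hle
    have : p ^ k ≤ (B + 1) ^ k := Nat.pow_le_pow_left (by omega) k
    omega
  have hdF (i : Fin k) : (d i : F) ≠ 0 := by
    rw [Ne, CharP.cast_eq_zero_iff F p]
    refine fun hdvd ↦ (Nat.le_of_dvd (Nat.pos_of_ne_zero (hd i)) hdvd).not_gt ?_
    have := Finset.single_le_sum (f := d) (fun _ _ ↦ Nat.zero_le _) (Finset.mem_univ i)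
    omega
  have hsF : (s.leadingCoeff : F) ≠ 0 := by
    rw [Ne, CharP.intCast_eq_zero_iff F p, Int.natCast_dvd]
    refine fun hdvd ↦ (Nat.le_of_dvd (by simpa [Int.natAbs_pos] using hs) hdvd).not_gt ?_
    omega
  have hle := ncard_eigenTriples_le e hdF hgen hsF hχ hse hχφ
  have : Finite ((Fin k → ℤ) →+ F) := finite_addMonoidHom F
  have hfin : (eigenTriples φ F).Finite := Set.toFinite _
  have h1 := (ncard_supplements_mul_le hfin).trans hle
  have h2 := maxSubgroupCount_le (finite_supplements hfin)
  generalize (supplements φ (Nat.card F)).ncard = S at *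
  generalize maxSubgroupCount (ZExtension φ) (Nat.card F) = T at *
  generalize Nat.card F = n at *
  generalize s.natDegree = ρ at *
  generalize χ.natDegree = K at *
  obtain ⟨n, rfl⟩ := Nat.exists_eq_add_of_le' (Nat.one_le_iff_ne_zero.2 hn0)
  rw [Nat.add_sub_cancel] at h1
  have h1' : (S : ℝ) * n ≤
      (ρ * (n + 1 : ℝ) ^ (b + 1) + K * (n + 1 : ℝ) ^ b) * (n + 1) := by exact_mod_cast h1
  have h2' : (T : ℝ) ≤ S + 1 := by exact_mod_cast h2
  push_cast at hn2 ⊢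
  have hn1 : (1 : ℝ) ≤ n := by linarith
  have hS : (S : ℝ) ≤ ρ * (n + 1 : ℝ) ^ (b + 1) + (2 * ρ + 3 * K) * (n + 1 : ℝ) ^ b := by
    refine le_of_mul_le_mul_right (h1'.trans ?_) (by linarith : (0 : ℝ) < n)
    rw [pow_succ]
    have hx : (0 : ℝ) ≤ (n + 1 : ℝ) ^ b := by positivity
    generalize (n + 1 : ℝ) ^ b = x at *
    have : 0 ≤ x * (ρ * (n - 1) + K * (2 * n - 1)) :=
      mul_nonneg hx (add_nonneg (mul_nonneg (by positivity) (by linarith))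
        (mul_nonneg (by positivity) (by linarith)))
    linarith
  have hpow : (1 : ℝ) ≤ (n + 1 : ℝ) ^ b := one_le_pow₀ (by linarith)
  linarith

end ZExtension

theorem exists_nsmul_map_eq_of_map_ne_zero {N : Type*} [AddCommGroup N] {p : ℕ} [Fact p.Prime]
    {l : N →+ ZMod p} {e : N} (he : l e ≠ 0) (x : ZMod p) : ∃ t : ℕ, l (t • e) = x :=
  ⟨(x * (l e)⁻¹).val, by
    rw [map_nsmul, nsmul_eq_mul, ZMod.natCast_val, ZMod.cast_id, inv_mul_cancel_right₀ he]⟩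

namespace ZExtension
open SemidirectProduct Multiplicative

theorem finite_maxSubgroups {k p : ℕ} (φ : (Fin k → ℤ) ≃+ (Fin k → ℤ)) [Fact p.Prime] :
    {H : Subgroup (ZExtension φ) | IsCoatom H ∧ H.index = p}.Finite := by
  obtain ⟨K, hK⟩ := maxSubgroups_subset (φ := φ) (n := p)
  have : Finite ((Fin k → ℤ) →+ ZMod p) := finite_addMonoidHom (ZMod p)
  have := finite_supplements (φ := φ) (F := ZMod p) (Set.toFinite _)
  rw [Nat.card_zmod] at this
  exact (this.insert K).subset hK

/-- Lower bound for the number of maximal subgroups of prime index from independent eigenfunctionals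
for distinct eigenvalues. -/
theorem le_maxSubgroupCount_of_eigenfunctionals {k p b : ℕ} {φ : (Fin k → ℤ) ≃+ (Fin k → ℤ)}
    [Fact p.Prime] {ι : Type} [Finite ι] {α : ι → ZMod p} (hα : Function.Injective α)
    {L : ι → Fin (b + 1) → (Fin k → ℤ) →+ ZMod p} (hL : ∀ i j w, L i j (φ w) = α i * L i j w)
    {e : Fin (b + 1) → (Fin k → ℤ)} {E : Fin (b + 1) → ZMod p} (hE : ∀ j, E j ≠ 0)
    (hLe : ∀ i j j', L i j (e j') = if j = j' then E j' else 0) :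
    Nat.card ι * p ^ (b + 1) ≤ maxSubgroupCount (ZExtension φ) p := by
  let l (i : ι) (y : Fin b → ZMod p) : (Fin k → ℤ) →+ ZMod p :=
    L i 0 + ∑ j, (AddMonoidHom.mulLeft (y j)).comp (L i j.succ)
  have hl (i y w) : l i y w = L i 0 w + ∑ j, y j * L i j.succ w := by
    simp [l]
  have hl0 (i y) : l i y (e 0) = E 0 := by simp [hl, hLe]
  have hlj (i y j) : l i y (e (Fin.succ j)) = y j * E j.succ := by
    simp [hl, hLe, (Fin.succ_ne_zero _).symm]
  have hlφ (i y w) : l i y (φ w) = α i * l i y w := by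
    simp only [hl, hL, mul_add, Finset.mul_sum]
    congr 1
    exact Finset.sum_congr rfl fun j _ ↦ by ring
  have hsurj (i y) : Function.Surjective (l i y) := fun x ↦
    (exists_nsmul_map_eq_of_map_ne_zero (l := l i y) (e := e 0) (by rw [hl0]; exact hE 0) x).imp'
      _ fun _ h ↦ h
  have hα0 (i) : α i ≠ 0 := fun h ↦ hE 0 (by
    rw [← hl0 i 0, ← φ.apply_symm_apply (e 0), hlφ, h, zero_mul])
  choose H hH1 hH2 hH3 using fun x : ι × (Fin b → ZMod p) × ZMod p ↦
    exists_subgroup_of_eigenfunctional (hα0 x.1) (hsurj x.1 x.2.1) (hlφ x.1 x.2.1) x.2.2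
  have hinj : Function.Injective H := by
    rintro ⟨i, y, c⟩ ⟨i', y', c'⟩ h
    have hker (w) : l i y w = 0 ↔ l i' y' w = 0 := by
      rw [← hH2 (i, y, c), h, hH2 (i', y', c')]
    have hll (w) : l i' y' w = l i y w := by
      obtain ⟨t, ht⟩ := exists_nsmul_map_eq_of_map_ne_zero (l := l i y) (e := e 0)
        (by rw [hl0]; exact hE 0) (l i y w)
      have : l i' y' (w - t • e 0) = 0 := by
        rw [← hker, map_sub, ht, sub_self]
      rw [map_sub, sub_eq_zero] at this
      rw [this, ← ht, map_nsmul, map_nsmul, hl0, hl0]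
    have h1 : i = i' := hα (mul_right_cancel₀ (hE 0) (by
      rw [← hl0 i y, ← hlφ, ← hll, hlφ, hl0, hl0]))
    have h2 : y = y' := funext fun j ↦ mul_right_cancel₀ (hE j.succ) (by
      rw [← hlj i, ← hlj i', hll])
    have h3 : c = c' := by
      obtain ⟨v, rfl⟩ := hsurj i y c
      have := (hH3 (i, y, l i y v) v).2 rfl
      rw [h, hH3] at this
      rw [← hll, this]
    rw [h1, h2, h3]
  have hcard := Set.ncard_le_ncard_of_injOn H (s := Set.univ) (fun x _ ↦ ?_) hinj.injOn
    (finite_maxSubgroups (p := p) φ)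
  · rw [maxSubgroupCount_eq]
    refine le_trans (le_of_eq ?_) hcard
    rw [Set.ncard_univ, Nat.card_prod, Nat.card_prod, Nat.card_fun, Nat.card_fin, Nat.card_zmod,
      pow_succ]
  · have hi : (H x).index = p := by rw [hH1, Nat.card_zmod]
    exact ⟨isCoatom_of_index_prime (by rw [hi]; exact Fact.out), hi⟩

end ZExtension

/-- A nonconstant integer polynomial has roots modulo arbitrarily large primes. -/
theorem exists_prime_root (g : ℤ[X]) (hg : 0 < g.degree) (B : ℕ) :
    ∃ p, B ≤ p ∧ p.Prime ∧ ∃ r : ℤ, (p : ℤ) ∣ g.eval r := by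
  by_cases h0 : g.eval 0 = 0
  · obtain ⟨p, hp, hpp⟩ := Nat.exists_infinite_primes B
    exact ⟨p, hp, hpp, 0, by simp [h0]⟩
  set c := g.eval 0
  obtain ⟨q, hq⟩ : ∃ q, g = C c + X * q := by
    refine ⟨g.divX, ?_⟩
    rw [mul_comm, add_comm, show c = g.coeff 0 from (coeff_zero_eq_eval_zero g).symm,
      divX_mul_X_add]
  have hq0 : q ≠ 0 := by
    rintro rfl
    rw [hq, mul_zero, add_zero] at hg
    exact hg.not_ge degree_C_le
  have hF : (B.factorial : ℤ) ≠ 0 := by exact_mod_cast B.factorial_ne_zero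
  set M : ℤ := c * (B.factorial : ℤ)
  have hM : M ≠ 0 := mul_ne_zero h0 hF
  set P : ℤ[X] := C (B.factorial : ℤ) * X * q.comp (C M * X)
  have hP : P ≠ 0 := by
    refine mul_ne_zero (mul_ne_zero (by simpa using hF) X_ne_zero) fun h => ?_
    rcases comp_eq_zero_iff.1 h with h | ⟨-, h⟩
    · exact hq0 h
    · have := congrArg (coeff · 1) h
      simp [hM] at this
  have hP2 : P + 2 ≠ 0 := fun h => by
    have := congrArg (eval 0) h
    simp [P] at this
  obtain ⟨y, hy⟩ : ∃ y : ℤ, (P * (P + 2)).eval y ≠ 0 := by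
    by_contra! h
    exact mul_ne_zero hP hP2 (Polynomial.funext (by simpa using h))
  rw [eval_mul, mul_ne_zero_iff, eval_add] at hy
  obtain ⟨p, hp, hpd⟩ := Nat.exists_prime_and_dvd (n := (1 + P.eval y).natAbs) (by
    have := hy.2
    simp only [eval_ofNat] at this
    have := hy.1
    omega)
  rw [← Int.natCast_dvd] at hpd
  refine ⟨p, ?_, hp, M * y, ?_⟩
  · by_contra! hlt
    have h1 : (p : ℤ) ∣ P.eval y := by
      simp only [P, eval_mul, eval_C, mul_assoc]
      exact (Int.natCast_dvd_natCast.2 ((hp.dvd_factorial).2 hlt.le)).mul_right _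
    have := Int.eq_one_of_dvd_one (Int.natCast_nonneg p) ((Int.dvd_add_left h1).1 hpd)
    exact hp.one_lt.ne' (by exact_mod_cast this)
  · have : g.eval (M * y) = c * (1 + P.eval y) := by
      rw [hq]
      simp [P, M]
      ring
    rw [this]
    exact hpd.mul_left _

/-- A rational polynomial becomes integral after multiplication by a positive integer. -/
theorem exists_nsmul_eq_map (h : ℚ[X]) :
    ∃ D : ℕ, D ≠ 0 ∧ ∃ g : ℤ[X], g.map (Int.castRingHom ℚ) = D • h := by
  obtain ⟨c, hc, h_eq⟩ := IsLocalization.integerNormalization_spec (nonZeroDivisors ℤ) h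
  have hc0 : c ≠ 0 := nonZeroDivisors.ne_zero hc
  refine ⟨c.natAbs, by simpa, C c.sign *
    IsLocalization.integerNormalization (nonZeroDivisors ℤ) h, ?_⟩
  rw [Polynomial.map_mul, map_C]
  refine (congrArg _ h_eq).trans ?_
  rw [← natCast_zsmul, ← Int.sign_mul_self_eq_natAbs, mul_smul]
  simp [zsmul_eq_mul]

/-- Finitely many algebraic numbers are rational polynomials in a single algebraic integer. -/
theorem exists_isIntegral_generator (S : Finset ℂ) (hS : ∀ x ∈ S, IsAlgebraic ℚ x) :
    ∃ β : ℂ, IsIntegral ℤ β ∧ ∀ x ∈ S, ∃ h : ℚ[X], aeval β h = x := by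
  let K := IntermediateField.adjoin ℚ (S : Set ℂ)
  have : FiniteDimensional ℚ K := IntermediateField.finiteDimensional_adjoin
    fun x hx => (hS x hx).isIntegral
  obtain ⟨β₀, hβ₀⟩ := Field.exists_primitive_element ℚ K
  have hβ : IsAlgebraic ℤ (β₀ : ℂ) := (IsFractionRing.isAlgebraic_iff ℤ ℚ ℂ).2
    ((IsAlgebraic.of_finite ℚ β₀).algebraMap (A := ℂ))
  obtain ⟨N, hN, hNβ⟩ := hβ.exists_integral_multiple
  refine ⟨N • (β₀ : ℂ), hNβ, fun x hx => ?_⟩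
  have hxK : (⟨x, IntermediateField.subset_adjoin ℚ _ hx⟩ : K) ∈
      IntermediateField.adjoin ℚ {β₀} := by
    rw [hβ₀]; trivial
  rw [← IntermediateField.mem_toSubalgebra,
    IntermediateField.adjoin_simple_toSubalgebra_of_isAlgebraic (IsAlgebraic.of_finite ℚ β₀),
    Algebra.adjoin_singleton_eq_range_aeval] at hxK
  obtain ⟨h, hh⟩ := hxK
  refine ⟨h.comp (C (N : ℚ)⁻¹ * X), ?_⟩
  have h2 := congrArg (algebraMap K ℂ) hh
  change algebraMap K ℂ (aeval β₀ h) = x at h2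
  rw [← aeval_algebraMap_apply] at h2
  rw [aeval_comp, ← h2]
  congr 1
  have : (N : ℂ) ≠ 0 := by exact_mod_cast hN
  simp [this]

/-- Finitely many algebraic numbers can be reduced modulo arbitrarily large primes, with residue
field the prime field. -/
theorem exists_reduction (S : Finset ℂ) (hS : ∀ x ∈ S, IsAlgebraic ℚ x) (B : ℕ) :
    ∃ p, B ≤ p ∧ p.Prime ∧ ∃ (Q : Type) (_ : CommRing Q) (i : Q →+* ℂ) (_ : Q →+* ZMod p),
      Function.Injective i ∧ ∀ x ∈ S, x ∈ i.range := by
  obtain ⟨β, hβ, hSβ⟩ := exists_isIntegral_generator S hS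
  choose! h hh using hSβ
  choose D hD g hg using exists_nsmul_eq_map
  set E : ℕ := ∏ x ∈ S, D (h x)
  have hE : E ≠ 0 := Finset.prod_ne_zero_iff.2 fun x _ => hD _
  obtain ⟨p, hBp, hp, r, hr⟩ := exists_prime_root (minpoly ℤ β) (minpoly.degree_pos hβ) (B + E + 1)
  have := Fact.mk hp
  let R := Algebra.adjoin ℤ {β}
  let ρ : AdjoinRoot (minpoly ℤ β) →+* ZMod p :=
    AdjoinRoot.lift (Int.castRingHom (ZMod p)) (r : ZMod p) (by
      rw [eval₂_at_intCast, eq_intCast, ZMod.intCast_zmod_eq_zero_iff_dvd]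
      simpa using hr)
  let ρ' : R →+* ZMod p := ρ.comp (minpoly.equivAdjoin hβ).symm.toRingEquiv.toRingHom
  have hE1 : IsUnit (ρ' (E : R)) := by
    rw [map_natCast, isUnit_iff_ne_zero, Ne, ZMod.natCast_eq_zero_iff]
    exact fun hd => by have := Nat.le_of_dvd (Nat.pos_of_ne_zero hE) hd; omega
  have hE2 : IsUnit (R.subtype (E : R)) := by
    rw [map_natCast, isUnit_iff_ne_zero]
    exact_mod_cast hE
  refine ⟨p, by omega, hp, Localization.Away (E : R), inferInstance,
    IsLocalization.Away.lift (E : R) hE2, IsLocalization.Away.lift (E : R) hE1, ?_, fun x hx => ?_⟩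
  · refine (IsLocalization.lift_injective_iff _).2 fun x y => ⟨fun hxy => ?_, fun hxy => ?_⟩
    · have h := congrArg
        (IsLocalization.Away.lift (S := Localization.Away (E : R)) (E : R) hE2) hxy
      rwa [IsLocalization.Away.lift_eq, IsLocalization.Away.lift_eq] at h
    · exact congrArg _ (Subtype.ext hxy)
  · obtain ⟨c, hc⟩ : D (h x) ∣ E := Finset.dvd_prod_of_mem (fun x => D (h x)) hx
    let y : R := c • ⟨aeval β (g (h x)), aeval_mem_adjoin_singleton ℤ β⟩
    have hy : (y : ℂ) = E * x := by
      have h1 := congrArg (aeval β) (hg (h x))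
      rw [map_nsmul, hh x hx] at h1
      change aeval β ((g (h x)).map (algebraMap ℤ ℚ)) = _ at h1
      rw [aeval_map_algebraMap] at h1
      change c • aeval β (g (h x)) = _
      rw [h1, hc]
      simp only [nsmul_eq_mul]
      push_cast
      ring
    refine ⟨IsLocalization.mk' _ y (⟨E, Submonoid.mem_powers _⟩ : Submonoid.powers (E : R)), ?_⟩
    refine (IsLocalization.lift_mk'_spec _ _ _ _).2 ?_
    simpa using! hy

/-- The lattice `ℤ^k` inside the `ℚ[X]`-module `⨁ ℚ[X] / (a j)` attached to a matrix with invariant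
factors `a j`. -/
theorem exists_lattice_embedding {k : ℕ} (A : Matrix.GeneralLinearGroup (Fin k) ℤ)
    {b : ℕ} {a : Fin b → ℚ[X]}
    (θ : (Module.AEval' (Matrix.toLin' ((A : Matrix (Fin k) (Fin k) ℤ).map ((↑·) : ℤ → ℚ))))
          ≃ₗ[ℚ[X]] ((j : Fin b) → ℚ[X] ⧸ Ideal.span {a j}))
    {φ : (Fin k → ℤ) ≃+ (Fin k → ℤ)} (hφ : ∀ w, φ w = (A : Matrix (Fin k) (Fin k) ℤ).mulVec w) :
    ∃ T : (Fin k → ℤ) →+ ((j : Fin b) → ℚ[X] ⧸ Ideal.span {a j}), Function.Injective T ∧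
      (∀ w, T (φ w) = (X : ℚ[X]) • T w) ∧ ∀ y, ∃ E : ℕ, E ≠ 0 ∧ ∃ w, T w = E • y := by
  set M := Matrix.toLin' ((A : Matrix (Fin k) (Fin k) ℤ).map ((↑·) : ℤ → ℚ))
  let T : (Fin k → ℤ) →+ ((j : Fin b) → ℚ[X] ⧸ Ideal.span {a j}) :=
    AddMonoidHom.mk' (fun w => θ (Module.AEval'.of M fun i => (w i : ℚ))) fun u v => by
      rw [← map_add, ← map_add]
      congr 2
      ext i
      simp
  have hT (w) : T w = θ (Module.AEval'.of M fun i => (w i : ℚ)) := rfl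
  refine ⟨T, fun u v h => ?_, fun w => ?_, fun y => ?_⟩
  · ext i
    exact_mod_cast congrFun ((Module.AEval'.of M).injective (θ.injective h)) i
  · rw [hT, hT, ← map_smul, Module.AEval'.X_smul_of]
    congr 2
    ext i
    simp [M, hφ, Matrix.mulVec, dotProduct]
  · set v : Fin k → ℚ := (Module.AEval'.of M).symm (θ.symm y)
    have hd (i) : (v i).den ∣ ∏ i, (v i).den := Finset.dvd_prod_of_mem _ (Finset.mem_univ i)
    choose c hc using hd
    refine ⟨∏ i, (v i).den, Finset.prod_ne_zero_iff.2 fun i _ => (v i).den_nz,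
      fun i => (v i).num * c i, ?_⟩
    have : (fun i => (((v i).num * c i : ℤ) : ℚ)) = (∏ i, (v i).den) • v := by
      ext i
      rw [Pi.smul_apply, nsmul_eq_mul, hc i]
      push_cast
      rw [← Rat.mul_den_eq_num]
      ring
    rw [hT, this, map_nsmul, map_nsmul, LinearEquiv.apply_symm_apply, LinearEquiv.apply_symm_apply]

namespace ZExtension

theorem map_aeval_toEnd {N V : Type*} [AddCommGroup N] [AddCommGroup V] [Module ℚ[X] V]
    {φ : N ≃+ N} {T : N →+ V} (hT : ∀ w, T (φ w) = (X : ℚ[X]) • T w) (P : ℤ[X]) (w : N) :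
    T (aeval (toEnd φ) P w) = P.map (Int.castRingHom ℚ) • T w := by
  induction P using Polynomial.induction_on' generalizing w with
  | add p q hp hq => simp [add_smul, hp, hq]
  | monomial n c =>
    have (n : ℕ) (w : N) : T ((toEnd φ ^ n) w) = (X ^ n : ℚ[X]) • T w := by
      induction n generalizing w with
      | zero => simp
      | succ n ih =>
        rw [pow_succ, Module.End.mul_apply, ih, pow_succ, mul_smul, ← hT]
        rfl
    rw [aeval_monomial, Module.End.mul_apply, Module.algebraMap_end_apply, map_zsmul, this,
      map_monomial, ← C_mul_X_pow_eq_monomial, mul_smul, eq_intCast, map_intCast,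
      Int.cast_smul_eq_zsmul]

/-- The radical of a nonzero rational polynomial, cleared of denominators. -/
theorem exists_int_radical {q : ℚ[X]} (hq : q ≠ 0) :
    ∃ s : ℤ[X], s ≠ 0 ∧ s.natDegree = (q.map (algebraMap ℚ ℂ)).roots.toFinset.card ∧
      ∃ m, q ∣ (s ^ m).map (Int.castRingHom ℚ) := by
  classical
  set r := UniqueFactorizationMonoid.radical q
  obtain ⟨m, hm⟩ := UniqueFactorizationMonoid.exists_dvd_radical_self_pow hq
  obtain ⟨D, hD, s, hs⟩ := exists_nsmul_eq_map r
  have hr : r ≠ 0 := UniqueFactorizationMonoid.radical_ne_zero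
  have hD' : (C (D : ℚ)) ≠ 0 := by simpa using hD
  rw [nsmul_eq_mul, ← C_eq_natCast] at hs
  have hs0 : s ≠ 0 := by
    rintro rfl
    rw [Polynomial.map_zero] at hs
    exact mul_ne_zero hD' hr hs.symm
  refine ⟨s, hs0, ?_, m, ?_⟩
  · rw [← natDegree_map_eq_of_injective (f := Int.castRingHom ℚ) Int.cast_injective, hs,
      natDegree_C_mul (by simpa using hD)]
    have hsep : r.Separable := PerfectField.separable_iff_squarefree.2
      (UniqueFactorizationMonoid.squarefree_radical)
    rw [← card_rootSet_eq_natDegree hsep (IsAlgClosed.splits (r.map (algebraMap ℚ ℂ))),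
      ← Nat.card_eq_fintype_card, Nat.card_coe_set_eq, rootSet_def, Set.ncard_coe_finset]
    congr 1
    ext x
    rw [Multiset.mem_toFinset, Multiset.mem_toFinset, mem_roots_map hr, mem_roots_map hq,
      ← aeval_def, ← aeval_def]
    refine ⟨aeval_eq_zero_of_dvd_aeval_eq_zero UniqueFactorizationMonoid.radical_dvd_self,
      fun h => ?_⟩
    have := aeval_eq_zero_of_dvd_aeval_eq_zero hm h
    rw [map_pow] at this
    exact eq_zero_of_pow_eq_zero this
  · rw [Polynomial.map_pow, hs, mul_pow]
    exact hm.mul_left _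

end ZExtension

theorem quotient_smul_eq_mk_mul {R : Type*} [CommRing R] (I : Ideal R) (r : R) (y : R ⧸ I) :
    r • y = Ideal.Quotient.mk I r * y := by
  obtain ⟨y, rfl⟩ := Ideal.Quotient.mk_surjective y
  rfl

namespace ZExtension

variable {k b : ℕ} {φ : (Fin k → ℤ) ≃+ (Fin k → ℤ)} {a : Fin (b + 1) → ℚ[X]}
  {T : (Fin k → ℤ) →+ ((j : Fin (b + 1)) → ℚ[X] ⧸ Ideal.span {a j})}

theorem maxSubgroupCount_le_of_embedding (ha : a 0 ≠ 0) (hT : Function.Injective T)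
    (hTX : ∀ w, T (φ w) = (X : ℚ[X]) • T w) {e : Fin (b + 1) → (Fin k → ℤ)} {E : Fin (b + 1) → ℕ}
    (hE : ∀ j, E j ≠ 0) (hTe : ∀ j, T (e j) = E j • Pi.single j 1) {χ : ℤ[X]} (hχ : χ.Monic)
    (hχφ : aeval (toEnd φ) χ = 0) :
    ∃ C : ℝ, ∃ n₀ : ℕ, ∀ n : ℕ, n₀ ≤ n → (maxSubgroupCount (ZExtension φ) n : ℝ) ≤
      ((a 0).map (algebraMap ℚ ℂ)).roots.toFinset.card * (n : ℝ) ^ (b + 1) + C * (n : ℝ) ^ b := by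
  classical
  obtain ⟨s, hs, hsdeg, m, hm⟩ := exists_int_radical ha
  have hev (P w) : T (aeval (toEnd φ) P w) = P.map (Int.castRingHom ℚ) • T w :=
    map_aeval_toEnd (T := T) hTX P w
  have hse : aeval (toEnd φ) (s ^ m) (e 0) = 0 := hT <| by
    rw [map_zero, hev, hTe, smul_comm]
    ext j
    rw [Pi.smul_apply, Pi.smul_apply, quotient_smul_eq_mk_mul, Pi.zero_apply]
    obtain rfl | hj := eq_or_ne j 0
    · rw [Ideal.Quotient.eq_zero_iff_mem.2 (Ideal.mem_span_singleton.2 hm), zero_mul, smul_zero]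
    · rw [Pi.single_eq_of_ne hj, mul_zero, smul_zero]
  have hrep (i : Fin k) (j : Fin (b + 1)) :
      ∃ q : ℚ[X], Ideal.Quotient.mk (Ideal.span {a j}) q = T (Pi.single i 1) j :=
    Ideal.Quotient.mk_surjective _
  choose q hq using hrep
  choose D hD g hg using exists_nsmul_eq_map
  set d : Fin k → ℕ := fun i => ∏ j, (D (q i j) * E j)
  have hd (i j) : D (q i j) * E j ∣ d i :=
    Finset.dvd_prod_of_mem (fun j => D (q i j) * E j) (Finset.mem_univ j)
  choose c hc using hd
  rw [← hsdeg]
  refine maxSubgroupCount_le_of_generators e (d := d) (h := fun i j => c i j * g (q i j))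
    (fun i => Finset.prod_ne_zero_iff.2 fun j _ => mul_ne_zero (hD _) (hE _)) (fun i => hT ?_)
    hs hχ hse hχφ
  rw [map_nsmul, map_sum]
  ext j
  rw [Pi.smul_apply, Finset.sum_apply, Finset.sum_eq_single j _ (by simp)]
  · rw [hev, hTe, Pi.smul_apply, Pi.smul_apply, Pi.single_eq_same, quotient_smul_eq_mk_mul, hc i j,
      ← hq, nsmul_eq_mul, Polynomial.map_mul, hg]
    simp only [nsmul_eq_mul, map_mul, map_natCast, Polynomial.map_natCast]
    push_cast
    ring
  · intro j' _ hj
    rw [hev, hTe, Pi.smul_apply, Pi.smul_apply, Pi.single_eq_of_ne hj.symm, smul_zero, smul_zero]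

theorem exists_le_maxSubgroupCount_of_embedding (hdvd : ∀ j, a 0 ∣ a j) (ha : a 0 ≠ 0)
    (hTX : ∀ w, T (φ w) = (X : ℚ[X]) • T w) {e : Fin (b + 1) → (Fin k → ℤ)} {E : Fin (b + 1) → ℕ}
    (hE : ∀ j, E j ≠ 0) (hTe : ∀ j, T (e j) = E j • Pi.single j 1) (m : ℕ) : ∃ n, m ≤ n ∧
      ((a 0).map (algebraMap ℚ ℂ)).roots.toFinset.card * n ^ (b + 1) ≤
        maxSubgroupCount (ZExtension φ) n := by
  classical
  set R := ((a 0).map (algebraMap ℚ ℂ)).roots.toFinset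
  have hR (x : R) : aeval (x : ℂ) (a 0) = 0 := by
    have := x.2
    rwa [Multiset.mem_toFinset, mem_roots_map ha, ← aeval_def] at this
  have hRa (x : R) (j) : aeval (x : ℂ) (a j) = 0 :=
    aeval_eq_zero_of_dvd_aeval_eq_zero (hdvd j) (hR x)
  let ev (x : R) (j : Fin (b + 1)) : ℚ[X] ⧸ Ideal.span {a j} →+* ℂ :=
    Ideal.Quotient.lift _ (aeval (x : ℂ)).toRingHom fun y hy => by
      obtain ⟨z, rfl⟩ := Ideal.mem_span_singleton.1 hy
      simp [hRa x j]
  let Λ (x : R) (j : Fin (b + 1)) : (Fin k → ℤ) →+ ℂ :=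
    ((ev x j : _ →+ ℂ).comp (Pi.evalAddMonoidHom _ j)).comp T
  have hΛ (x j w) : Λ x j w = ev x j (T w j) := rfl
  have hΛX (x j w) : Λ x j (φ w) = x * Λ x j w := by
    rw [hΛ, hTX, Pi.smul_apply, quotient_smul_eq_mk_mul, map_mul, ← hΛ]
    congr 1
    exact aeval_X (x : ℂ)
  have hΛe (x j j') : Λ x j (e j') = if j = j' then (E j' : ℂ) else 0 := by
    rw [hΛ, hTe]
    split_ifs with h
    · subst h; simp
    · simp [Pi.single_eq_of_ne h]
  set S : Finset ℂ := R ∪ (Finset.univ.image fun x : R × R => ((x.1 : ℂ) - x.2)⁻¹) ∪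
    Finset.univ.image fun t : R × Fin (b + 1) × Fin k => Λ t.1 t.2.1 (Pi.single t.2.2 1)
  have hS : ∀ x ∈ S, IsAlgebraic ℚ x := by
    have hx (x : R) : IsAlgebraic ℚ (x : ℂ) := ⟨a 0, ha, hR x⟩
    intro y hy
    simp only [S, Finset.mem_union, Finset.mem_image, Finset.mem_univ, true_and] at hy
    obtain (hy | ⟨x, rfl⟩) | ⟨t, rfl⟩ := hy
    · exact hx ⟨y, hy⟩
    · exact ((hx _).sub (hx _)).inv
    · obtain ⟨P, hP⟩ := Ideal.Quotient.mk_surjective (T (Pi.single t.2.2 1) t.2.1)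
      rw [hΛ, ← hP]
      change IsAlgebraic ℚ (aeval (t.1 : ℂ) P)
      exact (show IsIntegral ℚ (aeval (t.1 : ℂ) P) from Algebra.adjoin_le
        (S := integralClosure ℚ ℂ) (Set.singleton_subset_iff.2 (hx t.1).isIntegral)
        (aeval_mem_adjoin_singleton ℚ _)).isAlgebraic
  obtain ⟨p, hp, hpp, Q, _, i, π, hi, hSi⟩ := exists_reduction S hS (m + ∑ j, E j + 1)
  have := Fact.mk hpp
  refine ⟨p, by omega, ?_⟩
  have hα (x : R) : ∃ y, i y = x := hSi _ (by simp [S])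
  choose α hα using hα
  have hl (x : R) (j : Fin (b + 1)) (w : Fin k → ℤ) : ∃ y, i y = Λ x j w := by
    change _ ∈ i.range
    rw [← Finset.univ_sum_single w, map_sum]
    refine sum_mem fun t _ => ?_
    rw [show Pi.single t (w t) = w t • (Pi.single t 1 : Fin k → ℤ) by
      rw [← Pi.single_smul', smul_eq_mul, mul_one], map_zsmul]
    refine zsmul_mem (hSi _ ?_) _
    simp only [S, Finset.mem_union, Finset.mem_image, Finset.mem_univ, true_and]
    exact Or.inr ⟨(x, j, t), rfl⟩
  choose l hl using hl
  let L (x : R) (j : Fin (b + 1)) : (Fin k → ℤ) →+ ZMod p :=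
    AddMonoidHom.mk' (fun w => π (l x j w)) fun u v => by
      rw [← map_add]
      exact congrArg π (hi (by simp [hl]))
  have key := le_maxSubgroupCount_of_eigenfunctionals (φ := φ) (α := fun x => π (α x)) (L := L)
    (e := e) (E := fun j => (E j : ZMod p)) ?_ (fun x j w => ?_) (fun j => ?_) (fun x j j' => ?_)
  · simpa using key
  · intro x y hxy
    by_contra hne
    obtain ⟨z, hz⟩ : ∃ z, i z = ((x : ℂ) - y)⁻¹ := hSi _ (by
      simp only [S, Finset.mem_union, Finset.mem_image, Finset.mem_univ, true_and]
      exact Or.inl (Or.inr ⟨(x, y), rfl⟩))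
    have h1 : (α x - α y) * z = 1 := hi (by
      rw [map_mul, map_sub, hα, hα, hz, map_one]
      exact mul_inv_cancel₀ (sub_ne_zero.2 fun h => hne (Subtype.ext h)))
    have h2 := congrArg π h1
    simp only at hxy
    rw [map_mul, map_sub, hxy, sub_self, zero_mul, map_one] at h2
    exact zero_ne_one h2
  · change π _ = π _ * π _
    rw [← map_mul]
    exact congrArg π (hi (by simp [hl, hα, hΛX]))
  · rw [Ne, ZMod.natCast_eq_zero_iff]
    intro hd
    have h1 := Nat.le_of_dvd (Nat.pos_of_ne_zero (hE j)) hd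
    have h2 := Finset.single_le_sum (f := E) (fun _ _ => Nat.zero_le _) (Finset.mem_univ j)
    omega
  · have : l x j (e j') = if j = j' then (E j' : Q) else 0 := hi (by
      rw [hl, hΛe]; split_ifs <;> simp)
    change π _ = _
    rw [this]
    split_ifs <;> simp

end ZExtension

theorem stmt2 (k : ℕ) (A : Matrix.GeneralLinearGroup (Fin k) ℤ)
    (b : ℕ) (hb : 0 < b) (a : Fin b → ℚ[X])
    (hmonic : ∀ j, (a j).Monic) (hnu : ∀ j, ¬ IsUnit (a j))
    (hdvd : ∀ i j : Fin b, i ≤ j → a i ∣ a j)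
    -- `ℚ^k`, regarded as a `ℚ[x]`-module with `x` acting as `A`, decomposes as
    -- `⊕_{j=1}^b ℚ[x]/(a_j)` (the `a_j` are the invariant factors of `A`)
    (hiso : Nonempty
      ((Module.AEval' (Matrix.toLin' ((A : Matrix (Fin k) (Fin k) ℤ).map ((↑·) : ℤ → ℚ))))
          ≃ₗ[ℚ[X]] ((j : Fin b) → ℚ[X] ⧸ Ideal.span {a j})))
    (ρ₁ : ℕ)
    (hρ : ρ₁ = ((a ⟨0, hb⟩).map (algebraMap ℚ ℂ)).roots.toFinset.card) :
    (∃ C : ℝ, ∃ n₀ : ℕ, ∀ n : ℕ, n₀ ≤ n →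
      (maxSubgroupCount (zkByZ k A) n : ℝ) ≤ ρ₁ * (n : ℝ) ^ b + C * (n : ℝ) ^ (b - 1)) ∧
    (∀ m : ℕ, ∃ n : ℕ, m ≤ n ∧
      (ρ₁ : ℝ) * (n : ℝ) ^ b ≤ (maxSubgroupCount (zkByZ k A) n : ℝ)) := by
  obtain ⟨b, rfl⟩ := Nat.exists_eq_add_one_of_ne_zero hb.ne'
  obtain ⟨θ⟩ := hiso
  subst hρ
  set φ : (Fin k → ℤ) ≃+ (Fin k → ℤ) := (LinearMap.GeneralLinearGroup.generalLinearEquiv ℤ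
    (Fin k → ℤ) (Matrix.GeneralLinearGroup.toLin A)).toAddEquiv
  have hφ (w) : φ w = (A : Matrix (Fin k) (Fin k) ℤ).mulVec w := rfl
  obtain ⟨T, hT, hTX, hT'⟩ := exists_lattice_embedding A θ hφ
  choose E hE e he using fun j => hT' (Pi.single j 1)
  have hχφ : aeval (ZExtension.toEnd φ) (A : Matrix (Fin k) (Fin k) ℤ).charpoly = 0 := by
    have h := LinearMap.aeval_self_charpoly (Matrix.toLin' (A : Matrix (Fin k) (Fin k) ℤ))
    rw [Matrix.charpoly_toLin'] at h
    exact (congrArg (fun f => aeval f _) (LinearMap.ext hφ)).trans h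
  refine ⟨?_, fun m => ?_⟩
  · exact ZExtension.maxSubgroupCount_le_of_embedding (φ := φ) (hmonic 0).ne_zero hT hTX hE he
      (Matrix.charpoly_monic _) hχφ
  · obtain ⟨n, hn, h⟩ := ZExtension.exists_le_maxSubgroupCount_of_embedding (φ := φ)
      (fun j => hdvd 0 j (Fin.zero_le j)) (hmonic 0).ne_zero hTX hE he m
    exact ⟨n, hn, by exact_mod_cast h⟩
end

section
/- Let ℤ^ℓ be the free abelian group of rank ℓ and let S be a finite simple ℤ^ℓ-module. Then |Der(ℤ^ℓ, S)| = |S|^ℓ if the action of ℤ^ℓ on S is trivial, and |Der(ℤ^ℓ, S)| = |S| otherwise. -/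
/-- Derivations for a trivial action of `ℤ^ι` are families of elements indexed by `ι`. -/
theorem card_derivations_of_trivial {ι : Type*} [Fintype ι] {S : Type*}
    [AddCommGroup S] [DistribMulAction (Multiplicative (ι → ℤ)) S]
    (htriv : ∀ (g : Multiplicative (ι → ℤ)) (s : S), g • s = s) :
    Nat.card {δ : Multiplicative (ι → ℤ) → S // ∀ g h, δ (g * h) = δ g + g • δ h} =
      Nat.card S ^ Fintype.card ι := by
  let e : {δ : Multiplicative (ι → ℤ) → S // ∀ g h, δ (g * h) = δ g + g • δ h} ≃
      ((ι → ℤ) →ₗ[ℤ] S) :=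
    { toFun := fun δ => (AddMonoidHom.mk' (fun v => δ.1 (Multiplicative.ofAdd v))
        (fun v w => by rw [ofAdd_add, δ.2, htriv])).toIntLinearMap
      invFun := fun f => ⟨fun g => f g.toAdd, fun g h => by simp only [toAdd_mul, map_add, htriv]⟩
      left_inv := fun _ => rfl
      right_inv := fun _ => rfl }
  rw [Nat.card_congr (e.trans ((Pi.basisFun ℤ ι).constr ℤ).symm.toEquiv), Nat.card_fun,
    Nat.card_eq_fintype_card (α := ι)]

/-- If some element `a` of a commutative group acts on `A` so that `x ↦ a • x - x` is bijective,
then a derivation is determined by its arbitrary value at `a`. -/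
theorem card_derivations_of_bijective_smul_sub {G A : Type*} [CommGroup G] [AddCommGroup A]
    [DistribMulAction G A] (a : G) (ha : Function.Bijective fun x : A => a • x - x) :
    Nat.card {δ : G → A // ∀ g h, δ (g * h) = δ g + g • δ h} = Nat.card A := by
  refine Nat.card_eq_of_bijective (fun δ => δ.1 a) ⟨?_, ?_⟩
  · have key : ∀ δ : {δ : G → A // ∀ g h, δ (g * h) = δ g + g • δ h}, ∀ g,
        a • δ.1 g - δ.1 g = g • δ.1 a - δ.1 a := by
      intro δ g
      have h := δ.2 a g
      rw [mul_comm, δ.2 g a] at h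
      rw [sub_eq_sub_iff_add_eq_add, add_comm, ← h, add_comm]
    intro δ ε h
    refine Subtype.ext (funext fun g => ha.1 ?_)
    dsimp only at h ⊢
    rw [key δ, key ε, h]
  · intro s
    obtain ⟨t, rfl⟩ := ha.2 s
    refine ⟨⟨fun g => g • t - t, fun g h => ?_⟩, rfl⟩
    simp only [smul_sub, mul_smul]
    abel

/-- On a finite simple module over a commutative group, `x ↦ a • x - x` is bijective
for every `a` acting nontrivially. -/
theorem bijective_smul_sub_of_simple {G A : Type*} [CommGroup G] [AddCommGroup A] [Finite A]
    [DistribMulAction G A]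
    (hsimple : ∀ B : AddSubgroup A, (∀ g : G, ∀ b ∈ B, g • b ∈ B) → B = ⊥ ∨ B = ⊤)
    {a : G} {s : A} (has : a • s ≠ s) : Function.Bijective fun x : A => a • x - x := by
  let φ : A →+ A := DistribSMul.toAddMonoidHom A a - AddMonoidHom.id A
  have mem_ker : ∀ x, x ∈ φ.ker ↔ a • x = x := fun x => sub_eq_zero
  have hker : φ.ker = ⊥ := by
    refine (hsimple φ.ker fun g b hb => ?_).resolve_right fun h => has ?_
    · rw [mem_ker] at hb ⊢
      rw [smul_comm, hb]
    · exact (mem_ker s).1 (h ▸ AddSubgroup.mem_top s)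
  exact Finite.injective_iff_bijective.1 ((AddMonoidHom.ker_eq_bot_iff φ).1 hker)

theorem stmt9 {ℓ : ℕ} {S : Type*} [AddCommGroup S] [Finite S] [Nontrivial S]
    [DistribMulAction (Multiplicative (Fin ℓ → ℤ)) S]
    -- `S` is a simple `ℤ^ℓ`-module: the only invariant subgroups are `⊥` and `⊤`
    (hsimple : ∀ B : AddSubgroup S,
      (∀ g : Multiplicative (Fin ℓ → ℤ), ∀ b ∈ B, g • b ∈ B) → B = ⊥ ∨ B = ⊤) :
    ((∀ (g : Multiplicative (Fin ℓ → ℤ)) (s : S), g • s = s) →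
      Nat.card {δ : Multiplicative (Fin ℓ → ℤ) → S // ∀ g h, δ (g * h) = δ g + g • δ h} =
        Nat.card S ^ ℓ) ∧
    ((¬ ∀ (g : Multiplicative (Fin ℓ → ℤ)) (s : S), g • s = s) →
      Nat.card {δ : Multiplicative (Fin ℓ → ℤ) → S // ∀ g h, δ (g * h) = δ g + g • δ h} =
        Nat.card S) := by
  refine ⟨fun htriv => ?_, fun hnontriv => ?_⟩
  · simpa using card_derivations_of_trivial htriv
  · push Not at hnontriv
    obtain ⟨a, s, has⟩ := hnontriv
    exact card_derivations_of_bijective_smul_sub a (bijective_smul_sub_of_simple hsimple has)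
end

section
/- Let H be a finitely generated abelian group and let S be a finite simple H-module. Then |Der(H, S)| = |Hom(H, S)| if the action of H on S is trivial, and |Der(H, S)| = |S| otherwise. -/
/-- If some `g₀` acts without nonzero fixed points on a finite module of an abelian group, then
the principal derivations are pairwise distinct and exhaust all derivations. -/
theorem natCard_derivation_of_fixedPointFree {H : Type*} [CommGroup H]
    {S : Type*} [AddCommGroup S] [Finite S] [DistribMulAction H S]
    (g₀ : H) (hfix : ∀ s : S, g₀ • s = s → s = 0) :
    Nat.card {δ : H → S // ∀ g h, δ (g * h) = δ g + g • δ h} = Nat.card S := by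
  have hinj : Function.Injective fun s : S => g₀ • s - s := by
    intro a b hab
    refine sub_eq_zero.mp (hfix _ ?_)
    rw [smul_sub, sub_eq_sub_iff_sub_eq_sub]
    exact hab
  have hsurj := Finite.surjective_of_injective hinj
  symm
  refine Nat.card_congr (Equiv.ofBijective
    (fun t : S => ⟨fun g => g • t - t, fun g h => by simp only [mul_smul, smul_sub]; abel⟩) ⟨?_, ?_⟩)
  · intro a b hab
    exact hinj (congrFun (congrArg Subtype.val hab) g₀)
  · rintro ⟨δ, hδ⟩
    obtain ⟨t, ht⟩ := hsurj (δ g₀)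
    refine ⟨t, Subtype.ext (funext fun g => hinj ?_)⟩
    have hcomm : δ g + g • δ g₀ = δ g₀ + g₀ • δ g := by
      rw [← hδ, ← hδ, mul_comm]
    have hδg : g₀ • δ g - δ g = g • δ g₀ - δ g₀ := by
      rw [sub_eq_sub_iff_add_eq_add, add_comm, ← hcomm, add_comm]
    change g₀ • (g • t - t) - (g • t - t) = g₀ • δ g - δ g
    rw [hδg, ← ht]
    simp only [smul_sub, smul_smul, mul_comm g₀ g]
    abel

/-- Derivations into a module with trivial action are group homomorphisms. -/
theorem natCard_derivation_of_trivial {H : Type*} [Group H]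
    {S : Type*} [AddCommGroup S] [DistribMulAction H S]
    (htriv : ∀ (g : H) (s : S), g • s = s) :
    Nat.card {δ : H → S // ∀ g h, δ (g * h) = δ g + g • δ h} =
      Nat.card (H →* Multiplicative S) :=
  Nat.card_congr
    { toFun := fun δ => MonoidHom.mk' (fun g => Multiplicative.ofAdd (δ.1 g)) fun g h => by
        rw [δ.2, htriv, ofAdd_add]
      invFun := fun f => ⟨fun g => (f g).toAdd, fun g h => by
        simp only [map_mul, toAdd_mul, htriv]⟩
      left_inv := fun _ => rfl
      right_inv := fun _ => rfl }

theorem stmt10 {H : Type*} [CommGroup H] [Group.FG H]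
    {S : Type*} [AddCommGroup S] [Finite S] [Nontrivial S] [DistribMulAction H S]
    -- `S` is a simple `H`-module: the only invariant subgroups are `⊥` and `⊤`
    (hsimple : ∀ B : AddSubgroup S, (∀ g : H, ∀ b ∈ B, g • b ∈ B) → B = ⊥ ∨ B = ⊤) :
    ((∀ (g : H) (s : S), g • s = s) →
      Nat.card {δ : H → S // ∀ g h, δ (g * h) = δ g + g • δ h} =
        Nat.card (H →* Multiplicative S)) ∧
    ((¬ ∀ (g : H) (s : S), g • s = s) →
      Nat.card {δ : H → S // ∀ g h, δ (g * h) = δ g + g • δ h} = Nat.card S) := by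
  refine ⟨natCard_derivation_of_trivial, fun hnontriv => ?_⟩
  push Not at hnontriv
  obtain ⟨g₀, s₀, hs₀⟩ := hnontriv
  let B : AddSubgroup S :=
    { carrier := {s | g₀ • s = s}
      zero_mem' := smul_zero g₀
      add_mem' := fun {a b} ha hb => by
        rw [Set.mem_ofPred_eq] at ha hb ⊢
        rw [smul_add, ha, hb]
      neg_mem' := fun {a} ha => by
        rw [Set.mem_ofPred_eq] at ha ⊢
        rw [smul_neg, ha] }
  have hB : B = ⊥ := by
    refine (hsimple B fun g b hb => ?_).resolve_right fun htop => hs₀ ?_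
    · change g₀ • g • b = g • b
      rw [smul_smul, mul_comm, mul_smul]
      exact congrArg (g • ·) hb
    · exact (htop ▸ AddSubgroup.mem_top s₀ : s₀ ∈ B)
  refine natCard_derivation_of_fixedPointFree g₀ fun s hs => ?_
  have hmem : s ∈ B := hs
  rwa [hB, AddSubgroup.mem_bot] at hmem
end

section
/- Let G be a finitely generated group and F a finite normal subgroup of G. Then for every integer n > |F|, m_n(G) = m_n(G/F). -/
/-- A subgroup supplementing a finite normal subgroup `F` has index at most `|F|`. -/
theorem Subgroup.index_le_card_of_sup_eq_top {G : Type*} [Group G] {H F : Subgroup G}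
    [F.Normal] [Finite F] (h : F ⊔ H = ⊤) : H.index ≤ Nat.card F := by
  refine Nat.card_le_card_of_surjective (fun f : F => (QuotientGroup.mk (f : G) : G ⧸ H)) ?_
  intro x
  obtain ⟨g, rfl⟩ := QuotientGroup.mk_surjective x
  have hg : g ∈ F ⊔ H := h ▸ Subgroup.mem_top g
  obtain ⟨f, hf, k, hk, rfl⟩ := Subgroup.mem_sup_of_normal_left.mp hg
  exact ⟨⟨f, hf⟩, (QuotientGroup.mk_mul_of_mem f hk).symm⟩

/-- A maximal subgroup of index greater than `|F|` contains the finite normal subgroup `F`. -/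
theorem Subgroup.le_of_isCoatom_of_card_lt_index {G : Type*} [Group G] {H F : Subgroup G}
    [F.Normal] [Finite F] (hH : IsCoatom H) (h : Nat.card F < H.index) : F ≤ H := by
  by_contra hF
  exact h.not_ge (index_le_card_of_sup_eq_top (hH.2 _ (right_lt_sup.mpr hF)))

theorem Subgroup.isCoatom_comap_iff_of_surjective {G K : Type*} [Group G] [Group K]
    {f : G →* K} (hf : Function.Surjective f) {H : Subgroup K} :
    IsCoatom (H.comap f) ↔ IsCoatom H := by
  refine ⟨fun h => ⟨?_, fun L hL => ?_⟩, isCoatom_comap_of_surjective hf⟩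
  · rintro rfl
    exact h.1 (comap_top f)
  · exact comap_injective hf ((h.2 _ ((comap_lt_comap_of_surjective hf).mpr hL)).trans
      (comap_top f).symm)

theorem stmt11 {G : Type*} [Group G] [Group.FG G] (F : Subgroup G) [F.Normal]
    [Finite ↥F] (n : ℕ) (hn : Nat.card ↥F < n) :
    maxSubgroupCount G n = maxSubgroupCount (G ⧸ F) n := by
  have hs := QuotientGroup.mk'_surjective F
  refine (Nat.card_congr (Equiv.ofBijective (fun H => ⟨H.1.comap (QuotientGroup.mk' F),
    (Subgroup.isCoatom_comap_iff_of_surjective hs).mpr H.2.1,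
    (H.1.index_comap_of_surjective hs).trans H.2.2⟩) ⟨?_, ?_⟩)).symm
  · exact fun H K h => Subtype.ext (Subgroup.comap_injective hs (congrArg Subtype.val h))
  · rintro ⟨H, hH, rfl⟩
    have h : (H.map (QuotientGroup.mk' F)).comap (QuotientGroup.mk' F) = H :=
      Subgroup.comap_map_eq_self (by
        simpa using Subgroup.le_of_isCoatom_of_card_lt_index hH hn)
    refine ⟨⟨H.map (QuotientGroup.mk' F), ?_, ?_⟩, Subtype.ext h⟩
    · rwa [← Subgroup.isCoatom_comap_iff_of_surjective hs, h]
    · rw [← Subgroup.index_comap_of_surjective _ hs, h]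
end

section
/- Let R be a commutative unital ring, I a maximal ideal of R with |R/I| = n finite, and N a finitely generated R-module. Then the number of submodules M of N with N/M isomorphic to R/I as R-modules equals 1 + n + n² + ⋯ + n^{s−1} = (n^s − 1)/(n − 1), where s = dim_{R/I}(R/I ⊗_R N). -/
open TensorProduct

section

variable {R K N : Type*} [CommRing R] [Field K] [Algebra R K] [AddCommGroup N] [Module R N]

lemma LinearMap.surjective_of_ne_zero_of_surjective_algebraMap
    (hK : Function.Surjective (algebraMap R K)) {f : N →ₗ[R] K} (hf : f ≠ 0) :
    Function.Surjective f := by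
  obtain ⟨x, hx⟩ := DFunLike.ne_iff.mp hf
  intro y
  obtain ⟨r, hr⟩ := hK (y / f x)
  refine ⟨r • x, ?_⟩
  rw [map_smul, Algebra.smul_def, hr, div_mul_cancel₀ _ hx]

lemma LinearMap.exists_unit_smul_eq_of_ker_eq (hK : Function.Surjective (algebraMap R K))
    {f g : N →ₗ[R] K} (hf : f ≠ 0) (hg : g ≠ 0) (h : ker f = ker g) : ∃ c : Kˣ, c • f = g := by
  obtain ⟨x, hx⟩ := surjective_of_ne_zero_of_surjective_algebraMap hK hf 1
  have key (y : N) : g y = g x * f y := by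
    obtain ⟨r, hr⟩ := hK (f y)
    have hy : y - r • x ∈ ker g := by
      rw [← h, mem_ker, map_sub, map_smul, hx, Algebra.smul_def, hr, mul_one, sub_self]
    rw [mem_ker, map_sub, map_smul, Algebra.smul_def, hr, sub_eq_zero] at hy
    rw [hy, mul_comm]
  have hgx : g x ≠ 0 := fun h0 ↦ hg <| LinearMap.ext fun y ↦ by simp [key y, h0]
  exact ⟨Units.mk0 (g x) hgx, LinearMap.ext fun y ↦ (key y).symm⟩

/-- If `R → K` is surjective onto a field, the lines of `Hom(N, K)` correspond to the submodules
of `N` with quotient `K`, a line being sent to the common kernel of its nonzero elements. -/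
noncomputable def Projectivization.equivSubmoduleQuotientEquiv
    (hK : Function.Surjective (algebraMap R K)) :
    Projectivization K (N →ₗ[R] K) ≃ {M : Submodule R N // Nonempty ((N ⧸ M) ≃ₗ[R] K)} :=
  Equiv.ofBijective
    (fun p ↦ ⟨LinearMap.ker p.rep, ⟨p.rep.quotKerEquivOfSurjective
      (LinearMap.surjective_of_ne_zero_of_surjective_algebraMap hK p.rep_nonzero)⟩⟩) <| by
    refine ⟨fun p q h ↦ ?_, fun ⟨M, ⟨e⟩⟩ ↦ ?_⟩
    · obtain ⟨c, hc⟩ := LinearMap.exists_unit_smul_eq_of_ker_eq hK q.rep_nonzero p.rep_nonzero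
        (Subtype.ext_iff.mp h).symm
      rw [← p.mk_rep, ← q.mk_rep, Projectivization.mk_eq_mk_iff]
      exact ⟨c, hc⟩
    · have hne : e.toLinearMap ∘ₗ M.mkQ ≠ 0 := by
        obtain ⟨x, hx⟩ := (e.surjective.comp M.mkQ_surjective) 1
        exact DFunLike.ne_iff.mpr ⟨x, hx.trans_ne one_ne_zero⟩
      obtain ⟨a, ha⟩ := Projectivization.exists_smul_eq_mk_rep K _ hne
      refine ⟨Projectivization.mk K _ hne, Subtype.ext ?_⟩
      change LinearMap.ker (Projectivization.mk K _ hne).rep = M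
      rw [← ha]
      ext x
      simp [Units.smul_def]

lemma card_submodule_quotient_equiv_field [Finite K]
    (hK : Function.Surjective (algebraMap R K)) :
    Nat.card {M : Submodule R N // Nonempty ((N ⧸ M) ≃ₗ[R] K)} =
      ∑ i ∈ Finset.range (Module.finrank K (K ⊗[R] N)), Nat.card K ^ i := by
  rw [← Nat.card_congr (Projectivization.equivSubmoduleQuotientEquiv hK)]
  apply Projectivization.card_of_finrank
  rw [(LinearMap.liftBaseChangeEquiv K).finrank_eq]
  exact Subspace.dual_finrank_eq

end

theorem stmt12 {R : Type*} [CommRing R] (I : Ideal R) [I.IsMaximal]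
    {N : Type*} [AddCommGroup N] [Module R N] [Module.Finite R N]
    (n : ℕ) [Finite (R ⧸ I)] (hn : Nat.card (R ⧸ I) = n) :
    Nat.card {M : Submodule R N // Nonempty ((N ⧸ M) ≃ₗ[R] (R ⧸ I))} =
      ∑ i ∈ Finset.range (Module.finrank (R ⧸ I) ((R ⧸ I) ⊗[R] N)), n ^ i := by
  subst hn
  let _ : Field (R ⧸ I) := Ideal.Quotient.field I
  exact card_submodule_quotient_equiv_field Ideal.Quotient.mk_surjective
end

section
/- Let I be an ideal of ℤ[x] and let f ∈ I be a non-constant polynomial. Then for every prime p not dividing the content of f (the gcd of the coefficients of f) and every k ≥ 1, the number of maximal ℤ[x]-submodules of ℤ[x]/I of index p^k is at most deg(f). -/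
open Polynomial

/-- The number of maximal `R`-submodules of `M` of index `n` (i.e. with quotient of
cardinality `n`). -/
noncomputable def maxSubmoduleCount (R M : Type*) [Ring R] [AddCommGroup M] [Module R M]
    (n : ℕ) : ℕ :=
  Nat.card {W : Submodule R M // IsCoatom W ∧ Nat.card (M ⧸ W) = n}

/-- A maximal ideal of `ℤ[X]` of index a power of `p` is the kernel of evaluation at some point of
the algebraic closure of `ZMod p`. -/
theorem exists_ker_eval₂_eq_of_card_quotient (p : ℕ) [Fact p.Prime] (J : Ideal ℤ[X])
    (hJ : J.IsMaximal) (k : ℕ) (hcard : Nat.card (ℤ[X] ⧸ J) = p ^ k) :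
    ∃ α : AlgebraicClosure (ZMod p),
      RingHom.ker (eval₂RingHom (Int.castRingHom (AlgebraicClosure (ZMod p))) α) = J := by
  let : Field (ℤ[X] ⧸ J) := Ideal.Quotient.field J
  have hp : p.Prime := Fact.out
  have : Finite (ℤ[X] ⧸ J) :=
    Nat.finite_of_card_ne_zero (by rw [hcard]; exact pow_ne_zero _ hp.ne_zero)
  have h_pk : ((p : ℤ[X] ⧸ J)) ^ k = 0 := by
    have h : Nat.card (ℤ[X] ⧸ J) • (1 : ℤ[X] ⧸ J) = 0 := card_nsmul_eq_zero'
    rw [hcard, nsmul_eq_mul, mul_one] at h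
    exact_mod_cast h
  have : CharP (ℤ[X] ⧸ J) p := (CharP.charP_iff_prime_eq_zero hp).2 (eq_zero_of_pow_eq_zero h_pk)
  let : Algebra (ZMod p) (ℤ[X] ⧸ J) := ZMod.algebra _ p
  have : Algebra.IsAlgebraic (ZMod p) (ℤ[X] ⧸ J) := Algebra.IsAlgebraic.of_finite _ _
  let φ : (ℤ[X] ⧸ J) →ₐ[ZMod p] AlgebraicClosure (ZMod p) := IsAlgClosed.lift
  refine ⟨φ (Ideal.Quotient.mk J X), ?_⟩
  have h : eval₂RingHom (Int.castRingHom (AlgebraicClosure (ZMod p))) (φ (Ideal.Quotient.mk J X))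
      = (φ : (ℤ[X] ⧸ J) →+* _).comp (Ideal.Quotient.mk J) :=
    Polynomial.ringHom_ext (fun a => by simp) (by simp)
  rw [h, RingHom.ker_comp_of_injective _ (RingHom.injective _), Ideal.mk_ker]

theorem stmt15 (I : Ideal ℤ[X]) (f : ℤ[X]) (hfI : f ∈ I)
    (hf : 0 < f.natDegree) -- `f` is non-constant
    (p : ℕ) (hp : p.Prime) (hcont : ¬ ((p : ℤ) ∣ f.content))
    (k : ℕ) (hk : 1 ≤ k) :
    maxSubmoduleCount ℤ[X] (ℤ[X] ⧸ I) (p ^ k) ≤ f.natDegree := by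
  classical
  have : Fact p.Prime := ⟨hp⟩
  let K := AlgebraicClosure (ZMod p)
  have : CharP K p := charP_of_injective_algebraMap (algebraMap (ZMod p) K).injective p
  have h_map : f.map (Int.castRingHom K) ≠ 0 := fun h => hcont <| by
    rw [Polynomial.dvd_content_iff_C_dvd, Polynomial.C_dvd_iff_dvd_coeff]
    intro i
    have hi := congrArg (fun q => q.coeff i) h
    simpa [CharP.intCast_eq_zero_iff K p] using hi
  have key : ∀ W : {W : Submodule ℤ[X] (ℤ[X] ⧸ I) // IsCoatom W ∧
      Nat.card ((ℤ[X] ⧸ I) ⧸ W) = p ^ k}, ∃ α : K,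
      RingHom.ker (eval₂RingHom (Int.castRingHom K) α) = Submodule.comap (Submodule.mkQ I) W.1 := by
    rintro ⟨W, hW, hcard⟩
    apply exists_ker_eval₂_eq_of_card_quotient p _ _ k
    · have h_ker : LinearMap.ker (W.mkQ.comp (Submodule.mkQ I)) =
          Submodule.comap (Submodule.mkQ I) W := by
        rw [LinearMap.ker_comp, Submodule.ker_mkQ]
      refine (Nat.card_congr ((Submodule.quotEquivOfEq _ _ h_ker.symm).trans
        (LinearMap.quotKerEquivOfSurjective _ ?_)).toEquiv).trans hcard
      exact (Submodule.mkQ_surjective W).comp (Submodule.mkQ_surjective I)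
    · exact ⟨(Submodule.isCoatom_comap_iff (Submodule.mkQ_surjective I)).2 hW⟩
  choose g hg using key
  have h_root : ∀ W, g W ∈ (f.map (Int.castRingHom K)).roots.toFinset := by
    intro W
    have hmem : f ∈ RingHom.ker (eval₂RingHom (Int.castRingHom K) (g W)) := by
      rw [hg W, Submodule.mem_comap, Submodule.mkQ_apply, (Submodule.Quotient.mk_eq_zero I).2 hfI]
      exact W.1.zero_mem
    rw [Multiset.mem_toFinset, mem_roots h_map, IsRoot, eval_map]
    exact hmem
  have h_inj : Function.Injective g := fun W W' h => by
    refine Subtype.ext (Submodule.comap_injective_of_surjective (Submodule.mkQ_surjective I) ?_)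
    rw [← hg W, ← hg W', h]
  calc maxSubmoduleCount ℤ[X] (ℤ[X] ⧸ I) (p ^ k)
      ≤ Nat.card (f.map (Int.castRingHom K)).roots.toFinset :=
        Nat.card_le_card_of_injective (fun W => ⟨g W, h_root W⟩)
          fun W W' h => h_inj (congrArg Subtype.val h)
    _ = (f.map (Int.castRingHom K)).roots.toFinset.card := by
        rw [Nat.card_eq_fintype_card, Fintype.card_coe]
    _ ≤ (f.map (Int.castRingHom K)).roots.card := Multiset.toFinset_card_le _
    _ ≤ (f.map (Int.castRingHom K)).natDegree := card_roots' _
    _ ≤ f.natDegree := natDegree_map_le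
end

section
/- Let N be a finitely generated ℤ[x]-module and suppose ℚ ⊗_ℤ N is isomorphic as a ℚ[x]-module to (⊕_{j=1}^{s₁} ℚ[x]/(a_j)) ⊕ ℚ[x]^{s₂}, where the a_j ∈ ℚ[x] are monic non-units with a_1 | a_2 | ⋯ | a_{s₁}. Then for all but finitely many primes p, every a_j has p-integral coefficients and N/pN is isomorphic as an 𝔽_p[x]-module to (⊕_{j=1}^{s₁} 𝔽_p[x]/(ā_j)) ⊕ 𝔽_p[x]^{s₂}, where ā_j denotes the reduction of a_j modulo p. -/
open Polynomial TensorProduct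

/-- The reduction mod `p` of a `p`-integral rational number. -/
noncomputable def ratRed (p : ℕ) (q : ℚ) : ZMod p :=
  (q.num : ZMod p) * (q.den : ZMod p)⁻¹

/-- The reduction mod `p` of a rational polynomial with `p`-integral coefficients. -/
noncomputable def polyRed (p : ℕ) (f : ℚ[X]) : (ZMod p)[X] :=
  f.sum fun i c => Polynomial.C (ratRed p c) * Polynomial.X ^ i

/-- A semilinear map along `ℤ[X] → ℚ[X]` which exhibits its target as the rationalization of its
source. -/
def IsRationalization {M V : Type*} [AddCommGroup M] [AddCommGroup V] [Module ℤ[X] M]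
    [Module ℚ[X] V] (i : M →ₛₗ[mapRingHom (Int.castRingHom ℚ)] V) : Prop :=
  (∀ m, i m = 0 → ∃ n : ℤ, n ≠ 0 ∧ n • m = 0) ∧ ∀ v, ∃ n : ℤ, n ≠ 0 ∧ ∃ m, i m = n • v

/-- A semilinear map along `ℤ[X] → 𝔽_p[X]` which exhibits its target as the reduction mod `p` of
its source. -/
def IsReduction {p : ℕ} {M V : Type*} [AddCommGroup M] [AddCommGroup V] [Module ℤ[X] M]
    [Module (ZMod p)[X] V] (i : M →ₛₗ[mapRingHom (Int.castRingHom (ZMod p))] V) : Prop :=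
  Function.Surjective i ∧ ∀ m, i m = 0 → ∃ m', m = (p : ℤ) • m'

section Semilinear

variable {R S : Type*} [CommRing R] [CommRing S] {σ : R →+* S}

/-- The product of two semilinear maps. -/
def semilinearProdMap {M M' V V' : Type*} [AddCommGroup M] [AddCommGroup M'] [AddCommGroup V]
    [AddCommGroup V'] [Module R M] [Module R M'] [Module S V] [Module S V']
    (i : M →ₛₗ[σ] V) (i' : M' →ₛₗ[σ] V') : M × M' →ₛₗ[σ] V × V' where
  toFun x := (i x.1, i' x.2)
  map_add' x y := by simp
  map_smul' r x := by simp

/-- The product of a family of semilinear maps. -/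
def semilinearPiMap {ι : Type*} {M V : ι → Type*} [∀ k, AddCommGroup (M k)]
    [∀ k, AddCommGroup (V k)] [∀ k, Module R (M k)] [∀ k, Module S (V k)]
    (i : ∀ k, M k →ₛₗ[σ] V k) : (∀ k, M k) →ₛₗ[σ] ∀ k, V k where
  toFun x k := i k (x k)
  map_add' x y := by ext; simp
  map_smul' r x := by ext; simp

/-- The semilinear map between quotients by principal ideals induced by a ring homomorphism. -/
def semilinearQuotMap (σ : R →+* S) (A : R) (a : S) (h : a ∣ σ A) :
    (R ⧸ Ideal.span {A}) →ₛₗ[σ] S ⧸ Ideal.span {a} :=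
  Submodule.mapQ _ _ σ.toSemilinearMap <| by
    intro x hx
    rw [Ideal.mem_span_singleton] at hx
    exact Ideal.mem_span_singleton.2 (h.trans (map_dvd σ hx))

theorem semilinearQuotMap_mk (A : R) (a : S) (h : a ∣ σ A) (x : R) :
    semilinearQuotMap σ A a h (Ideal.Quotient.mk _ x) = Ideal.Quotient.mk _ (σ x) := rfl

end Semilinear

section Rationalization

variable {M N V W : Type*} [AddCommGroup M] [AddCommGroup N] [AddCommGroup V] [AddCommGroup W]
  [Module ℤ[X] M] [Module ℤ[X] N] [Module ℚ[X] V] [Module ℚ[X] W]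

theorem IsRationalization.prodMap {i : M →ₛₗ[mapRingHom (Int.castRingHom ℚ)] V}
    {j : N →ₛₗ[mapRingHom (Int.castRingHom ℚ)] W}
    (hi : IsRationalization i) (hj : IsRationalization j) :
    IsRationalization (semilinearProdMap i j) := by
  refine ⟨fun m hm => ?_, fun v => ?_⟩
  · obtain ⟨n, hn, h⟩ := hi.1 m.1 congr(($hm).1)
    obtain ⟨n', hn', h'⟩ := hj.1 m.2 congr(($hm).2)
    exact ⟨n' * n, mul_ne_zero hn' hn, Prod.ext
      (by simp [mul_smul, h]) (by rw [mul_comm]; simp [mul_smul, h'])⟩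
  · obtain ⟨n, hn, m, h⟩ := hi.2 v.1
    obtain ⟨n', hn', m', h'⟩ := hj.2 v.2
    refine ⟨n' * n, mul_ne_zero hn' hn, (n' • m, n • m'), Prod.ext ?_ ?_⟩
    · simp [semilinearProdMap, mul_smul, h]
    · rw [mul_comm]; simp [semilinearProdMap, mul_smul, h']

theorem IsRationalization.piMap {ι : Type*} [Finite ι] {M V : ι → Type*}
    [∀ k, AddCommGroup (M k)] [∀ k, AddCommGroup (V k)] [∀ k, Module ℤ[X] (M k)]
    [∀ k, Module ℚ[X] (V k)] {i : ∀ k, M k →ₛₗ[mapRingHom (Int.castRingHom ℚ)] V k}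
    (hi : ∀ k, IsRationalization (i k)) : IsRationalization (semilinearPiMap i) := by
  classical
  cases nonempty_fintype ι
  refine ⟨fun m hm => ?_, fun v => ?_⟩
  · choose n hn h using fun k => (hi k).1 (m k) congr(($hm) k)
    refine ⟨∏ k, n k, Finset.prod_ne_zero_iff.2 fun k _ => hn k, funext fun k => ?_⟩
    rw [← Finset.prod_erase_mul _ _ (Finset.mem_univ k)]
    simp [mul_smul, h]
  · choose n hn m h using fun k => (hi k).2 (v k)
    refine ⟨∏ k, n k, Finset.prod_ne_zero_iff.2 fun k _ => hn k,
      fun k => (∏ l ∈ Finset.univ.erase k, n l) • m k, funext fun k => ?_⟩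
    rw [← Finset.prod_erase_mul _ _ (Finset.mem_univ k)]
    simp [semilinearPiMap, mul_smul, h]

theorem exists_int_smul_eq_map (g : ℚ[X]) :
    ∃ n : ℤ, n ≠ 0 ∧ ∃ G : ℤ[X], G.map (Int.castRingHom ℚ) = n • g := by
  obtain ⟨b, hb, h⟩ := IsLocalization.integerNormalization_spec (nonZeroDivisors ℤ) g
  exact ⟨b, nonZeroDivisors.ne_zero hb, _, h⟩

theorem isRationalization_polynomial :
    IsRationalization (mapRingHom (Int.castRingHom ℚ)).toSemilinearMap := by
  refine ⟨fun m hm => ⟨1, one_ne_zero, ?_⟩, exists_int_smul_eq_map⟩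
  rw [one_smul]
  exact (Polynomial.map_eq_zero_iff (Int.castRingHom ℚ).injective_int).1 hm

theorem isRationalization_quotMap (A : ℤ[X]) (a : ℚ[X]) (D : ℤ) (hD : D ≠ 0)
    (hA : A.map (Int.castRingHom ℚ) = D • a) (h : a ∣ mapRingHom (Int.castRingHom ℚ) A) :
    IsRationalization (semilinearQuotMap (mapRingHom (Int.castRingHom ℚ)) A a h) := by
  refine ⟨fun m hm => ?_, fun v => ?_⟩
  · obtain ⟨m, rfl⟩ := Ideal.Quotient.mk_surjective m
    rw [semilinearQuotMap_mk, Ideal.Quotient.eq_zero_iff_dvd] at hm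
    obtain ⟨g, hg⟩ := hm
    obtain ⟨E, hE, G, hG⟩ := exists_int_smul_eq_map g
    refine ⟨D * E, mul_ne_zero hD hE, ?_⟩
    rw [← map_zsmul, Ideal.Quotient.eq_zero_iff_dvd]
    refine ⟨G, Polynomial.map_injective _ (Int.castRingHom ℚ).injective_int ?_⟩
    rw [coe_mapRingHom] at hg
    rw [← coe_mapRingHom, map_zsmul, map_mul, coe_mapRingHom, hg, hA, hG]
    simp only [zsmul_eq_mul, Int.cast_mul]
    ring
  · obtain ⟨v, rfl⟩ := Ideal.Quotient.mk_surjective v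
    obtain ⟨n, hn, G, hG⟩ := exists_int_smul_eq_map v
    refine ⟨n, hn, Ideal.Quotient.mk _ G, ?_⟩
    rw [semilinearQuotMap_mk, coe_mapRingHom, hG, map_zsmul]

theorem IsRationalization.isLocalizedModule
    {i : M →ₛₗ[mapRingHom (Int.castRingHom ℚ)] V} (hi : IsRationalization i) :
    letI := Module.compHom V (mapRingHom (Int.castRingHom ℚ))
    IsLocalizedModule ((nonZeroDivisors ℤ).map (C : ℤ →+* ℤ[X]))
      (⟨⟨i, map_add i⟩, fun r x => i.map_smulₛₗ r x⟩ : M →ₗ[ℤ[X]] V) := by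
  let := Module.compHom V (mapRingHom (Int.castRingHom ℚ))
  have key (n : ℤ) (v : V) : (C n : ℤ[X]) • v = (C (n : ℚ) : ℚ[X]) • v := by
    change (mapRingHom (Int.castRingHom ℚ) (C n)) • v = _
    simp
  have keyZ (n : ℤ) (v : V) : (C n : ℤ[X]) • v = n • v := by
    rw [← Int.cast_smul_eq_zsmul ℤ[X] n v]; simp
  have keyM (n : ℤ) (v : M) : (C n : ℤ[X]) • v = n • v := by
    rw [← Int.cast_smul_eq_zsmul ℤ[X] n v]; simp
  refine ⟨?_, fun v => ?_, fun {x y} hxy => ?_⟩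
  · rintro ⟨_, n, hn, rfl⟩
    have hn' : (n : ℚ) ≠ 0 := Int.cast_ne_zero.2 (nonZeroDivisors.ne_zero hn)
    rw [Module.End.isUnit_iff]
    refine ⟨fun x y hxy => ?_, fun y => ⟨(C (n : ℚ)⁻¹ : ℚ[X]) • y, ?_⟩⟩
    · change (C n : ℤ[X]) • x = (C n : ℤ[X]) • y at hxy
      rw [key, key] at hxy
      have := congrArg (fun z => (C (n : ℚ)⁻¹ : ℚ[X]) • z) hxy
      simpa [smul_smul, ← C_mul, hn', -map_intCast] using this
    · change (C n : ℤ[X]) • (C (n : ℚ)⁻¹ : ℚ[X]) • y = y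
      rw [key, smul_smul, ← C_mul, mul_inv_cancel₀ hn', C_1, one_smul]
  · obtain ⟨n, hn, m, h⟩ := hi.2 v
    refine ⟨(m, ⟨C n, n, mem_nonZeroDivisors_of_ne_zero hn, rfl⟩), ?_⟩
    change (C n : ℤ[X]) • v = i m
    rw [h, keyZ]
  · obtain ⟨n, hn, h⟩ := hi.1 (x - y) (by rw [map_sub]; exact sub_eq_zero.2 hxy)
    refine ⟨⟨C n, n, mem_nonZeroDivisors_of_ne_zero hn, rfl⟩, ?_⟩
    change (C n : ℤ[X]) • x = (C n : ℤ[X]) • y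
    rw [keyM, keyM, ← sub_eq_zero, ← smul_sub, h]

theorem IsRationalization.exists_lift {i : M →ₛₗ[mapRingHom (Int.castRingHom ℚ)] V}
    {j : N →ₛₗ[mapRingHom (Int.castRingHom ℚ)] W} [Module.Finite ℤ[X] M]
    (hj : IsRationalization j) (e : V →ₗ[ℚ[X]] W) :
    ∃ (φ : M →ₗ[ℤ[X]] N) (n : ℤ), n ≠ 0 ∧ ∀ m, j (φ m) = n • e (i m) := by
  let := Module.compHom W (mapRingHom (Int.castRingHom ℚ))
  have := hj.isLocalizedModule
  have : Module.FinitePresentation ℤ[X] M := Module.finitePresentation_of_finite _ _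
  let g : M →ₗ[ℤ[X]] W := ⟨⟨fun m => e (i m), by simp⟩, fun r x => by
    simp only [map_smulₛₗ, RingHom.id_apply]; rfl⟩
  obtain ⟨φ, ⟨_, n, hn, rfl⟩, h⟩ := Module.FinitePresentation.exists_lift_of_isLocalizedModule
    ((nonZeroDivisors ℤ).map (C : ℤ →+* ℤ[X]))
    (⟨⟨j, map_add j⟩, fun r x => j.map_smulₛₗ r x⟩ : N →ₗ[ℤ[X]] W) g
  refine ⟨φ, n, nonZeroDivisors.ne_zero hn, fun m => ?_⟩
  refine (LinearMap.congr_fun h m).trans ?_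
  change (C n : ℤ[X]) • e (i m) = _
  rw [← Int.cast_smul_eq_zsmul ℤ[X] n]; simp

theorem IsRationalization.exists_int_smul_eq_zero {i : M →ₛₗ[mapRingHom (Int.castRingHom ℚ)] V}
    [Module.Finite ℤ[X] N] (hi : IsRationalization i) (g : N →ₗ[ℤ[X]] M)
    (hg : ∀ m, i (g m) = 0) : ∃ n : ℤ, n ≠ 0 ∧ ∀ m, n • g m = 0 := by
  let := Module.compHom V (mapRingHom (Int.castRingHom ℚ))
  have := hi.isLocalizedModule
  obtain ⟨⟨_, n, hn, rfl⟩, h⟩ := Module.Finite.exists_smul_of_comp_eq_of_isLocalizedModule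
    ((nonZeroDivisors ℤ).map (C : ℤ →+* ℤ[X]))
    (⟨⟨i, map_add i⟩, fun r x => i.map_smulₛₗ r x⟩ : M →ₗ[ℤ[X]] V) g 0
    (by ext m; simpa using hg m)
  refine ⟨n, nonZeroDivisors.ne_zero hn, fun m => ?_⟩
  have := LinearMap.congr_fun h m
  change (C n : ℤ[X]) • g m = (C n : ℤ[X]) • 0 at this
  rw [← Int.cast_smul_eq_zsmul ℤ[X] n]
  simpa using this

/-- Finitely generated `ℤ[X]`-modules with isomorphic rationalizations are isomorphic up to
multiplication by a nonzero integer. -/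
theorem IsRationalization.exists_almost_inverse
    {i : M →ₛₗ[mapRingHom (Int.castRingHom ℚ)] V} {j : N →ₛₗ[mapRingHom (Int.castRingHom ℚ)] W}
    [Module.Finite ℤ[X] M] [Module.Finite ℤ[X] N]
    (hi : IsRationalization i) (hj : IsRationalization j) (e : V ≃ₗ[ℚ[X]] W) :
    ∃ (φ : M →ₗ[ℤ[X]] N) (ψ : N →ₗ[ℤ[X]] M) (c : ℤ), c ≠ 0 ∧ (∀ m, ψ (φ m) = c • m) ∧
      ∀ l, φ (ψ l) = c • l := by
  obtain ⟨φ, n, hn, hφ⟩ := hj.exists_lift (i := i) e.toLinearMap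
  obtain ⟨ψ, n', hn', hψ⟩ := hi.exists_lift (i := j) e.symm.toLinearMap
  obtain ⟨k, hk, h⟩ := hi.exists_int_smul_eq_zero (ψ ∘ₗ φ - (n' * n) • LinearMap.id)
    (fun m => by simp [hψ, hφ, mul_smul, smul_comm n' n])
  obtain ⟨k', hk', h'⟩ := hj.exists_int_smul_eq_zero (φ ∘ₗ ψ - (n' * n) • LinearMap.id)
    (fun m => by simp [hψ, hφ, mul_smul, smul_comm n n'])
  simp only [LinearMap.sub_apply, LinearMap.comp_apply, LinearMap.smul_apply, LinearMap.id_apply,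
    smul_sub, sub_eq_zero] at h h'
  refine ⟨φ, (k * k') • ψ, k * k' * (n' * n), by positivity, fun m => ?_, fun l => ?_⟩
  · rw [mul_comm k k', LinearMap.smul_apply, mul_smul, h, mul_smul (k' * k), mul_smul k']
  · rw [LinearMap.smul_apply, map_zsmul, mul_smul, h', mul_smul (k * k'), mul_smul k]

end Rationalization

section Reduction

variable {p : ℕ} {M N V W : Type*} [AddCommGroup M] [AddCommGroup N] [AddCommGroup V]
  [AddCommGroup W] [Module ℤ[X] M] [Module ℤ[X] N] [Module (ZMod p)[X] V] [Module (ZMod p)[X] W]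

theorem IsReduction.prodMap {i : M →ₛₗ[mapRingHom (Int.castRingHom (ZMod p))] V}
    {j : N →ₛₗ[mapRingHom (Int.castRingHom (ZMod p))] W}
    (hi : IsReduction i) (hj : IsReduction j) : IsReduction (semilinearProdMap i j) := by
  refine ⟨hi.1.prodMap hj.1, fun m hm => ?_⟩
  obtain ⟨n, h⟩ := hi.2 m.1 congr(($hm).1)
  obtain ⟨n', h'⟩ := hj.2 m.2 congr(($hm).2)
  exact ⟨(n, n'), Prod.ext h h'⟩

theorem IsReduction.piMap {ι : Type*} {M V : ι → Type*}
    [∀ k, AddCommGroup (M k)] [∀ k, AddCommGroup (V k)] [∀ k, Module ℤ[X] (M k)]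
    [∀ k, Module (ZMod p)[X] (V k)]
    {i : ∀ k, M k →ₛₗ[mapRingHom (Int.castRingHom (ZMod p))] V k}
    (hi : ∀ k, IsReduction (i k)) : IsReduction (semilinearPiMap i) := by
  refine ⟨Function.Surjective.piMap fun k => (hi k).1, fun m hm => ?_⟩
  choose n h using fun k => (hi k).2 (m k) congr(($hm) k)
  exact ⟨n, funext h⟩

theorem exists_eq_zsmul_of_map_eq_zero (m : ℤ[X]) (hm : m.map (Int.castRingHom (ZMod p)) = 0) :
    ∃ m', m = (p : ℤ) • m' := by
  have : (C (p : ℤ) : ℤ[X]) ∣ m := by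
    rw [C_dvd_iff_dvd_coeff]
    intro k
    rw [← ZMod.intCast_zmod_eq_zero_iff_dvd]
    simpa using congr(($hm).coeff k)
  obtain ⟨m', rfl⟩ := this
  exact ⟨m', by simp⟩

theorem isReduction_polynomial :
    IsReduction (mapRingHom (Int.castRingHom (ZMod p))).toSemilinearMap :=
  ⟨Polynomial.map_surjective _ (ZMod.ringHom_surjective _), exists_eq_zsmul_of_map_eq_zero⟩

theorem isReduction_quotMap (A : ℤ[X]) (a : (ZMod p)[X])
    (hA : A.map (Int.castRingHom (ZMod p)) ∣ a)
    (h : a ∣ mapRingHom (Int.castRingHom (ZMod p)) A) :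
    IsReduction (semilinearQuotMap (mapRingHom (Int.castRingHom (ZMod p))) A a h) := by
  refine ⟨fun v => ?_, fun m hm => ?_⟩
  · obtain ⟨v, rfl⟩ := Ideal.Quotient.mk_surjective v
    obtain ⟨G, rfl⟩ := isReduction_polynomial.1 v
    exact ⟨Ideal.Quotient.mk _ G, rfl⟩
  · obtain ⟨m, rfl⟩ := Ideal.Quotient.mk_surjective m
    rw [semilinearQuotMap_mk, Ideal.Quotient.eq_zero_iff_dvd] at hm
    obtain ⟨g, hg⟩ := hA.trans hm
    obtain ⟨G, rfl⟩ := Polynomial.map_surjective _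
      (ZMod.ringHom_surjective (Int.castRingHom (ZMod p))) g
    obtain ⟨m', hm'⟩ := exists_eq_zsmul_of_map_eq_zero (p := p) (m - A * G)
      (by simpa [sub_eq_zero] using hg)
    refine ⟨Ideal.Quotient.mk _ m', ?_⟩
    rw [← map_zsmul, ← hm', Ideal.Quotient.mk_eq_mk_iff_sub_mem, sub_sub_cancel,
      Ideal.mem_span_singleton]
    exact dvd_mul_right _ _

/-- `ℤ[X]`-modules that are isomorphic up to multiplication by an integer prime to `p` have
isomorphic reductions mod `p`. -/
theorem IsReduction.nonempty_linearEquiv {i : M →ₛₗ[mapRingHom (Int.castRingHom (ZMod p))] V}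
    {j : N →ₛₗ[mapRingHom (Int.castRingHom (ZMod p))] W} (hi : IsReduction i)
    (hj : IsReduction j) (φ : M →ₗ[ℤ[X]] N) (ψ : N →ₗ[ℤ[X]] M) {c : ℤ}
    (hc : IsCoprime c p) (hψφ : ∀ m, ψ (φ m) = c • m) (hφψ : ∀ l, φ (ψ l) = c • l) :
    Nonempty (V ≃ₗ[(ZMod p)[X]] W) := by
  have hp (w : W) : (p : ℤ) • w = 0 := by
    rw [← Int.cast_smul_eq_zsmul (ZMod p)[X]]; simp
  have hpV (w : V) : (p : ℤ) • w = 0 := by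
    rw [← Int.cast_smul_eq_zsmul (ZMod p)[X]]; simp
  obtain ⟨u, v, huv⟩ := hc
  have hker (m : M) : i m = 0 ↔ j (φ m) = 0 := by
    refine ⟨fun h => ?_, fun h => ?_⟩
    · obtain ⟨m', rfl⟩ := hi.2 m h
      simp only [map_zsmul, hp]
    · obtain ⟨l, hl⟩ := hj.2 _ h
      have hm : m = (p : ℤ) • (u • ψ l + v • m) := by
        have := hψφ m
        rw [hl, map_zsmul] at this
        rw [smul_add, smul_comm _ u, this, smul_smul, smul_smul, ← add_smul, mul_comm (p : ℤ) v,
          huv, one_smul]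
      rw [hm, map_zsmul, hpV]
  have heq (m m' : M) : i m = i m' ↔ j (φ m) = j (φ m') := by
    rw [← sub_eq_zero, ← map_sub, hker, map_sub, map_sub, sub_eq_zero]
  let s := Function.surjInv hi.1
  have hs : ∀ y, i (s y) = y := Function.surjInv_eq hi.1
  let F : V →ₗ[(ZMod p)[X]] W :=
    { toFun y := j (φ (s y))
      map_add' x y := by
        rw [← map_add, ← map_add, ← heq, map_add, hs, hs, hs]
      map_smul' r y := by
        obtain ⟨r, rfl⟩ := Polynomial.map_surjective _
          (ZMod.ringHom_surjective (Int.castRingHom (ZMod p))) r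
        rw [RingHom.id_apply, ← coe_mapRingHom, ← map_smulₛₗ, ← map_smul, ← heq, map_smulₛₗ, hs,
          hs] }
  refine ⟨LinearEquiv.ofBijective F ⟨fun x y hxy => ?_, fun w => ?_⟩⟩
  · have := (heq _ _).2 hxy
    rwa [hs, hs] at this
  · obtain ⟨l, rfl⟩ := hj.1 w
    refine ⟨i (u • ψ l), ?_⟩
    change j (φ (s (i (u • ψ l)))) = j l
    rw [(heq _ _).1 (hs _), map_zsmul, hφψ, smul_smul, eq_sub_of_add_eq huv, sub_smul, one_smul,
      mul_comm, mul_smul, map_sub, map_zsmul, hp, sub_zero]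

end Reduction

section BaseChange

variable {M : Type*} [AddCommGroup M] (f : M →ₗ[ℤ] M)

/-- The canonical map from a module with endomorphism to its base change. -/
noncomputable def baseChangeMap (K : Type*) [CommRing K] :
    Module.AEval' f →ₛₗ[mapRingHom (Int.castRingHom K)] Module.AEval' (f.baseChange K) where
  toFun m := Module.AEval'.of (f.baseChange K) (1 ⊗ₜ (Module.AEval'.of f).symm m)
  map_add' x y := by simp [TensorProduct.tmul_add]
  map_smul' r x := by
    induction r using Polynomial.induction_on generalizing x with
    | C n =>
      have key (y : Module.AEval' (f.baseChange K)) : n • y = (n : K[X]) • y :=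
        (Int.cast_smul_eq_zsmul K[X] n y).symm
      simpa using! key _
    | add p q hp hq => simp_all [add_smul, TensorProduct.tmul_add]
    | monomial n a h =>
      rw [pow_succ, ← mul_assoc, mul_smul, h, map_mul _ _ X, mul_smul,
        coe_mapRingHom, map_X,
        Module.AEval'.X_smul_of, Module.AEval'.of_symm_X_smul, LinearMap.baseChange_tmul]

theorem isRationalization_baseChangeMap : IsRationalization (baseChangeMap f ℚ) := by
  have := (isLocalizedModule_iff_isBaseChange (nonZeroDivisors ℤ) ℚ
    (TensorProduct.mk ℤ ℚ M 1)).2 (TensorProduct.isBaseChange ℤ M ℚ)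
  refine ⟨fun m hm => ?_, fun v => ?_⟩
  · obtain ⟨c, hc⟩ := IsLocalizedModule.exists_of_eq (S := nonZeroDivisors ℤ)
      (f := TensorProduct.mk ℤ ℚ M 1) (x₁ := m) (x₂ := 0) (hm.trans (by simp; rfl))
    exact ⟨c, nonZeroDivisors.ne_zero c.2, hc.trans (smul_zero _)⟩
  · obtain ⟨x, hx⟩ := IsLocalizedModule.surj (nonZeroDivisors ℤ) (TensorProduct.mk ℤ ℚ M 1) v
    exact ⟨x.2, nonZeroDivisors.ne_zero x.2.2, x.1, hx.symm⟩

theorem isReduction_baseChangeMap (p : ℕ) : IsReduction (p := p)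
    (V := Module.AEval' (f.baseChange (ZMod p))) (baseChangeMap f (ZMod p)) := by
  refine ⟨fun v => ?_, fun m hm => ?_⟩
  · induction v using TensorProduct.induction_on with
    | zero => exact ⟨0, map_zero _⟩
    | tmul r m =>
      obtain ⟨r, rfl⟩ := ZMod.intCast_surjective r
      refine ⟨r • Module.AEval'.of f m, ?_⟩
      rw [map_zsmul]
      change r • ((1 : ZMod p) ⊗ₜ[ℤ] m) = _
      rw [TensorProduct.smul_tmul']
      simp
    | add x y hx hy =>
      obtain ⟨a, ha⟩ := hx
      obtain ⟨b, hb⟩ := hy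
      exact ⟨a + b, by rw [map_add, ha, hb]; rfl⟩
  · let g : ℤ →ₗ[ℤ] ℤ := LinearMap.lsmul ℤ ℤ (p : ℤ)
    let q : ℤ →ₗ[ℤ] ZMod p := (Int.castAddHom (ZMod p)).toIntLinearMap
    have hex : Function.Exact g q := fun x => by
      change (x : ZMod p) = 0 ↔ _
      rw [ZMod.intCast_zmod_eq_zero_iff_dvd]
      exact ⟨fun ⟨y, hy⟩ => ⟨y, hy.symm⟩, fun ⟨y, hy⟩ => ⟨y, hy.symm⟩⟩
    have := rTensor_exact M hex (ZMod.intCast_surjective)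
    obtain ⟨y, hy⟩ := (this (1 ⊗ₜ (Module.AEval'.of f).symm m)).1 (by
      rw [LinearMap.rTensor_tmul]
      change ((1 : ℤ) : ZMod p) ⊗ₜ[ℤ] _ = 0
      rw [Int.cast_one]; exact hm)
    refine ⟨Module.AEval'.of f (TensorProduct.lid ℤ M y), ?_⟩
    have h2 : TensorProduct.lid ℤ M (g.rTensor M y) = (p : ℤ) • TensorProduct.lid ℤ M y := by
      have : g.rTensor M = (p : ℤ) • LinearMap.id := by
        ext; simp [g, TensorProduct.smul_tmul']
      rw [this]; simp
    rw [← map_zsmul, ← h2, hy]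
    simp

end BaseChange

theorem associated_polyRed {p : ℕ} [Fact p.Prime] {A : ℤ[X]} {a : ℚ[X]} {D : ℤ}
    (hA : A.map (Int.castRingHom ℚ) = D • a) (hD : ¬ (p : ℤ) ∣ D)
    (hden : ∀ i, ¬ p ∣ (a.coeff i).den) :
    Associated (polyRed p a) (A.map (Int.castRingHom (ZMod p))) := by
  have hD' : (D : ZMod p) ≠ 0 := by rwa [Ne, ZMod.intCast_zmod_eq_zero_iff_dvd]
  have hcoeff (i : ℕ) : (polyRed p a).coeff i = ratRed p (a.coeff i) := by
    rw [polyRed, Polynomial.sum_def, Polynomial.finsetSum_coeff]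
    simp only [coeff_C_mul_X_pow]
    rw [Finset.sum_ite_eq]
    split_ifs with h
    · rfl
    · simp [notMem_support_iff.1 h, ratRed]
  have hu : IsUnit (C (D : ZMod p)) := Polynomial.isUnit_C.2 hD'.isUnit
  refine ⟨hu.unit, ?_⟩
  ext i
  rw [IsUnit.unit_spec, coeff_mul_C, hcoeff, coeff_map]
  have h := congr(($hA).coeff i)
  rw [coeff_map, coeff_smul, zsmul_eq_mul] at h
  have hd : ((a.coeff i).den : ZMod p) ≠ 0 := by
    rw [Ne, ZMod.natCast_eq_zero_iff]; exact hden i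
  have h3 : A.coeff i * ((a.coeff i).den : ℤ) = D * (a.coeff i).num := by
    have : (A.coeff i : ℚ) * (a.coeff i).den = D * (a.coeff i).num := by
      rw [← Rat.mul_den_eq_num (a.coeff i), ← mul_assoc, ← h]; rfl
    exact_mod_cast this
  have h4 := congrArg (Int.cast : ℤ → ZMod p) h3
  push_cast at h4
  rw [ratRed, eq_intCast]
  field_simp
  rw [mul_comm, ← h4, mul_comm]

theorem den_dvd_of_map_eq_smul {A : ℤ[X]} {a : ℚ[X]} {D : ℤ}
    (hA : A.map (Int.castRingHom ℚ) = D • a) (hD : D ≠ 0) (i : ℕ) :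
    ((a.coeff i).den : ℤ) ∣ D := by
  have h := congr(($hA).coeff i)
  rw [coeff_map, coeff_smul, zsmul_eq_mul, eq_intCast] at h
  have : a.coeff i = Rat.divInt (A.coeff i) D := by
    rw [Rat.divInt_eq_div, h]
    field_simp
  rw [this]
  exact Rat.den_dvd _ _

theorem stmt16 {M : Type*} [AddCommGroup M] (f : M →ₗ[ℤ] M)
    -- `M`, with `x` acting as `f`, is a finitely generated `ℤ[x]`-module
    [Module.Finite ℤ[X] (Module.AEval' f)]
    (s₁ s₂ : ℕ) (a : Fin s₁ → ℚ[X])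
    (hmonic : ∀ j, (a j).Monic) (hnu : ∀ j, ¬ IsUnit (a j))
    (hdvd : ∀ i j : Fin s₁, i ≤ j → a i ∣ a j)
    -- `ℚ ⊗_ℤ M ≅ (⊕_j ℚ[x]/(a_j)) ⊕ ℚ[x]^{s₂}` as `ℚ[x]`-modules
    (hiso : Nonempty ((Module.AEval' (f.baseChange ℚ)) ≃ₗ[ℚ[X]]
      (((j : Fin s₁) → ℚ[X] ⧸ Ideal.span {a j}) × (Fin s₂ → ℚ[X])))) :
    -- for all but finitely many primes `p` …
    ∃ T : Finset ℕ, ∀ p : ℕ, p.Prime → p ∉ T →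
      -- … every `a_j` has `p`-integral coefficients …
      (∀ (j : Fin s₁) (i : ℕ), ¬ (p ∣ ((a j).coeff i).den)) ∧
      -- … and `M/pM ≅ (⊕_j 𝔽_p[x]/(ā_j)) ⊕ 𝔽_p[x]^{s₂}` as `𝔽_p[x]`-modules
      Nonempty ((Module.AEval' (f.baseChange (ZMod p))) ≃ₗ[(ZMod p)[X]]
        (((j : Fin s₁) → (ZMod p)[X] ⧸ Ideal.span {polyRed p (a j)}) ×
          (Fin s₂ → (ZMod p)[X]))) := by
  classical
  obtain ⟨e⟩ := hiso
  choose D hD A hA using fun j => exists_int_smul_eq_map (a j)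
  have hdvdA (j) : a j ∣ mapRingHom (Int.castRingHom ℚ) (A j) := by
    rw [coe_mapRingHom, hA, zsmul_eq_mul]
    exact dvd_mul_left _ _
  have hL := (IsRationalization.piMap fun j =>
      isRationalization_quotMap (A j) (a j) (D j) (hD j) (hA j) (hdvdA j)).prodMap
    (IsRationalization.piMap fun _ : Fin s₂ => isRationalization_polynomial)
  obtain ⟨φ, ψ, c, hc, hψφ, hφψ⟩ :=
    (isRationalization_baseChangeMap f).exists_almost_inverse hL e
  have hE : c * ∏ j, D j ≠ 0 := mul_ne_zero hc (Finset.prod_ne_zero_iff.2 fun j _ => hD j)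
  refine ⟨(c * ∏ j, D j).natAbs.primeFactors, fun p hp hpT => ?_⟩
  have := Fact.mk hp
  have hpE : ¬ (p : ℤ) ∣ c * ∏ j, D j := fun h =>
    hpT (Nat.mem_primeFactors.2 ⟨hp, Int.natCast_dvd.1 h, Int.natAbs_ne_zero.2 hE⟩)
  have hpD (j) : ¬ (p : ℤ) ∣ D j := fun h =>
    hpE ((h.trans (Finset.dvd_prod_of_mem D (Finset.mem_univ j))).mul_left c)
  have hpc : IsCoprime c p :=
    ((Nat.prime_iff_prime_int.1 hp).coprime_iff_not_dvd.2 fun h => hpE (h.mul_right _)).symm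
  have hden (j) (i : ℕ) : ¬ p ∣ ((a j).coeff i).den := fun h =>
    hpD j ((Int.natCast_dvd_natCast.2 h).trans (den_dvd_of_map_eq_smul (hA j) (hD j) i))
  refine ⟨hden, ?_⟩
  have hass (j) := associated_polyRed (hA j) (hpD j) (hden j)
  have hLp := (IsReduction.piMap fun j =>
      isReduction_quotMap (A j) (polyRed p (a j)) (hass j).symm.dvd (hass j).dvd).prodMap
    (IsReduction.piMap fun _ : Fin s₂ => isReduction_polynomial (p := p))
  exact (isReduction_baseChangeMap f p).nonempty_linearEquiv hLp φ ψ hpc hψφ hφψ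
end

section
/- Let N be a ℤ[x]-module that is finitely generated as an abelian group, and suppose ℚ ⊗_ℤ N is isomorphic as a ℚ[x]-module to ⊕_{j=1}^{d} ℚ[x]/(a_j), where a_1 | a_2 | ⋯ | a_d in ℚ[x] and a_1 is not a unit. Let ρ₁ be the number of distinct roots of a_1 in ℂ. Then there is a constant C such that m_n(N) ≤ ρ₁·n^{d−1} + C·n^{d−2} for all sufficiently large n, and m_n(N) ≥ ρ₁·n^{d−1} for infinitely many n. -/
open Polynomial TensorProduct

theorem exists_int_map_eq_C_mul (P : ℚ[X]) :
    ∃ (c : ℤ) (Q : ℤ[X]), c ≠ 0 ∧ Q.map (Int.castRingHom ℚ) = C (c : ℚ) * P := by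
  obtain ⟨b, hb, h⟩ := IsLocalization.integerNormalization_spec (nonZeroDivisors ℤ) P
  refine ⟨b, _, mem_nonZeroDivisors_iff_ne_zero.1 hb, h.trans ?_⟩
  rw [← smul_eq_C_mul, Int.cast_smul_eq_zsmul]

theorem aeval_baseChange_one_tmul {M : Type*} [AddCommGroup M] (f : M →ₗ[ℤ] M) (P : ℤ[X])
    (v : M) :
    aeval (f.baseChange ℚ) (P.map (Int.castRingHom ℚ)) ((1 : ℚ) ⊗ₜ[ℤ] v) =
      1 ⊗ₜ[ℤ] (aeval f P v) := by
  induction P using Polynomial.induction_on' with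
  | add p q hp hq => simp [hp, hq, TensorProduct.tmul_add]
  | monomial n a =>
    have h : ∀ n : ℕ, ((f.baseChange ℚ) ^ n) ((1 : ℚ) ⊗ₜ[ℤ] v) = 1 ⊗ₜ[ℤ] ((f ^ n) v) := by
      intro n
      induction n with
      | zero => simp
      | succ n ih => rw [pow_succ', pow_succ', Module.End.mul_apply, ih]; simp
    simp only [map_monomial, aeval_monomial, Module.End.mul_apply, h, Module.algebraMap_end_apply]
    rw [TensorProduct.tmul_smul, eq_intCast, Int.cast_smul_eq_zsmul]

/-- The natural map `M → ℚ ⊗ M`, semilinear for the polynomial actions of `f`. -/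
noncomputable def rationalize {M : Type*} [AddCommGroup M] (f : M →ₗ[ℤ] M) :
    Module.AEval' f →ₛₗ[mapRingHom (Int.castRingHom ℚ)] Module.AEval' (f.baseChange ℚ) where
  toFun v := Module.AEval'.of (f.baseChange ℚ) (1 ⊗ₜ (Module.AEval'.of f).symm v)
  map_add' v w := by simp [TensorProduct.tmul_add]
  map_smul' P v := (aeval_baseChange_one_tmul f P _).symm

theorem rationalize_eq_zero {M : Type*} [AddCommGroup M] (f : M →ₗ[ℤ] M) (v : Module.AEval' f)
    (hv : rationalize f v = 0) : ∃ c : ℤ, c ≠ 0 ∧ c • v = 0 := by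
  have : IsLocalizedModule (nonZeroDivisors ℤ) (TensorProduct.mk ℤ ℚ M 1) := by
    rw [isLocalizedModule_iff_isBaseChange (nonZeroDivisors ℤ) ℚ]
    exact TensorProduct.isBaseChange ℤ M ℚ
  have h : TensorProduct.mk ℤ ℚ M 1 ((Module.AEval'.of f).symm v) = 0 := hv
  rw [IsLocalizedModule.eq_zero_iff (nonZeroDivisors ℤ)] at h
  obtain ⟨c, hc⟩ := h
  exact ⟨c, nonZeroDivisors.coe_ne_zero c, hc⟩

theorem exists_rationalize_eq {M : Type*} [AddCommGroup M] (f : M →ₗ[ℤ] M)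
    (w : Module.AEval' (f.baseChange ℚ)) : ∃ (c : ℤ) (v : Module.AEval' f),
      c ≠ 0 ∧ rationalize f v = c • w := by
  have : IsLocalizedModule (nonZeroDivisors ℤ) (TensorProduct.mk ℤ ℚ M 1) := by
    rw [isLocalizedModule_iff_isBaseChange (nonZeroDivisors ℤ) ℚ]
    exact TensorProduct.isBaseChange ℤ M ℚ
  obtain ⟨⟨v, c⟩, h⟩ := IsLocalizedModule.surj (nonZeroDivisors ℤ) (TensorProduct.mk ℤ ℚ M 1)
    ((Module.AEval'.of (f.baseChange ℚ)).symm w)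
  exact ⟨c, Module.AEval'.of f v, nonZeroDivisors.coe_ne_zero c, h.symm⟩

theorem exists_forall_zsmul_mem {N : Type*} [AddCommGroup N] [Module.Finite ℤ N]
    (S : AddSubgroup N) (h : ∀ v : N, ∃ c : ℤ, c ≠ 0 ∧ c • v ∈ S) :
    ∃ D : ℤ, D ≠ 0 ∧ ∀ v : N, D • v ∈ S := by
  have ht : Module.IsTorsion ℤ (N ⧸ AddSubgroup.toIntSubmodule S) := by
    intro x
    obtain ⟨v, rfl⟩ := Submodule.Quotient.mk_surjective _ x
    obtain ⟨c, hc, hv⟩ := h v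
    refine ⟨⟨c, mem_nonZeroDivisors_iff_ne_zero.2 hc⟩, ?_⟩
    rw [Submonoid.mk_smul, ← Submodule.Quotient.mk_smul]
    exact (Submodule.Quotient.mk_eq_zero _).2 hv
  obtain ⟨D, hD, hD0⟩ := Submodule.annihilator_top_inter_nonZeroDivisors ht
  refine ⟨D, nonZeroDivisors.ne_zero hD0, fun v => ?_⟩
  have := (Submodule.mem_annihilator.1 hD) (Submodule.Quotient.mk v) trivial
  rw [← Submodule.Quotient.mk_smul] at this
  exact (Submodule.Quotient.mk_eq_zero _).1 this

theorem intCast_smul_eq_zsmul {N : Type*} [AddCommGroup N] [Module ℤ[X] N] (c : ℤ) (v : N) :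
    (C c : ℤ[X]) • v = c • v := by
  rw [← Int.cast_smul_eq_zsmul ℤ[X] c v]; simp

theorem map_polynomial_smul {N : Type*} [AddCommGroup N] [Module ℤ[X] N]
    {d : ℕ} {a : Fin d → ℚ[X]}
    {ι : N →ₛₗ[mapRingHom (Int.castRingHom ℚ)] ((j : Fin d) → ℚ[X] ⧸ Ideal.span {a j})}
    {v : N} {m : ℤ} {j : Fin d} (he : ι v = m • Pi.single j 1) (P : ℤ[X]) :
    ι (P • v) = Pi.single j
      (Ideal.Quotient.mk (Ideal.span {a j}) (C (m : ℚ) * P.map (Int.castRingHom ℚ))) := by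
  rw [map_smulₛₗ, he, smul_comm, ← Pi.single_smul, ← Pi.single_smul]
  congr 1
  rw [← Int.cast_smul_eq_zsmul ℚ[X], coe_mapRingHom, ← smul_assoc, ← Ideal.Quotient.mk_eq_mk,
    ← map_one (Ideal.Quotient.mk _), ← Ideal.Quotient.mk_eq_mk, ← Submodule.Quotient.mk_smul]
  simp

theorem exists_annihilating {N : Type*} [AddCommGroup N] [Module ℤ[X] N]
    {d : ℕ} {a : Fin d → ℚ[X]}
    {ι : N →ₛₗ[mapRingHom (Int.castRingHom ℚ)] ((j : Fin d) → ℚ[X] ⧸ Ideal.span {a j})}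
    (hker : ∀ v, ι v = 0 → ∃ c : ℤ, c ≠ 0 ∧ c • v = 0)
    {v : N} {m : ℤ} {j : Fin d} (he : ι v = m • Pi.single j 1) :
    ∃ (c : ℤ) (A : ℤ[X]), c ≠ 0 ∧ A.map (Int.castRingHom ℚ) = C (c : ℚ) * a j ∧ A • v = 0 := by
  obtain ⟨c, A, hc, hA⟩ := exists_int_map_eq_C_mul (a j)
  have h0 : ι (A • v) = 0 := by
    rw [map_polynomial_smul he, hA, Pi.single_eq_zero_iff, Ideal.Quotient.eq_zero_iff_mem,
      Ideal.mem_span_singleton]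
    exact ⟨C (m : ℚ) * C (c : ℚ), by ring⟩
  obtain ⟨b, hb, h⟩ := hker _ h0
  refine ⟨b * c, C b * A, mul_ne_zero hb hc, ?_, ?_⟩
  · simp [hA, mul_assoc]
  · rw [mul_smul, intCast_smul_eq_zsmul, h]

theorem exists_zsmul_mem_span {N : Type*} [AddCommGroup N] [Module ℤ[X] N]
    {d : ℕ} {a : Fin d → ℚ[X]}
    {ι : N →ₛₗ[mapRingHom (Int.castRingHom ℚ)] ((j : Fin d) → ℚ[X] ⧸ Ideal.span {a j})}
    (hker : ∀ v, ι v = 0 → ∃ c : ℤ, c ≠ 0 ∧ c • v = 0)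
    {e : Fin d → N} {m : Fin d → ℤ} (hm : ∀ j, m j ≠ 0)
    (he : ∀ j, ι (e j) = m j • Pi.single j 1) (v : N) :
    ∃ c : ℤ, c ≠ 0 ∧ c • v ∈ Submodule.span ℤ[X] (Set.range e) := by
  have key : ∀ w : (j : Fin d) → ℚ[X] ⧸ Ideal.span {a j}, ∃ c : ℤ, c ≠ 0 ∧
      ∃ u ∈ Submodule.span ℤ[X] (Set.range e), ι u = c • w := by
    intro w
    rw [← Finset.univ_sum_single w]
    refine Finset.sum_induction _ (fun w => ∃ c : ℤ, c ≠ 0 ∧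
      ∃ u ∈ Submodule.span ℤ[X] (Set.range e), ι u = c • w) ?_ ⟨1, one_ne_zero, 0, by simp⟩ ?_
    · rintro w₁ w₂ ⟨c₁, hc₁, u₁, hu₁, h₁⟩ ⟨c₂, hc₂, u₂, hu₂, h₂⟩
      refine ⟨c₁ * c₂, mul_ne_zero hc₁ hc₂, c₂ • u₁ + c₁ • u₂,
        add_mem (zsmul_mem hu₁ _) (zsmul_mem hu₂ _), ?_⟩
      rw [map_add, map_zsmul, map_zsmul, h₁, h₂]
      module
    · intro j _
      obtain ⟨g, hg⟩ := Ideal.Quotient.mk_surjective (w j)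
      obtain ⟨c, Q, hc, hQ⟩ := exists_int_map_eq_C_mul (C ((m j : ℚ)⁻¹) * g)
      have hmj : (m j : ℚ) ≠ 0 := Int.cast_ne_zero.2 (hm j)
      refine ⟨c, hc, Q • e j, Submodule.smul_mem _ _ (Submodule.subset_span ⟨j, rfl⟩), ?_⟩
      rw [map_polynomial_smul (he j), hQ, ← Pi.single_smul, ← hg, ← map_zsmul]
      congr 2
      rw [mul_left_comm, ← mul_assoc (C (m j : ℚ)), ← C_mul, mul_inv_cancel₀ hmj, C_1, one_mul,
        zsmul_eq_mul]
      simp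
  obtain ⟨c, hc, u, hu, h⟩ := key (ι v)
  obtain ⟨b, hb, h0⟩ := hker (c • v - u) (by rw [map_sub, map_zsmul, h, sub_self])
  refine ⟨b * c, mul_ne_zero hb hc, ?_⟩
  rw [smul_sub, sub_eq_zero, smul_smul] at h0
  rw [h0]
  exact zsmul_mem hu _

theorem exists_monic_smul_eq_zero (N : Type*) [AddCommGroup N] [Module ℤ[X] N]
    [Module.Finite ℤ N] : ∃ P : ℤ[X], P.Monic ∧ ∀ v : N, P • v = 0 := by
  let φ : ℤ[X] →+* Module.End ℤ N := Module.toModuleEnd ℤ N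
  obtain ⟨P, hP, h⟩ := LinearMap.exists_monic_and_aeval_eq_zero ℤ (φ X)
  have h1 : (aeval (φ X)).toRingHom = φ :=
    Polynomial.ringHom_ext (fun a => by simp) (by simp)
  have h2 : φ P = 0 := (congrArg (fun g => g P) h1).symm.trans h
  exact ⟨P, hP, fun v => congrArg (fun g => g v) h2⟩

theorem ne_zero_of_finite {N : Type*} [AddCommGroup N] [Module ℤ[X] N] [Module.Finite ℤ N]
    {d : ℕ} {a : Fin d → ℚ[X]}
    {ι : N →ₛₗ[mapRingHom (Int.castRingHom ℚ)] ((j : Fin d) → ℚ[X] ⧸ Ideal.span {a j})}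
    {v : N} {m : ℤ} (hm : m ≠ 0) {j : Fin d} (he : ι v = m • Pi.single j 1) : a j ≠ 0 := by
  intro ha
  obtain ⟨P, hP, h⟩ := exists_monic_smul_eq_zero N
  have h0 := map_polynomial_smul he P
  rw [h, map_zero, eq_comm, Pi.single_eq_zero_iff, Ideal.Quotient.eq_zero_iff_mem,
      Ideal.mem_span_singleton, ha, zero_dvd_iff] at h0
  simp [hm, (hP.map (Int.castRingHom ℚ)).ne_zero] at h0

theorem exists_dvd_mul_pow {a : ℚ[X]} (ha : a ≠ 0) {c : ℤ} (hc : c ≠ 0) {A : ℤ[X]}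
    (hA : A.map (Int.castRingHom ℚ) = C (c : ℚ) * a) :
    ∃ (B : ℤ[X]) (D : ℤ) (k : ℕ), B ≠ 0 ∧ D ≠ 0 ∧ A ∣ C D * B ^ k ∧
      B.natDegree ≤ (a.map (algebraMap ℚ ℂ)).roots.toFinset.card := by
  classical
  have hinj : Function.Injective (Polynomial.map (Int.castRingHom ℚ)) :=
    map_injective _ (RingHom.injective_int _)
  obtain ⟨k, g, hg⟩ := UniqueFactorizationMonoid.exists_dvd_radical_self_pow ha
  set b := UniqueFactorizationMonoid.radical a with hb
  have hb0 : b ≠ 0 := UniqueFactorizationMonoid.radical_ne_zero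
  have hsep : b.Separable :=
    PerfectField.separable_iff_squarefree.2 UniqueFactorizationMonoid.squarefree_radical
  obtain ⟨c₁, B, hc₁, hB⟩ := exists_int_map_eq_C_mul b
  obtain ⟨c₂, G, hc₂, hG⟩ := exists_int_map_eq_C_mul g
  refine ⟨B, c₂ * c, k, ?_, mul_ne_zero hc₂ hc, ⟨C (c₁ ^ k) * G, hinj ?_⟩, ?_⟩
  · rintro rfl
    simp [hc₁, hb0] at hB
  · simp only [Polynomial.map_mul, Polynomial.map_pow, map_C, hB, hA, hG, mul_pow, hg]
    simp only [map_mul, map_pow, eq_intCast]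
    ring
  · have h1 : B.natDegree = b.natDegree := by
      rw [← natDegree_map_eq_of_injective (RingHom.injective_int (Int.castRingHom ℚ)), hB,
        natDegree_C_mul (Int.cast_ne_zero.2 hc₁)]
    rw [h1, ← natDegree_map (algebraMap ℚ ℂ), ← IsAlgClosed.card_roots_eq_natDegree,
      ← Multiset.toFinset_card_of_nodup (nodup_roots hsep.map)]
    refine Finset.card_le_card (Multiset.toFinset_subset.2 (Multiset.subset_of_le
      (roots.le_of_dvd ?_ (Polynomial.map_dvd _ UniqueFactorizationMonoid.radical_dvd_self))))
    exact (Polynomial.map_ne_zero_iff (algebraMap ℚ ℂ).injective).2 ha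

theorem ncard_maximal_le_natDegree {B : ℤ[X]} {n : ℕ} (hn : n ≠ 0) :
    {I : Ideal ℤ[X] | I.IsMaximal ∧ Nat.card (ℤ[X] ⧸ I) = n ∧ B ∈ I ∧
      C B.leadingCoeff ∉ I}.Finite ∧
    {I : Ideal ℤ[X] | I.IsMaximal ∧ Nat.card (ℤ[X] ⧸ I) = n ∧ B ∈ I ∧
      C B.leadingCoeff ∉ I}.ncard ≤ B.natDegree := by
  classical
  set S := {I : Ideal ℤ[X] | I.IsMaximal ∧ Nat.card (ℤ[X] ⧸ I) = n ∧ B ∈ I ∧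
      C B.leadingCoeff ∉ I} with hS
  rcases S.eq_empty_or_nonempty with h | ⟨I₀, hI₀⟩
  · simp [h]
  have hchar : ∀ I ∈ S, ∃ p k : ℕ, p.Prime ∧ k ≠ 0 ∧ n = p ^ k ∧ CharP (ℤ[X] ⧸ I) p := by
    rintro I ⟨hI, hcard, -⟩
    let := Ideal.Quotient.field I
    have : Finite (ℤ[X] ⧸ I) := Nat.finite_of_card_ne_zero (hcard ▸ hn)
    let := Fintype.ofFinite (ℤ[X] ⧸ I)
    obtain ⟨p, hp, k, hpp, hk⟩ := FiniteField.card' (ℤ[X] ⧸ I)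
    exact ⟨p, k, hpp, k.ne_zero, by rw [← hcard, Nat.card_eq_fintype_card, hk], hp⟩
  obtain ⟨p, k, hp, hk, hnp, -⟩ := hchar I₀ hI₀
  have : Fact p.Prime := ⟨hp⟩
  have hex : ∀ I ∈ S, ∃ τ : ℤ[X] →+* AlgebraicClosure (ZMod p), RingHom.ker τ = I := by
    intro I hI
    obtain ⟨q, l, hq, hl, hnq, hchar⟩ := hchar I hI
    obtain rfl : q = p := by
      have : q ∣ p ^ k := hnp ▸ hnq ▸ dvd_pow_self q hl
      exact (Nat.prime_dvd_prime_iff_eq hq hp).1 (hq.dvd_of_dvd_pow this)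
    have := hI.1
    let := Ideal.Quotient.field I
    have : Finite (ℤ[X] ⧸ I) := Nat.finite_of_card_ne_zero (hI.2.1 ▸ hn)
    let := ZMod.algebra (ℤ[X] ⧸ I) q
    have : Algebra.IsAlgebraic (ZMod q) (ℤ[X] ⧸ I) := inferInstance
    let τ : (ℤ[X] ⧸ I) →ₐ[ZMod q] AlgebraicClosure (ZMod q) := IsAlgClosed.lift
    refine ⟨τ.toRingHom.comp (Ideal.Quotient.mk I), ?_⟩
    ext x
    rw [RingHom.mem_ker, RingHom.comp_apply, ← Ideal.Quotient.eq_zero_iff_mem]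
    exact map_eq_zero_iff τ τ.toRingHom.injective
  have : Nonempty (ℤ[X] →+* AlgebraicClosure (ZMod p)) := ⟨eval₂RingHom (Int.castRingHom _) 0⟩
  choose! τ hτ using hex
  have hτ' : ∀ I, ∀ P : ℤ[X], τ I P = (P.map (Int.castRingHom _)).eval (τ I X) := by
    intro I P
    rw [eval_map]
    conv_lhs => rw [← P.eval₂_C_X, hom_eval₂]
    congr 1
    exact RingHom.ext_int _ _
  set Q := B.map (Int.castRingHom (AlgebraicClosure (ZMod p)))
  have hmaps : ∀ I ∈ S, τ I X ∈ (Q.roots.toFinset : Set (AlgebraicClosure (ZMod p))) := by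
    intro I hI
    have h0 : Q ≠ 0 := by
      intro h
      apply hI.2.2.2
      have := congrArg (fun P => P.coeff B.natDegree) h
      rw [← hτ I hI, RingHom.mem_ker, hτ']
      simpa [Q] using this
    have h1 : τ I B = 0 := by rw [← RingHom.mem_ker, hτ I hI]; exact hI.2.2.1
    simp only [Finset.mem_coe, Multiset.mem_toFinset, mem_roots h0, IsRoot]
    rw [← hτ', h1]
  have hinj : Set.InjOn (fun I => τ I X) S := by
    intro I hI J hJ h
    rw [← hτ I hI, ← hτ J hJ]
    ext P
    simp only at h
    rw [RingHom.mem_ker, RingHom.mem_ker, hτ' I P, hτ' J P, h]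
  refine ⟨Set.Finite.of_injOn hmaps hinj (Finset.finite_toSet _), ?_⟩
  calc S.ncard ≤ (Q.roots.toFinset : Set (AlgebraicClosure (ZMod p))).ncard :=
        Set.ncard_le_ncard_of_injOn _ hmaps hinj (Finset.finite_toSet _)
    _ ≤ Q.roots.card := by rw [Set.ncard_coe_finset]; exact Multiset.toFinset_card_le _
    _ ≤ Q.natDegree := card_roots' _
    _ ≤ B.natDegree := natDegree_map_le

theorem exists_ncard_maximal_le {a : ℚ[X]} (ha : a ≠ 0) {c : ℤ} (hc : c ≠ 0) {A : ℤ[X]}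
    (hA : A.map (Int.castRingHom ℚ) = C (c : ℚ) * a) :
    ∃ D : ℤ, D ≠ 0 ∧ ∀ n : ℕ, n ≠ 0 →
      {I : Ideal ℤ[X] | I.IsMaximal ∧ Nat.card (ℤ[X] ⧸ I) = n ∧ A ∈ I ∧ C D ∉ I}.Finite ∧
      {I : Ideal ℤ[X] | I.IsMaximal ∧ Nat.card (ℤ[X] ⧸ I) = n ∧ A ∈ I ∧ C D ∉ I}.ncard ≤
        (a.map (algebraMap ℚ ℂ)).roots.toFinset.card := by
  obtain ⟨B, D, k, hB, hD, hdvd, hdeg⟩ := exists_dvd_mul_pow ha hc hA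
  refine ⟨D * B.leadingCoeff, mul_ne_zero hD (leadingCoeff_ne_zero.2 hB), fun n hn => ?_⟩
  obtain ⟨hfin, hcard⟩ := ncard_maximal_le_natDegree (B := B) hn
  have hsub : {I : Ideal ℤ[X] | I.IsMaximal ∧ Nat.card (ℤ[X] ⧸ I) = n ∧ A ∈ I ∧
      C (D * B.leadingCoeff) ∉ I} ⊆ {I : Ideal ℤ[X] | I.IsMaximal ∧ Nat.card (ℤ[X] ⧸ I) = n ∧
      B ∈ I ∧ C B.leadingCoeff ∉ I} := by
    rintro I ⟨hI, hn, hA, hD⟩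
    rw [C_mul] at hD
    refine ⟨hI, hn, ?_, fun h => hD (I.mul_mem_left _ h)⟩
    exact hI.isPrime.mem_of_pow_mem k ((hI.isPrime.mem_or_mem (I.mem_of_dvd hdvd hA)).resolve_left
      fun h => hD (I.mul_mem_right _ h))
  exact ⟨hfin.subset hsub, (Set.ncard_le_ncard hsub hfin).trans (hcard.trans hdeg)⟩

section
variable {R N : Type*} [CommRing R] [AddCommGroup N] [Module R N]

/-- The maximal submodules `W` of `N` that contain `e i` for `i < j`, and for which the
annihilator of `e j` modulo `W` is `I`. -/
def leadingClass {d : ℕ} (e : Fin d → N) (j : Fin d) (I : Ideal R) : Set (Submodule R N) :=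
  {W | IsCoatom W ∧ (∀ i < j, e i ∈ W) ∧ e j ∉ W ∧ ∀ r : R, r • e j ∈ W ↔ r ∈ I}

theorem exists_sub_smul_mem {W : Submodule R N} (hW : IsCoatom W) {u : N} (hu : u ∉ W) (v : N) :
    ∃ r : R, v - r • u ∈ W := by
  have h : v ∈ W ⊔ Submodule.span R {u} := by
    rw [hW.2 _ (left_lt_sup.2 fun h => hu (h (Submodule.mem_span_singleton_self u)))]
    trivial
  obtain ⟨w, hw, z, hz, rfl⟩ := Submodule.mem_sup.1 h
  obtain ⟨r, rfl⟩ := Submodule.mem_span_singleton.1 hz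
  exact ⟨r, by simpa using hw⟩

theorem finite_and_ncard_leadingClass_le {d : ℕ} (e : Fin d → N) (j : Fin d) (I : Ideal R)
    [Finite (R ⧸ I)] {D : R} (hD : D ∉ I)
    (hspan : ∀ v : N, D • v ∈ Submodule.span R (Set.range e)) :
    (leadingClass e j I).Finite ∧
      (leadingClass e j I).ncard ≤ Nat.card (R ⧸ I) ^ (d - 1 - (j : ℕ)) := by
  classical
  have hex : ∀ W ∈ leadingClass e j I, ∃ r : Fin d → R, ∀ i, e i - r i • e j ∈ W := by
    rintro W ⟨hW, -, hj, -⟩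
    choose r hr using fun i => exists_sub_smul_mem hW hj (e i)
    exact ⟨r, hr⟩
  choose! r hr using hex
  have key : ∀ W ∈ leadingClass e j I, ∀ s : Fin d → R,
      ∑ i, s i • e i ∈ W ↔ ∑ i, s i * r W i ∈ I := by
    intro W hW s
    have h : ∑ i, s i • e i = ∑ i, s i • (e i - r W i • e j) + (∑ i, s i * r W i) • e j := by
      simp only [smul_sub, Finset.sum_sub_distrib, Finset.sum_smul, mul_smul, sub_add_cancel]
    rw [← hW.2.2.2, h]
    exact Submodule.add_mem_iff_right _ (sum_mem fun i _ => W.smul_mem _ (hr W hW i))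
  let g : Submodule R N → ({i : Fin d // j < i} → R ⧸ I) := fun W i => Ideal.Quotient.mk I (r W i)
  have hinj : Set.InjOn g (leadingClass e j I) := by
    intro W hW W' hW' h
    have hr_eq : ∀ i, r W i - r W' i ∈ I := by
      intro i
      rcases lt_trichotomy i j with hij | rfl | hij
      · have h1 : ∀ W ∈ leadingClass e j I, r W i ∈ I := fun W hW => by
          rw [← hW.2.2.2]
          exact (Submodule.sub_mem_iff_right _ (hW.2.1 i hij)).1 (hr W hW i)
        exact sub_mem (h1 W hW) (h1 W' hW')
      · have h1 : ∀ W ∈ leadingClass e i I, 1 - r W i ∈ I := fun W hW => by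
          rw [← hW.2.2.2, sub_smul, one_smul]
          exact hr W hW i
        simpa using sub_mem (h1 W' hW') (h1 W hW)
      · exact Ideal.Quotient.eq.1 (congrFun h ⟨i, hij⟩)
    have hmem : ∀ W ∈ leadingClass e j I, ∀ v, v ∈ W ↔ D • v ∈ W := by
      intro W hW v
      refine ⟨fun h => W.smul_mem D h, fun h => ?_⟩
      by_contra hv
      obtain ⟨t, ht⟩ := exists_sub_smul_mem hW.1 hv (e j)
      apply hD
      rw [← hW.2.2.2]
      have := W.smul_mem D ht
      rw [smul_sub, smul_comm] at this
      exact (Submodule.sub_mem_iff_left _ (W.smul_mem t h)).1 this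
    ext v
    rw [hmem W hW, hmem W' hW']
    obtain ⟨s, hs⟩ := (Submodule.mem_span_range_iff_exists_fun R).1 (hspan v)
    rw [← hs, key W hW, key W' hW']
    rw [← Submodule.sub_mem_iff_left I (y := ∑ i, s i * (r W i - r W' i))]
    · simp [mul_sub]
    · exact sum_mem fun i _ => I.mul_mem_left _ (hr_eq i)
  have hcard : Nat.card ({i : Fin d // j < i} → R ⧸ I) = Nat.card (R ⧸ I) ^ (d - 1 - (j : ℕ)) := by
    rw [Nat.card_fun, Nat.card_eq_fintype_card (α := {i : Fin d // j < i}),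
      Fintype.card_subtype, Finset.filter_lt_eq_Ioi, Fin.card_Ioi]
  refine ⟨Set.Finite.of_injOn (Set.mapsTo_univ g _) hinj Set.finite_univ, ?_⟩
  rw [← hcard, ← Set.ncard_univ]
  exact Set.ncard_le_ncard_of_injOn g (fun _ _ => Set.mem_univ _) hinj Set.finite_univ

theorem zsmul_mem_of_coatom {W : Submodule R N} (hW : IsCoatom W) {u : N} (hu : u ∉ W) {r : R}
    (h : r • u ∈ W) (v : N) : r • v ∈ W := by
  obtain ⟨t, ht⟩ := exists_sub_smul_mem hW hu v
  have := W.add_mem (W.smul_mem r ht) (W.smul_mem t h)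
  rwa [smul_sub, smul_comm t r u, sub_add_cancel] at this

theorem exists_mem_leadingClass {d : ℕ} (e : Fin d → N) {W : Submodule R N} (hW : IsCoatom W)
    (hne : ∃ i, e i ∉ W) : ∃ (j : Fin d) (I : Ideal R), W ∈ leadingClass e j I ∧ I.IsMaximal ∧
      Nat.card (R ⧸ I) = Nat.card (N ⧸ W) := by
  classical
  obtain ⟨j, hj, hmin⟩ := exists_minimal_of_wellFoundedLT (fun i => e i ∉ W) hne
  have hsimple : IsSimpleModule R (N ⧸ W) := isSimpleModule_iff_isCoatom.2 hW
  have h0 : W.mkQ (e j) ≠ 0 := fun h => hj ((Submodule.Quotient.mk_eq_zero _).1 h)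
  refine ⟨j, LinearMap.ker (LinearMap.toSpanSingleton R (N ⧸ W) (W.mkQ (e j))),
    ⟨hW, fun i hi => by_contra fun h => (hmin h hi.le).not_gt hi, hj, fun r => ?_⟩,
    IsSimpleModule.ker_toSpanSingleton_isMaximal R h0,
    Nat.card_congr (LinearMap.quotKerEquivOfSurjective _
      (IsSimpleModule.toSpanSingleton_surjective R h0)).toEquiv⟩
  rw [LinearMap.mem_ker, LinearMap.toSpanSingleton_apply, ← map_smul]
  exact (Submodule.Quotient.mk_eq_zero _).symm

end

/-- Quotients of a finitely generated abelian group by a nonzero integer are finite. -/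
theorem finite_quotient_of_zsmul_mem {N : Type*} [AddCommGroup N] [Module ℤ[X] N]
    [Module.Finite ℤ N] {W : Submodule ℤ[X] N} {E : ℤ} (hE : E ≠ 0) (h : ∀ v : N, E • v ∈ W) :
    Finite (N ⧸ W) := by
  have : Module.Finite ℤ (N ⧸ W) :=
    Module.Finite.of_surjective (W.mkQ.restrictScalars ℤ) W.mkQ_surjective
  refine Module.finite_of_fg_torsion _ fun x => ?_
  obtain ⟨v, rfl⟩ := W.mkQ_surjective x
  refine ⟨⟨E, mem_nonZeroDivisors_iff_ne_zero.2 hE⟩, ?_⟩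
  rw [Submonoid.mk_smul, ← map_zsmul]
  exact (Submodule.Quotient.mk_eq_zero _).2 (h v)

/-- The submodule of multiples of an integer. -/
noncomputable def multiples (N : Type*) [AddCommGroup N] [Module ℤ[X] N] (E : ℤ) :
    Submodule ℤ[X] N :=
  LinearMap.range (LinearMap.lsmul ℤ[X] N (C E))

theorem zsmul_mem_multiples {N : Type*} [AddCommGroup N] [Module ℤ[X] N] (E : ℤ) (v : N) :
    E • v ∈ multiples N E := ⟨v, intCast_smul_eq_zsmul E v⟩

theorem multiples_le {N : Type*} [AddCommGroup N] [Module ℤ[X] N] {E : ℤ} {W : Submodule ℤ[X] N}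
    (h : ∀ v : N, E • v ∈ W) : multiples N E ≤ W := by
  rintro _ ⟨v, rfl⟩
  have := h v
  rwa [← intCast_smul_eq_zsmul] at this

theorem exists_zsmul_not_mem {N : Type*} [AddCommGroup N] [Module ℤ[X] N]
    [Module.Finite ℤ N] {E : ℤ} (hE : E ≠ 0) {W : Submodule ℤ[X] N}
    (hcard : Nat.card (N ⧸ multiples N E) < Nat.card (N ⧸ W)) : ∃ v : N, E • v ∉ W := by
  by_contra! h
  have := finite_quotient_of_zsmul_mem hE (zsmul_mem_multiples (N := N) E)
  exact hcard.not_ge (Nat.card_le_card_of_surjective _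
    (Submodule.factor_surjective (multiples_le h)))

theorem maxSubmoduleCount_le {N : Type*} [AddCommGroup N] [Module ℤ[X] N] [Module.Finite ℤ N]
    {d : ℕ} {e : Fin d → N} {D : ℤ} (hD : D ≠ 0)
    (hspan : ∀ v : N, D • v ∈ Submodule.span ℤ[X] (Set.range e)) {A : Fin d → ℤ[X]}
    (hA : ∀ j, A j • e j = 0) {ρ : Fin d → ℕ}
    (hρ : ∀ j, ∃ D : ℤ, D ≠ 0 ∧ ∀ n : ℕ, n ≠ 0 →
      {I : Ideal ℤ[X] | I.IsMaximal ∧ Nat.card (ℤ[X] ⧸ I) = n ∧ A j ∈ I ∧ C D ∉ I}.Finite ∧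
      {I : Ideal ℤ[X] | I.IsMaximal ∧ Nat.card (ℤ[X] ⧸ I) = n ∧ A j ∈ I ∧ C D ∉ I}.ncard ≤ ρ j) :
    ∃ n₀ : ℕ, ∀ n, n₀ ≤ n →
      maxSubmoduleCount ℤ[X] N n ≤ ∑ j : Fin d, ρ j * n ^ (d - 1 - (j : ℕ)) := by
  classical
  choose D' hD' hρ using hρ
  set E : ℤ := D * ∏ j, D' j with hE
  have hE0 : E ≠ 0 := mul_ne_zero hD (Finset.prod_ne_zero_iff.2 fun j _ => hD' j)
  refine ⟨Nat.card (N ⧸ multiples N E) + 1, fun n hn => ?_⟩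
  have hn0 : n ≠ 0 := by omega
  let S : Fin d → Set (Ideal ℤ[X]) := fun j =>
    {I | I.IsMaximal ∧ Nat.card (ℤ[X] ⧸ I) = n ∧ A j ∈ I ∧ C (D * D' j) ∉ I}
  have hS : ∀ j, (S j).Finite ∧ (S j).ncard ≤ ρ j := by
    intro j
    obtain ⟨hfin, hle⟩ := hρ j n hn0
    have hsub : S j ⊆ {I : Ideal ℤ[X] | I.IsMaximal ∧ Nat.card (ℤ[X] ⧸ I) = n ∧ A j ∈ I ∧
        C (D' j) ∉ I} := fun I ⟨h₁, h₂, h₃, h₄⟩ =>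
      ⟨h₁, h₂, h₃, fun h => h₄ (by rw [C_mul]; exact I.mul_mem_left _ h)⟩
    exact ⟨hfin.subset hsub, (Set.ncard_le_ncard hsub hfin).trans hle⟩
  have hcover : {W : Submodule ℤ[X] N | IsCoatom W ∧ Nat.card (N ⧸ W) = n} ⊆
      ⋃ j : Fin d, ⋃ I ∈ S j, leadingClass e j I := by
    rintro W ⟨hW, hcard⟩
    obtain ⟨v, hv⟩ := exists_zsmul_not_mem hE0 (W := W) (by omega)
    have hne : ∃ i, e i ∉ W := by
      by_contra! h
      apply hv
      rw [hE, mul_comm, mul_smul]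
      exact zsmul_mem (Submodule.span_le.2 (Set.range_subset_iff.2 h) (hspan v)) _
    obtain ⟨j, I, hmem, hI, hIcard⟩ := exists_mem_leadingClass e hW hne
    refine Set.mem_iUnion.2 ⟨j, Set.mem_iUnion₂.2 ⟨I, ⟨hI, hIcard.trans hcard, ?_, fun h => hv ?_⟩,
      hmem⟩⟩
    · rw [← hmem.2.2.2, hA]
      exact W.zero_mem
    · obtain ⟨t, ht⟩ : D * D' j ∣ E :=
        mul_dvd_mul_left D (Finset.dvd_prod_of_mem D' (Finset.mem_univ j))
      rw [ht, mul_comm, mul_smul, ← intCast_smul_eq_zsmul (D * D' j)]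
      exact zsmul_mem (zsmul_mem_of_coatom hW hmem.2.2.1 ((hmem.2.2.2 _).2 h) v) _
  have hclass : ∀ j, ∀ I ∈ S j, (leadingClass e j I).Finite ∧
      (leadingClass e j I).ncard ≤ n ^ (d - 1 - (j : ℕ)) := by
    rintro j I ⟨hI, hcard, -, hDI⟩
    have : Finite (ℤ[X] ⧸ I) := Nat.finite_of_card_ne_zero (hcard ▸ hn0)
    rw [← hcard]
    refine finite_and_ncard_leadingClass_le e j I (D := C D)
      (fun h => hDI (by rw [C_mul]; exact I.mul_mem_right _ h)) fun v => ?_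
    rw [intCast_smul_eq_zsmul]
    exact hspan v
  have hfin : (⋃ j : Fin d, ⋃ I ∈ S j, leadingClass e j I).Finite :=
    Set.finite_iUnion fun j => (hS j).1.biUnion fun I hI => (hclass j I hI).1
  calc maxSubmoduleCount ℤ[X] N n ≤ (⋃ j : Fin d, ⋃ I ∈ S j, leadingClass e j I).ncard :=
        Set.ncard_le_ncard hcover hfin
    _ ≤ ∑ j : Fin d, (⋃ I ∈ S j, leadingClass e j I).ncard := Set.ncard_iUnion_le_of_fintype _
    _ ≤ ∑ j : Fin d, ρ j * n ^ (d - 1 - (j : ℕ)) := by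
      refine Finset.sum_le_sum fun j _ => ?_
      calc (⋃ I ∈ S j, leadingClass e j I).ncard
          = (⋃ I ∈ (hS j).1.toFinset, leadingClass e j I).ncard := by simp
        _ ≤ ∑ I ∈ (hS j).1.toFinset, (leadingClass e j I).ncard := Finset.set_ncard_biUnion_le _ _
        _ ≤ ∑ I ∈ (hS j).1.toFinset, n ^ (d - 1 - (j : ℕ)) :=
          Finset.sum_le_sum fun I hI => (hclass j I ((hS j).1.mem_toFinset.1 hI)).2
        _ ≤ ρ j * n ^ (d - 1 - (j : ℕ)) := by
          rw [Finset.sum_const, smul_eq_mul, ← Set.ncard_eq_toFinset_card _ (hS j).1]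
          exact Nat.mul_le_mul_right _ (hS j).2

theorem exists_prime_gt_eval_eq_zero {h : ℤ[X]} (hh : 0 < h.degree) (m : ℕ) :
    ∃ p : ℕ, m < p ∧ p.Prime ∧ ∃ t : ZMod p, aeval t h = 0 := by
  classical
  by_cases h0 : h.eval 0 = 0
  · obtain ⟨p, hp, hpp⟩ := Nat.exists_infinite_primes (m + 1)
    refine ⟨p, hp, hpp, 0, ?_⟩
    have := congrArg (Int.cast : ℤ → ZMod p) h0
    simpa [aeval_def, eval₂_at_zero, coeff_zero_eq_eval_zero] using this
  set c := h.eval 0 with hc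
  set s : ℤ := c * (m.factorial : ℤ) with hs
  have hs0 : s ≠ 0 := mul_ne_zero h0 (Int.natCast_ne_zero.2 m.factorial_ne_zero)
  have hfin : {y : ℤ | h.eval y = c ∨ h.eval y = -c}.Finite := by
    have h1 : ∀ b : ℤ, {y : ℤ | h.eval y = b}.Finite := by
      intro b
      have hne : h - C b ≠ 0 := by
        intro e
        rw [sub_eq_zero.1 e] at hh
        exact hh.not_ge degree_C_le
      refine (h - C b).roots.toFinset.finite_toSet.subset fun y hy => ?_
      simp only [Finset.mem_coe, Multiset.mem_toFinset, mem_roots hne, IsRoot, eval_sub, eval_C]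
      exact sub_eq_zero.2 hy
    exact (h1 c).union (h1 (-c))
  obtain ⟨y, hy⟩ := (hfin.preimage (f := fun y : ℤ => s * y)
    (mul_right_injective₀ hs0).injOn).exists_notMem
  obtain ⟨q, hq⟩ : s * y ∣ h.eval (s * y) - c := by
    simpa using sub_dvd_eval_sub (s * y) 0 h
  set w : ℤ := 1 + (m.factorial : ℤ) * y * q with hw
  have hval : h.eval (s * y) = c * w := by rw [hw]; linear_combination hq
  have hw1 : w.natAbs ≠ 1 := by
    intro e
    apply hy
    rcases Int.natAbs_eq_iff.1 e with e | e
    · left; simp [hval, e]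
    · right; simp [hval, e]
  obtain ⟨p, hp, hpw⟩ := Nat.exists_prime_and_dvd hw1
  have hpw' : (p : ℤ) ∣ w := Int.natCast_dvd.2 hpw
  refine ⟨p, ?_, hp, ((s * y : ℤ) : ZMod p), ?_⟩
  · by_contra! hle
    have hd : (p : ℤ) ∣ (m.factorial : ℤ) := Int.natCast_dvd_natCast.2 (hp.dvd_factorial.2 hle)
    have h1 : (p : ℤ) ∣ 1 := (Int.dvd_add_left ((hd.mul_right y).mul_right q)).1 hpw'
    exact hp.one_lt.ne' (by exact_mod_cast Int.eq_one_of_dvd_one (Int.natCast_nonneg p) h1)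
  · have h1 : aeval ((s * y : ℤ) : ZMod p) h = ((h.eval (s * y) : ℤ) : ZMod p) := by
      rw [← eq_intCast (algebraMap ℤ (ZMod p)), aeval_algebraMap_apply]
      simp
    rw [h1, hval, ZMod.intCast_zmod_eq_zero_iff_dvd _ p]
    exact hpw'.mul_left c

open NumberField in
theorem exists_monogenic_order (K : Type*) [Field K] [NumberField K] :
    ∃ (θ : 𝓞 K) (D : ℤ), D ≠ 0 ∧ ∀ z : 𝓞 K, D • z ∈ Algebra.adjoin ℤ {θ} := by
  let pb := Field.powerBasisOfFiniteOfSeparable ℚ K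
  obtain ⟨c, hc, hint⟩ := ((IsFractionRing.isAlgebraic_iff ℤ ℚ K).2
    (Algebra.IsAlgebraic.isAlgebraic pb.gen)).exists_integral_multiple
  let θ : 𝓞 K := ⟨c • pb.gen, hint⟩
  have hθ : (θ : K) = (c : K) * pb.gen := zsmul_eq_mul _ _
  refine ⟨θ, exists_forall_zsmul_mem (Algebra.adjoin ℤ {θ}).toSubring.toAddSubgroup fun z => ?_⟩
  obtain ⟨P, hP⟩ := pb.exists_eq_aeval' (z : K)
  obtain ⟨b, Q, hb, hQ⟩ := exists_int_map_eq_C_mul (P.comp (C ((c : ℚ)⁻¹) * X))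
  refine ⟨b, hb, ?_⟩
  have hz : b • z = aeval θ Q := by
    apply RingOfIntegers.coe_injective
    have hcK : (c : K) ≠ 0 := Int.cast_ne_zero.2 hc
    have h1 : aeval (θ : K) (Q.map (Int.castRingHom ℚ)) = b • (z : K) := by
      rw [hQ, map_mul, aeval_comp, hP]
      simp [hθ, hcK]
    have h2 : ((aeval θ Q : 𝓞 K) : K) = aeval (θ : K) Q := (aeval_algebraMap_apply K θ Q).symm
    refine Eq.trans ?_ h2.symm
    rw [← aeval_map_algebraMap ℚ]
    exact (h1.trans (by simp)).symm
  rw [hz]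
  exact aeval_mem_adjoin_singleton ℤ θ

/-- A homomorphism from a subring of bounded exponent to a ring extends if the exponent
is invertible there. -/
theorem nonempty_ringHom_of_zsmul_mem {S F : Type*} [CommRing S] [CommRing F] {B : Subring S}
    (ψ : B →+* F) {D : ℤ} {u : F} (hu : D * u = 1) (hmem : ∀ z : S, D • z ∈ B) :
    Nonempty (S →+* F) := by
  refine ⟨RingHom.mk' ⟨⟨fun z => ψ ⟨D • z, hmem z⟩ * u, ?_⟩, fun z w => ?_⟩ fun z w => ?_⟩
  · have : (⟨D • 1, hmem 1⟩ : B) = D • 1 := rfl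
    rw [this, map_zsmul, map_one, zsmul_one, hu]
  · have h1 : ψ ⟨D • z, hmem z⟩ * ψ ⟨D • w, hmem w⟩ = D * ψ ⟨D • (z * w), hmem _⟩ := by
      rw [← map_mul, ← zsmul_eq_mul, ← map_zsmul]
      congr 1
      ext1
      simp
      ring
    linear_combination (-u * u) * h1 - ψ ⟨D • (z * w), hmem _⟩ * u * hu
  · have h1 : ψ ⟨D • (z + w), hmem _⟩ = ψ ⟨D • z, hmem z⟩ + ψ ⟨D • w, hmem w⟩ := by
      rw [← map_add]
      congr 1
      ext1
      simp
    change _ * u = _ * u + _ * u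
    rw [h1, add_mul]

theorem nonempty_ringHom_of_aeval_minpoly_eq_zero {S F : Type*} [CommRing S] [IsDomain S]
    [CharZero S] [CommRing F] {θ : S} (hθ : IsIntegral ℤ θ) {D : ℤ} {u : F} (hu : D * u = 1)
    (hmem : ∀ z : S, D • z ∈ Algebra.adjoin ℤ {θ}) {t : F} (ht : aeval t (minpoly ℤ θ) = 0) :
    Nonempty (S →+* F) := by
  have h : aeval t (minpoly ℤ (Algebra.adjoin.powerBasis' hθ).gen) = 0 := by
    rwa [Algebra.adjoin.powerBasis'_minpoly_gen hθ] at ht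
  exact nonempty_ringHom_of_zsmul_mem (B := (Algebra.adjoin ℤ {θ}).toSubring)
    ((Algebra.adjoin.powerBasis' hθ).lift t h).toRingHom hu hmem

open NumberField in
theorem exists_ringHom_ringOfIntegers_zmod (K : Type*) [Field K] [NumberField K] (m : ℕ) :
    ∃ p : ℕ, m < p ∧ p.Prime ∧ Nonempty (𝓞 K →+* ZMod p) := by
  obtain ⟨θ, D, hD, hmem⟩ := exists_monogenic_order K
  have hθ : IsIntegral ℤ θ := Algebra.IsIntegral.isIntegral θ
  obtain ⟨p, hpm, hp, t, ht⟩ := exists_prime_gt_eval_eq_zero (minpoly.degree_pos hθ)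
    (max m D.natAbs)
  refine ⟨p, (le_max_left _ _).trans_lt hpm, hp, ?_⟩
  obtain ⟨u, hu⟩ : ∃ u : ZMod p, (D : ZMod p) * u = 1 := by
    have : Fact p.Prime := ⟨hp⟩
    refine ⟨(D : ZMod p)⁻¹, mul_inv_cancel₀ fun h => ?_⟩
    rw [ZMod.intCast_zmod_eq_zero_iff_dvd] at h
    exact ((le_max_right _ _).trans_lt hpm).not_ge
      (Nat.le_of_dvd (Int.natAbs_pos.2 hD) (Int.natCast_dvd.1 h))
  exact nonempty_ringHom_of_aeval_minpoly_eq_zero hθ hu hmem ht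

theorem isCoatom_ker_and_card_quotient {R N : Type*} [CommRing R] [AddCommGroup N] [Module R N]
    {p : ℕ} [Fact p.Prime] {σ : R →+* ZMod p} {φ : N →ₛₗ[σ] ZMod p} (hφ : φ ≠ 0) :
    IsCoatom (LinearMap.ker φ) ∧ Nat.card (N ⧸ LinearMap.ker φ) = p := by
  obtain ⟨u, hu⟩ : ∃ u, φ u ≠ 0 := by
    by_contra! h
    exact hφ (LinearMap.ext h)
  have hdiv : ∀ x : ZMod p, ∃ c : ℤ, φ (c • u) = x := fun x => by
    obtain ⟨c, hc⟩ := ZMod.intCast_surjective (x / φ u)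
    exact ⟨c, by rw [map_zsmul, zsmul_eq_mul, hc, div_mul_cancel₀ _ hu]⟩
  refine ⟨⟨fun h => hu (LinearMap.mem_ker.1 (h ▸ Submodule.mem_top)), fun W hW => ?_⟩, ?_⟩
  · obtain ⟨w, hw, hw0⟩ := SetLike.exists_of_lt hW
    refine (Submodule.eq_top_iff').2 fun v => ?_
    obtain ⟨c, hc⟩ := ZMod.intCast_surjective (φ v / φ w)
    have h : v - c • w ∈ LinearMap.ker φ := by
      rw [LinearMap.mem_ker, map_sub, map_zsmul, zsmul_eq_mul, hc,
        div_mul_cancel₀ _ (fun h => hw0 h), sub_self]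
    simpa using W.add_mem (hW.le h) (zsmul_mem hw c)
  · refine (Nat.card_congr (Equiv.ofBijective ((LinearMap.ker φ).liftQ φ le_rfl)
      ⟨?_, fun x => ?_⟩)).trans (Nat.card_zmod p)
    · exact LinearMap.ker_eq_bot.1 (Submodule.ker_liftQ_eq_bot _ _ _ le_rfl)
    · obtain ⟨c, hc⟩ := hdiv x
      exact ⟨Submodule.Quotient.mk (c • u), hc⟩

theorem finite_coatoms {N : Type*} [AddCommGroup N] [Module ℤ[X] N] [Module.Finite ℤ N]
    {n : ℕ} (hn : n ≠ 0) : Finite {W : Submodule ℤ[X] N // IsCoatom W ∧ Nat.card (N ⧸ W) = n} := by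
  have := finite_quotient_of_zsmul_mem (Int.natCast_ne_zero.2 hn)
    (zsmul_mem_multiples (N := N) (n : ℤ))
  have hle : ∀ W : Submodule ℤ[X] N, Nat.card (N ⧸ W) = n → multiples N n ≤ W := fun W hW =>
    multiples_le fun v => by
      rw [natCast_zsmul, ← hW, ← Submodule.Quotient.mk_eq_zero, Submodule.Quotient.mk_smul]
      exact card_nsmul_eq_zero'
  refine Finite.of_injective
    (fun W : {W : Submodule ℤ[X] N // IsCoatom W ∧ Nat.card (N ⧸ W) = n} =>
      W.1.map (multiples N (n : ℤ)).mkQ) fun W V h => ?_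
  have h := congrArg (Submodule.comap (multiples N (n : ℤ)).mkQ) h
  simp only [Submodule.comap_map_mkQ] at h
  rwa [sup_eq_right.2 (hle _ W.2.2), sup_eq_right.2 (hle _ V.2.2), ← Subtype.ext_iff] at h

theorem card_mul_pow_le_maxSubmoduleCount {N : Type*} [AddCommGroup N] [Module ℤ[X] N]
    [Module.Finite ℤ N] {p : ℕ} [Fact p.Prime] {Λ : Type*} [Finite Λ] {σ : Λ → ℤ[X] →+* ZMod p}
    (hσ : Function.Injective σ) {k : ℕ} (φ : (α : Λ) → Fin (k + 1) → N →ₛₗ[σ α] ZMod p)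
    (e : Fin (k + 1) → N) {u : Λ → Fin (k + 1) → ZMod p} (hu : ∀ α j, u α j ≠ 0)
    (he : ∀ α j i, φ α j (e i) = if i = j then u α i else 0) :
    Nat.card Λ * p ^ k ≤ maxSubmoduleCount ℤ[X] N p := by
  classical
  let Φ : (α : Λ) → (Fin k → ZMod p) → N →ₛₗ[σ α] ZMod p := fun α c =>
    ∑ j, (Fin.cons 1 c : Fin (k + 1) → ZMod p) j • φ α j
  have hΦ : ∀ α c i, Φ α c (e i) = (Fin.cons 1 c : Fin (k + 1) → ZMod p) i * u α i := by
    intro α c i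
    simp [Φ, LinearMap.sum_apply, he]
  have hΦ0 : ∀ α c, Φ α c (e 0) = u α 0 := fun α c => by rw [hΦ]; simp
  have hne : ∀ α c, Φ α c ≠ 0 := fun α c h => hu α 0 (by rw [← hΦ0 α c, h, LinearMap.zero_apply])
  have := finite_coatoms (N := N) (Fact.out : p.Prime).ne_zero
  have hcard : Nat.card (Λ × (Fin k → ZMod p)) = Nat.card Λ * p ^ k := by
    simp [Nat.card_prod]
  rw [← hcard, maxSubmoduleCount]
  refine Nat.card_le_card_of_injective
    (fun x => ⟨LinearMap.ker (Φ x.1 x.2), isCoatom_ker_and_card_quotient (hne x.1 x.2)⟩) ?_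
  rintro ⟨α, c⟩ ⟨β, b⟩ h
  have hker : ∀ v, Φ α c v = 0 → Φ β b v = 0 := fun v hv =>
    (SetLike.ext_iff.1 (congrArg Subtype.val h) v).1 hv
  have hαβ : α = β := by
    refine hσ (RingHom.ext fun P => ?_)
    obtain ⟨t, ht⟩ := ZMod.intCast_surjective (σ α P)
    have h := hker (P • e 0 - t • e 0) (by
      rw [map_sub, map_smulₛₗ, map_zsmul, smul_eq_mul, zsmul_eq_mul, ht, sub_self])
    rw [map_sub, map_smulₛₗ, map_zsmul, smul_eq_mul, zsmul_eq_mul, ht, hΦ0, ← sub_mul] at h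
    exact (sub_eq_zero.1 ((mul_eq_zero.1 h).resolve_right (hu _ 0))).symm
  subst hαβ
  refine Prod.ext rfl (funext fun i => ?_)
  obtain ⟨t, ht⟩ := ZMod.intCast_surjective (c i * u α i.succ / u α 0)
  have h := hker (e i.succ - t • e 0) (by
    rw [map_sub, map_zsmul, zsmul_eq_mul, ht, hΦ0, div_mul_cancel₀ _ (hu _ 0), hΦ, Fin.cons_succ,
      sub_self])
  rw [map_sub, map_zsmul, zsmul_eq_mul, ht, hΦ0, div_mul_cancel₀ _ (hu _ 0), hΦ, Fin.cons_succ,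
    ← sub_mul] at h
  exact (sub_eq_zero.1 ((mul_eq_zero.1 h).resolve_right (hu _ _))).symm

theorem exists_numberField_card_root_eq (P : ℚ[X]) (hP : P ≠ 0) :
    ∃ (K : Type) (_ : Field K) (_ : NumberField K),
      Nat.card {x : K // aeval x P = 0} = (P.map (algebraMap ℚ ℂ)).roots.toFinset.card := by
  classical
  obtain ⟨K, hK, hA, hs⟩ : ∃ (K : Type) (_ : Field K) (_ : Algebra ℚ K),
      IsSplittingField ℚ K P :=
    ⟨P.SplittingField, inferInstance, _, IsSplittingField.splittingField P⟩
  have hchar : CharZero K := charZero_of_injective_algebraMap (algebraMap ℚ K).injective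
  obtain rfl : hA = DivisionRing.toRatAlgebra := Subsingleton.elim _ _
  have hfin : FiniteDimensional ℚ K := IsSplittingField.finiteDimensional K P
  refine ⟨K, hK, ⟨⟩, ?_⟩
  let φ : K →ₐ[ℚ] ℂ := IsAlgClosed.lift
  have hroots : (P.map (algebraMap ℚ ℂ)).roots =
      (P.map (algebraMap ℚ K)).roots.map (φ : K →+* ℂ) := by
    rw [← (IsSplittingField.splits K P).roots_map, Polynomial.map_map]
    congr 2
    exact φ.comp_algebraMap.symm
  rw [hroots, Multiset.toFinset_map, Finset.card_image_of_injective _ (φ : K →+* ℂ).injective]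
  have hmem : ∀ x : K, aeval x P = 0 ↔ x ∈ (P.map (algebraMap ℚ K)).roots.toFinset := fun x => by
    rw [Multiset.mem_toFinset, ← aroots_def, mem_aroots, and_iff_right hP]
  exact Nat.subtype_card _ fun x => (hmem x).symm

open NumberField in
theorem exists_ringHom_apply_ne_zero {K : Type*} [Field K] [NumberField K] {z : 𝓞 K}
    (hz : z ≠ 0) (m : ℕ) :
    ∃ p : ℕ, m < p ∧ p.Prime ∧ ∃ ψ : 𝓞 K →+* ZMod p, ψ z ≠ 0 := by
  have hn : Ideal.absNorm (Ideal.span {z}) ≠ 0 := by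
    rwa [Ne, Ideal.absNorm_eq_zero_iff, Ideal.span_singleton_eq_bot]
  obtain ⟨p, hpm, hp, ⟨ψ⟩⟩ :=
    exists_ringHom_ringOfIntegers_zmod K (max m (Ideal.absNorm (Ideal.span {z})))
  refine ⟨p, (le_max_left _ _).trans_lt hpm, hp, ψ, fun h => ?_⟩
  obtain ⟨y, hy⟩ := Ideal.mem_span_singleton.1 (Ideal.absNorm_mem (Ideal.span {z}))
  have h0 := congrArg ψ hy
  rw [map_mul, h, zero_mul, map_natCast, ZMod.natCast_eq_zero_iff] at h0
  exact ((le_max_right _ _).trans_lt hpm).not_ge (Nat.le_of_dvd (Nat.pos_of_ne_zero hn) h0)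

section
variable {N : Type*} [AddCommGroup N] [Module ℤ[X] N] {d : ℕ} {a : Fin d → ℚ[X]}
  {ι : N →ₛₗ[mapRingHom (Int.castRingHom ℚ)] ((j : Fin d) → ℚ[X] ⧸ Ideal.span {a j})}
  {e : Fin d → N} {m : Fin d → ℤ}

theorem exists_root_functional (he : ∀ i, ι (e i) = m i • Pi.single i 1) {K : Type*} [Field K]
    [Algebra ℚ K] {α : K} {j : Fin d} (hα : aeval α (a j) = 0) :
    ∃ π : N →ₛₗ[(aeval α : ℤ[X] →ₐ[ℤ] K).toRingHom] K,
      ∀ i, π (e i) = if i = j then (m i : K) else 0 := by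
  classical
  let ev : ℚ[X] ⧸ Ideal.span {a j} →+* K := Ideal.Quotient.lift _ (aeval α).toRingHom (by
    intro P hP
    obtain ⟨Q, rfl⟩ := Ideal.mem_span_singleton.1 hP
    simp [hα])
  refine ⟨⟨⟨fun v => ev (ι v j), fun v w => by simp⟩, fun P v => ?_⟩, fun i => ?_⟩
  · obtain ⟨Q, hQ⟩ := Ideal.Quotient.mk_surjective (ι v j)
    simp only [map_smulₛₗ, Pi.smul_apply, ← hQ]
    rw [← Ideal.Quotient.mk_eq_mk, ← Submodule.Quotient.mk_smul, smul_eq_mul,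
      Ideal.Quotient.mk_eq_mk, map_mul, map_mul, smul_eq_mul]
    congr 1
    exact (aeval_map_algebraMap ℚ α P)
  · change ev (ι (e i) j) = _
    rw [he]
    rcases eq_or_ne i j with rfl | h
    · simp
    · simp [h]

open NumberField in
theorem exists_integral_functional [Module.Finite ℤ N] (hm : ∀ i, m i ≠ 0)
    (he : ∀ i, ι (e i) = m i • Pi.single i 1) {K : Type*} [Field K]
    [NumberField K] {α : 𝓞 K} {j : Fin d} (hα : aeval (α : K) (a j) = 0) :
    ∃ (π : N →ₛₗ[(aeval α : ℤ[X] →ₐ[ℤ] 𝓞 K).toRingHom] 𝓞 K) (w : ℤ), w ≠ 0 ∧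
      ∀ i, π (e i) = if i = j then (w : 𝓞 K) else 0 := by
  obtain ⟨π, hπ⟩ := exists_root_functional he hα
  obtain ⟨D, hD, hint⟩ := exists_forall_zsmul_mem
    ((integralClosure ℤ K).toSubring.toAddSubgroup.comap π.toAddMonoidHom) fun v => by
      obtain ⟨c, hc, h⟩ := ((IsFractionRing.isAlgebraic_iff ℤ ℚ K).2
        (Algebra.IsAlgebraic.isAlgebraic (π v))).exists_integral_multiple
      refine ⟨c, hc, ?_⟩
      change IsIntegral ℤ (π (c • v))
      rwa [map_zsmul]
  replace hint : ∀ v, IsIntegral ℤ (π (D • v)) := hint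
  refine ⟨⟨⟨fun v => ⟨π (D • v), hint v⟩, fun v w => ?_⟩, fun P v => ?_⟩, D * m j,
    mul_ne_zero hD (hm j), fun i => ?_⟩
  · apply RingOfIntegers.coe_injective
    change π (D • (v + w)) = π (D • v) + π (D • w)
    rw [smul_add, map_add]
  · apply RingOfIntegers.coe_injective
    change π (D • P • v) = (algebraMap (𝓞 K) K) (aeval α P) * π (D • v)
    rw [smul_comm, map_smulₛₗ, ← aeval_algebraMap_apply]
    rfl
  · apply RingOfIntegers.coe_injective
    change π (D • e i) = _
    rw [map_zsmul, hπ]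
    split_ifs with h
    · simp [h]
    · simp

theorem isIntegral_root [Module.Finite ℤ N] (hm : ∀ i, m i ≠ 0)
    (he : ∀ i, ι (e i) = m i • Pi.single i 1) {K : Type*} [Field K] [CharZero K]
    [Algebra ℚ K] {α : K} {j : Fin d} (hα : aeval α (a j) = 0) : IsIntegral ℤ α := by
  obtain ⟨π, hπ⟩ := exists_root_functional he hα
  obtain ⟨P, hP, h⟩ := exists_monic_smul_eq_zero N
  refine ⟨P, hP, ?_⟩
  have h0 : π (P • e j) = 0 := by rw [h, map_zero]
  rw [map_smulₛₗ, hπ, if_pos rfl, smul_eq_mul] at h0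
  exact (mul_eq_zero.1 h0).resolve_right (Int.cast_ne_zero.2 (hm j))
end

open NumberField in
theorem exists_prime_card_mul_pow_le {N : Type*} [AddCommGroup N] [Module ℤ[X] N]
    [Module.Finite ℤ N] {k : ℕ} {a : Fin (k + 1) → ℚ[X]}
    {ι : N →ₛₗ[mapRingHom (Int.castRingHom ℚ)] ((j : Fin (k + 1)) → ℚ[X] ⧸ Ideal.span {a j})}
    {e : Fin (k + 1) → N} {m : Fin (k + 1) → ℤ} (hm : ∀ i, m i ≠ 0)
    (he : ∀ i, ι (e i) = m i • Pi.single i 1) (hdvd : ∀ j, a 0 ∣ a j) (b : ℕ) :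
    ∃ p : ℕ, b < p ∧ p.Prime ∧
      ((a 0).map (algebraMap ℚ ℂ)).roots.toFinset.card * p ^ k ≤ maxSubmoduleCount ℤ[X] N p := by
  classical
  have ha := ne_zero_of_finite (hm 0) (he 0)
  obtain ⟨K, _, _, hcard⟩ := exists_numberField_card_root_eq (a 0) ha
  rw [← hcard]
  have : Finite {x : K // aeval x (a 0) = 0} :=
    ((a 0).rootSet_finite K).subset fun x hx => (mem_rootSet_of_ne ha).2 hx
  let := Fintype.ofFinite {x : K // aeval x (a 0) = 0}
  let r : {x : K // aeval x (a 0) = 0} → 𝓞 K := fun α => ⟨α, isIntegral_root hm he α.2⟩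
  have hr : Function.Injective r := fun α β h => Subtype.ext (congrArg (algebraMap (𝓞 K) K) h)
  have hroot : ∀ α j, aeval (r α : K) (a j) = 0 := fun α j => by
    obtain ⟨Q, hQ⟩ := hdvd j
    rw [hQ, map_mul]
    exact mul_eq_zero_of_left α.2 _
  choose π w hw hπ using fun α j => exists_integral_functional hm he (hroot α j)
  obtain ⟨p, hbp, hp, ψ, hψ⟩ := exists_ringHom_apply_ne_zero
    (z := (∏ α, ∏ j, (w α j : 𝓞 K)) * ∏ x ∈ Finset.univ.offDiag, (r x.1 - r x.2))
    (mul_ne_zero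
      (Finset.prod_ne_zero_iff.2 fun α _ => Finset.prod_ne_zero_iff.2 fun j _ =>
        Int.cast_ne_zero.2 (hw α j))
      (Finset.prod_ne_zero_iff.2 fun x hx =>
        sub_ne_zero.2 (hr.ne (Finset.mem_offDiag.1 hx).2.2))) b
  refine ⟨p, hbp, hp, ?_⟩
  have : Fact p.Prime := ⟨hp⟩
  simp only [map_mul, map_prod, mul_ne_zero_iff, Finset.prod_ne_zero_iff, map_intCast] at hψ
  refine card_mul_pow_le_maxSubmoduleCount (σ := fun α => ψ.comp (aeval (r α)).toRingHom)
    (fun α β h => ?_) (fun α j => ?_) e (u := fun α j => (w α j : ZMod p))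
    (fun α j => hψ.1 α (Finset.mem_univ _) j (Finset.mem_univ _)) fun α j i => ?_
  · by_contra hne
    refine hψ.2 (α, β) (by simpa using hne) ?_
    have := congrArg (fun g : ℤ[X] →+* ZMod p => g X) h
    simpa [sub_eq_zero] using this
  · have : RingHomCompTriple (aeval (r α) : ℤ[X] →ₐ[ℤ] 𝓞 K).toRingHom ψ
      (ψ.comp (aeval (r α)).toRingHom) := ⟨rfl⟩
    exact ψ.toSemilinearMap.comp (π α j)
  · change ψ (π α j (e i)) = _
    rw [hπ]
    split_ifs with h
    · simp [h]
    · simp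

theorem exists_le_of_le_sum {k : ℕ} {ρ : Fin (k + 1) → ℕ} {g : ℕ → ℕ} {n₀ : ℕ}
    (hg : ∀ n, n₀ ≤ n → g n ≤ ∑ j : Fin (k + 1), ρ j * n ^ (k + 1 - 1 - (j : ℕ))) :
    ∃ C : ℝ, ∃ n₀ : ℕ, ∀ n : ℕ, n₀ ≤ n →
      (g n : ℝ) ≤ ρ 0 * (n : ℝ) ^ (((k + 1 : ℕ) : ℤ) - 1) +
        C * (n : ℝ) ^ (((k + 1 : ℕ) : ℤ) - 2) := by
  refine ⟨∑ j : Fin k, (ρ j.succ : ℝ), max n₀ 1, fun n hn => ?_⟩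
  have h1 : (1 : ℝ) ≤ n := by exact_mod_cast (le_max_right _ _).trans hn
  have h : (g n : ℝ) ≤ ∑ j : Fin (k + 1), ρ j * (n : ℝ) ^ (k + 1 - 1 - (j : ℕ)) := by
    exact_mod_cast hg n ((le_max_left _ _).trans hn)
  rw [Fin.sum_univ_succ] at h
  refine h.trans (add_le_add (by simp) ?_)
  rw [Finset.sum_mul]
  refine Finset.sum_le_sum fun j _ => mul_le_mul_of_nonneg_left ?_ (Nat.cast_nonneg _)
  rw [← zpow_natCast]
  refine zpow_le_zpow_right₀ h1 ?_
  have := j.2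
  simp only [Fin.val_succ]
  omega

theorem stmt17 {M : Type*} [AddCommGroup M]
    -- `M` is finitely generated as an abelian group, with `x` acting as `f`
    [Module.Finite ℤ M] (f : M →ₗ[ℤ] M)
    (d : ℕ) (hd : 0 < d) (a : Fin d → ℚ[X])
    (hdvd : ∀ i j : Fin d, i ≤ j → a i ∣ a j)
    (hnu : ¬ IsUnit (a ⟨0, hd⟩))
    -- `ℚ ⊗_ℤ M ≅ ⊕_{j=1}^d ℚ[x]/(a_j)` as `ℚ[x]`-modules
    (hiso : Nonempty ((Module.AEval' (f.baseChange ℚ)) ≃ₗ[ℚ[X]]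
      ((j : Fin d) → ℚ[X] ⧸ Ideal.span {a j})))
    (ρ₁ : ℕ)
    (hρ : ρ₁ = ((a ⟨0, hd⟩).map (algebraMap ℚ ℂ)).roots.toFinset.card) :
    (∃ C : ℝ, ∃ n₀ : ℕ, ∀ n : ℕ, n₀ ≤ n →
      (maxSubmoduleCount ℤ[X] (Module.AEval' f) n : ℝ) ≤
        ρ₁ * (n : ℝ) ^ ((d : ℤ) - 1) + C * (n : ℝ) ^ ((d : ℤ) - 2)) ∧
    (∀ m : ℕ, ∃ n : ℕ, m ≤ n ∧
      (ρ₁ : ℝ) * (n : ℝ) ^ ((d : ℤ) - 1) ≤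
        (maxSubmoduleCount ℤ[X] (Module.AEval' f) n : ℝ)) := by
  obtain ⟨k, rfl⟩ : ∃ k, d = k + 1 := ⟨d - 1, by omega⟩
  obtain ⟨Φ⟩ := hiso
  subst hρ
  have : Module.Finite ℤ (Module.AEval' f) :=
    Module.Finite.equiv (M := M) (Module.AEval'.of f)
  let ι := Φ.toLinearMap.comp (rationalize f)
  have hker : ∀ v, ι v = 0 → ∃ c : ℤ, c ≠ 0 ∧ c • v = 0 := fun v hv =>
    rationalize_eq_zero f v (Φ.map_eq_zero_iff.1 hv)
  choose m e hm he using fun j => exists_rationalize_eq f (Φ.symm (Pi.single j 1))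
  replace he : ∀ j, ι (e j) = m j • Pi.single j 1 := fun j => by
    change Φ (rationalize f (e j)) = _
    rw [he, map_zsmul, Φ.apply_symm_apply]
  refine ⟨?_, fun b => ?_⟩
  · choose c A hc hA hAe using fun j => exists_annihilating hker (he j)
    obtain ⟨D, hD, hspan⟩ := exists_forall_zsmul_mem
      (Submodule.span ℤ[X] (Set.range e)).toAddSubgroup (exists_zsmul_mem_span hker hm he)
    obtain ⟨n₀, hn₀⟩ := maxSubmoduleCount_le hD hspan hAe fun j =>
      exists_ncard_maximal_le (ne_zero_of_finite (hm j) (he j)) (hc j) (hA j)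
    exact exists_le_of_le_sum (ρ := fun j : Fin (k + 1) =>
      ((a j).map (algebraMap ℚ ℂ)).roots.toFinset.card) hn₀
  · obtain ⟨p, hbp, -, hp⟩ := exists_prime_card_mul_pow_le hm he
      (fun j => hdvd 0 j (Fin.zero_le j)) b
    refine ⟨p, hbp.le, ?_⟩
    rw [Nat.cast_add_one, add_sub_cancel_right, zpow_natCast]
    exact_mod_cast hp
end
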